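/- For any cardinal κ, the M-order ◁ on witness collections of Ramsey measures on κ is transitive and well-founded. -/

import Mathlib

noncomputable section

namespace MPaper

open ZFSet

attribute [local instance] Classical.propDecidable

/-! ### Basic set-theoretic vocabulary over `ZFSet` -/

/-- The (external) cardinality of a ZFC set. -/
def zcard (x : ZFSet) : Cardinal := Cardinal.mk x.toSet

/-- `x` is a von Neumann ordinal: a transitive set of transitive sets. -/
def IsOrd (x : ZFSet) : Prop := x.IsTransitive ∧ ∀ y ∈ x, ZFSet.IsTransitive y

/-- `κ` is a cardinal: an ordinal not equinumerous with any of its members. -/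
def IsCard (κ : ZFSet) : Prop := IsOrd κ ∧ ∀ α ∈ κ, zcard α < zcard κ

/-- The ordinal `κ⁺`, the cardinal successor of `κ`. -/
def cardSuccOrd (κ : ZFSet) : Ordinal := (Order.succ (zcard κ)).ord

/-- `f` is a set-coded function with domain `d` (a set of Kuratowski pairs). -/
def IsZFunc (d f : ZFSet) : Prop :=
  (∀ p ∈ f, ∃ a ∈ d, ∃ b, p = ZFSet.pair a b) ∧ ∀ a ∈ d, ∃! b, ZFSet.pair a b ∈ f

/-- Application of a set-coded function. -/
def fapp (f a : ZFSet) : ZFSet :=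
  ⋃₀ (ZFSet.sep (fun b => ZFSet.pair a b ∈ f) (⋃₀ (⋃₀ f)))

/-- `f` maps `d` into `y`. -/
def MapsInto (f d y : ZFSet) : Prop := ∀ a ∈ d, fapp f a ∈ y

/-- `f` maps `d` onto `y`. -/
def SurjOnto (f d y : ZFSet) : Prop := MapsInto f d y ∧ ∀ b ∈ y, ∃ a ∈ d, fapp f a = b

/-- `f` is injective on `d`. -/
def InjOnZ (f d : ZFSet) : Prop := ∀ a ∈ d, ∀ b ∈ d, fapp f a = fapp f b → a = b

/-- `f` is a bijection from `d` onto `y`. -/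
def IsBij (f d y : ZFSet) : Prop := IsZFunc d f ∧ SurjOnto f d y ∧ InjOnZ f d

/-- The tail `κ ∖ α = {ξ ∈ κ | α ≤ ξ}` (for ordinals `α ∈ κ`). -/
def tailSet (κ α : ZFSet) : ZFSet := ZFSet.sep (fun ξ => ξ ∉ α) κ

/-- The relative complement `κ ∖ A`. -/
def compl (κ A : ZFSet) : ZFSet := ZFSet.sep (fun ξ => ξ ∉ A) κ

/-! ### First-order satisfaction in ∈-structures -/

/-- First order formulas in the language of set theory, with variables indexed by `ℕ`. -/
inductive Fml : Type
  | mem : ℕ → ℕ → Fml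
  | eq : ℕ → ℕ → Fml
  | impl : Fml → Fml → Fml
  | neg : Fml → Fml
  | all : ℕ → Fml → Fml

/-- Tarskian satisfaction of a formula in the ∈-structure with domain `D`. -/
def Sat (D : Set ZFSet) : Fml → (ℕ → ZFSet) → Prop
  | .mem i j, v => v i ∈ v j
  | .eq i j, v => v i = v j
  | .impl φ ψ, v => Sat D φ v → Sat D ψ v
  | .neg φ, v => ¬ Sat D φ v
  | .all n φ, v => ∀ x ∈ D, Sat D φ (Function.update v n x)

/-- `D` is an elementary substructure of `E` (as ∈-structures). -/
def ElemSub (D E : Set ZFSet) : Prop :=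
  D ⊆ E ∧ ∀ (φ : Fml) (v : ℕ → ZFSet), (∀ n, v n ∈ D) → (Sat D φ v ↔ Sat E φ v)

/-- `r` is a well-ordering of `x` (coded as a set of Kuratowski pairs). -/
def IsWellOrderOn (x r : ZFSet) : Prop :=
  (∀ p ∈ r, ∃ a ∈ x, ∃ b ∈ x, p = ZFSet.pair a b) ∧
  (∀ a ∈ x, ∀ b ∈ x, a = b ∨ ZFSet.pair a b ∈ r ∨ ZFSet.pair b a ∈ r) ∧
  (∀ a ∈ x, ∀ b ∈ x, ∀ c ∈ x,
    ZFSet.pair a b ∈ r → ZFSet.pair b c ∈ r → ZFSet.pair a c ∈ r) ∧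
  (∀ a ∈ x, ZFSet.pair a a ∉ r) ∧
  (∀ S : Set ZFSet, S ⊆ x.toSet → S.Nonempty → ∃ a ∈ S, ∀ b ∈ S, ZFSet.pair b a ∉ r)

/-- A transitive model of `ZFC⁻` (ZFC minus power set): a transitive set closed under
pairing and union, containing `ω`, satisfying the separation and collection schemes for
first-order formulas, and choice in the guise of the well-ordering principle.
(Extensionality and foundation hold automatically in transitive sets.) -/
def IsTransModel (M : ZFSet) : Prop :=
  M.IsTransitive ∧
  ZFSet.omega ∈ M ∧
  (∀ x ∈ M, ∀ y ∈ M, ({x, y} : ZFSet) ∈ M) ∧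
  (∀ x ∈ M, (⋃₀ x : ZFSet) ∈ M) ∧
  (∀ (φ : Fml) (v : ℕ → ZFSet), (∀ n, v n ∈ M) → ∀ a ∈ M,
    ∃ b ∈ M, ∀ x, x ∈ b ↔ x ∈ a ∧ Sat M.toSet φ (Function.update v 0 x)) ∧
  (∀ (φ : Fml) (v : ℕ → ZFSet), (∀ n, v n ∈ M) → ∀ a ∈ M,
    (∀ x ∈ a, ∃ y ∈ M, Sat M.toSet φ (Function.update (Function.update v 0 x) 1 y)) →
    ∃ b ∈ M, ∀ x ∈ a, ∃ y ∈ b, Sat M.toSet φ (Function.update (Function.update v 0 x) 1 y)) ∧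
  (∀ x ∈ M, ∃ r ∈ M, IsWellOrderOn x r)

/-! ### Weak κ-models, κ-models, M-ultrafilters -/

/-- A weak `κ`-model: a transitive model of ZFC⁻ of size `κ` with `κ ∈ M`. -/
def IsWeakModel (κ M : ZFSet) : Prop :=
  IsTransModel M ∧ κ ∈ M ∧ zcard M = zcard κ

/-- `M` is closed under `<κ`-sequences (of its elements). -/
def SeqClosed (κ M : ZFSet) : Prop :=
  ∀ γ ∈ κ, ∀ f : ZFSet, IsZFunc γ f → (∀ a ∈ γ, fapp f a ∈ M) → f ∈ M

/-- A `κ`-model: a weak `κ`-model closed under `<κ`-sequences. -/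
def IsKappaModel (κ M : ZFSet) : Prop := IsWeakModel κ M ∧ SeqClosed κ M

/-- `U` is an `M`-ultrafilter on `κ`: `⟨M, ∈, U⟩` thinks `U` is a normal ultrafilter on `κ`
containing all tail sets. -/
def IsMUltrafilter (κ M U : ZFSet) : Prop :=
  (∀ A ∈ U, A ∈ M ∧ A ⊆ κ) ∧
  (∀ α ∈ κ, tailSet κ α ∈ U) ∧
  (∅ : ZFSet) ∉ U ∧
  (∀ A ∈ U, ∀ B ∈ U, A ∩ B ∈ U) ∧
  (∀ A ∈ U, ∀ B, B ∈ M → B ⊆ κ → A ⊆ B → B ∈ U) ∧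
  (∀ B, B ∈ M → B ⊆ κ → B ∈ U ∨ compl κ B ∈ U) ∧
  (∀ f ∈ M, IsZFunc κ f → ZFSet.sep (fun ξ => fapp f ξ ∈ ξ) κ ∈ U →
    ∃ γ ∈ κ, ZFSet.sep (fun ξ => fapp f ξ = γ) κ ∈ U)

/-- `U` is weakly amenable for `M`: for every `X ∈ M` of size at most `κ` in `M`,
the intersection `X ∩ U` belongs to `M`. -/
def WeaklyAmenable (κ M U : ZFSet) : Prop :=
  ∀ X ∈ M, (∃ f ∈ M.toSet, IsZFunc κ f ∧ ∀ y ∈ X, ∃ ξ ∈ κ, fapp f ξ = y) →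
    X ∩ U ∈ M

/-- `U` is `ω₁`-intersecting: every countable collection of its members has a common element. -/
def OmegaOneIntersecting (U : ZFSet) : Prop :=
  ∀ s : ℕ → ZFSet, (∀ n, s n ∈ U) → ∃ x, ∀ n, x ∈ s n

/-- `M` contains (its version of) `V_κ`, i.e. the set of all sets of rank `< κ`. -/
def HasVkappa (κ M : ZFSet) : Prop :=
  ∃ v ∈ M.toSet, ∀ x, x ∈ v ↔ ZFSet.rank x < ZFSet.rank κ

/-! ### Small universe measures and the associated models `M_U`, `N_U` -/

/-- `M` is the minimal model associated to `U` (the collection of Mostowski collapses of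
well-founded relations on `κ` coded by sets in `U` and their complements): a weak `κ`-model
with `V_κ ∈ M` for which `U` is an `M`-ultrafilter, contained in every transitive
ZFC⁻-model `M'` with `κ ∈ M'` for which `U` is an `M'`-ultrafilter. -/
def IsMUModel (κ U M : ZFSet) : Prop :=
  IsWeakModel κ M ∧ HasVkappa κ M ∧ IsMUltrafilter κ M U ∧
  ∀ M', IsTransModel M' → κ ∈ M' → IsMUltrafilter κ M' U → M ⊆ M'

/-- A small universe measure on `κ`: a set `U` of subsets of `κ` of size `κ` whose associated
minimal model `M_U` exists (is a weak `κ`-model with `V_κ ∈ M_U` and `U` an `M_U`-ultrafilter). -/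
def IsSUMeasure (κ U : ZFSet) : Prop :=
  zcard U = zcard κ ∧ (∀ A ∈ U, A ⊆ κ) ∧ ∃ M, IsMUModel κ U M

/-- The minimal model `M_U` associated to a small universe measure `U`. -/
def MU (κ U : ZFSet) : ZFSet :=
  if h : ∃ M, IsMUModel κ U M then h.choose else ∅

/-- `j : M → N` is (up to isomorphism) the ultrapower embedding of `M` by the
`M`-ultrafilter `U` on `κ`, with `N` transitive (so the ultrapower is well-founded):
`j` is elementary, every element of `N` has the form `j(f)(κ)` for `f : κ → M` in `M`,
and `U` is the `M`-ultrafilter derived from `j` with seed `κ`. -/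
def IsUltrapowerEmb (κ M U N : ZFSet) (j : ZFSet → ZFSet) : Prop :=
  N.IsTransitive ∧
  (∀ x ∈ M, j x ∈ N) ∧
  (∀ (φ : Fml) (v : ℕ → ZFSet), (∀ n, v n ∈ M) →
    (Sat M.toSet φ v ↔ Sat N.toSet φ (fun n => j (v n)))) ∧
  (∀ a ∈ N, ∃ f ∈ M.toSet, IsZFunc κ f ∧ MapsInto f κ M ∧ fapp (j f) κ = a) ∧
  (∀ A ∈ M, A ⊆ κ → (A ∈ U ↔ κ ∈ j A))

/-- The ultrapower of `M_U` by `U` is well-founded. -/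
def UltrapowerWF (κ U : ZFSet) : Prop :=
  ∃ (N : ZFSet) (j : ZFSet → ZFSet), IsUltrapowerEmb κ (MU κ U) U N j

/-- A choice of transitive collapse of the ultrapower of `M_U` by `U`, with its embedding. -/
def upData (κ U : ZFSet) : ZFSet × (ZFSet → ZFSet) :=
  if h : ∃ p : ZFSet × (ZFSet → ZFSet), IsUltrapowerEmb κ (MU κ U) U p.1 p.2
  then h.choose else (∅, id)

/-- `N_U`: the transitive collapse of the ultrapower of `M_U` by `U` (when well-founded). -/
def NU (κ U : ZFSet) : ZFSet := (upData κ U).1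

/-- The ultrapower embedding `j_U : M_U → N_U`. -/
def jU (κ U : ZFSet) : ZFSet → ZFSet := (upData κ U).2

/-- `M_U⋆ = V_{j(κ)}^{N_U}`, the rank-initial segment of `N_U` below `j_U(κ)`. -/
def MUstar (κ U : ZFSet) : ZFSet :=
  ZFSet.sep (fun x => ZFSet.rank x < ZFSet.rank (jU κ U κ)) (NU κ U)

/-! ### Hereditary size, `H_{κ⁺}`, elementarity -/

/-- `x` has hereditary size at most `κ`. -/
def HeredLE (κ : ZFSet) : ZFSet → Prop :=
  WellFounded.fix ZFSet.mem_wf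
    (fun x ih => zcard x ≤ zcard κ ∧ ∀ y, ∀ h : y ∈ x, ih y h)

/-- The class `H_{κ⁺}` of sets of hereditary size at most `κ`. -/
def Hclass (κ : ZFSet) : Set ZFSet := { x | HeredLE κ x }

/-! ### The measures witnessing Ramsey and Ramsey-like cardinals -/

/-- A Ramsey measure on `κ`: a weakly amenable `ω₁`-intersecting small universe measure. -/
def IsRamseyMeasure (κ U : ZFSet) : Prop :=
  IsSUMeasure κ U ∧ WeaklyAmenable κ (MU κ U) U ∧ OmegaOneIntersecting U

/-- A strong Ramsey measure on `κ`: a weakly amenable small universe measure whose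
minimal model `M_U` is a `κ`-model. -/
def IsStrongRamseyMeasure (κ U : ZFSet) : Prop :=
  IsSUMeasure κ U ∧ WeaklyAmenable κ (MU κ U) U ∧ SeqClosed κ (MU κ U)

/-- A super Ramsey measure on `κ`: a strong Ramsey measure with `M_U ≺ H_{κ⁺}`. -/
def IsSuperRamseyMeasure (κ U : ZFSet) : Prop :=
  IsStrongRamseyMeasure κ U ∧ ElemSub (MU κ U).toSet (Hclass κ)

/-- `I` certifies `U`: `I` is an unbounded subset of `κ` and the sets in `U` are exactly
the subsets of `κ` in `M_U` containing a tail of `I`. -/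
def Certifies (κ U : ZFSet) (I : Set ZFSet) : Prop :=
  (∀ ξ ∈ I, ξ ∈ κ) ∧ (∀ α ∈ κ, ∃ ξ ∈ I, ξ ∉ α) ∧
  ∀ X ∈ (MU κ U).toSet, X ⊆ κ →
    (X ∈ U ↔ ∃ α ∈ κ.toSet, ∀ ξ ∈ I, ξ ∉ α → ξ ∈ X)

/-- A certified Ramsey measure on `κ`: a weakly amenable small universe measure which is
certified by some unbounded `I ⊆ κ`. -/
def IsCertifiedRamseyMeasure (κ U : ZFSet) : Prop :=
  IsSUMeasure κ U ∧ WeaklyAmenable κ (MU κ U) U ∧ ∃ I : Set ZFSet, Certifies κ U I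

/-! ### Relativized (internal) versions of the measure predicates -/

/-- `ω₁`-intersecting from the point of view of the transitive model `N`: every
`ω`-sequence of members of `U` lying in `N` has a common element. -/
def OmegaOneIntersectingIn (N U : ZFSet) : Prop :=
  ∀ f ∈ N.toSet, IsZFunc ZFSet.omega f → (∀ n ∈ ZFSet.omega, fapp f n ∈ U) →
    ∃ x, ∀ n ∈ ZFSet.omega, x ∈ fapp f n

/-- `N ⊨ U is a Ramsey measure on κ`, for a transitive ZFC⁻-model `N`: all components are
absolute except `ω₁`-intersectingness, which is evaluated using sequences in `N`. -/
def RamseyMeasureIn (N κ U : ZFSet) : Prop :=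
  U ∈ N ∧ IsSUMeasure κ U ∧ WeaklyAmenable κ (MU κ U) U ∧ OmegaOneIntersectingIn N U

/-- `N ⊨ U is a strong Ramsey measure on κ`: closure of `M_U` under `<κ`-sequences is
evaluated using the sequences lying in `N`. -/
def StrongRamseyMeasureIn (N κ U : ZFSet) : Prop :=
  U ∈ N ∧ IsSUMeasure κ U ∧ WeaklyAmenable κ (MU κ U) U ∧
  ∀ f ∈ N.toSet, ∀ γ ∈ κ, IsZFunc γ f → (∀ a ∈ γ, fapp f a ∈ MU κ U) → f ∈ MU κ U

/-- The class `H_{κ⁺}` as computed in `N`. -/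
def HclassIn (N κ : ZFSet) : Set ZFSet := { x | x ∈ N ∧ HeredLE κ x }

/-- `N ⊨ U is a super Ramsey measure on κ`. -/
def SuperRamseyMeasureIn (N κ U : ZFSet) : Prop :=
  StrongRamseyMeasureIn N κ U ∧ ElemSub (MU κ U).toSet (HclassIn N κ)

/-- `N ⊨ U is a certified Ramsey measure on κ` (the certifying set is required to lie in `N`). -/
def CertifiedRamseyMeasureIn (N κ U : ZFSet) : Prop :=
  U ∈ N ∧ IsSUMeasure κ U ∧ WeaklyAmenable κ (MU κ U) U ∧
  ∃ I ∈ N.toSet, Certifies κ U I.toSet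

/-! ### Goodness, witness collections, and the M-order -/

/-- `U` is `A`-good: `A ∈ M_U`. -/
def AGood (κ A U : ZFSet) : Prop := A ∈ MU κ U

/-- A witness collection of `Pm`-measures on `κ`: a collection of `Pm`-measures containing
an `A`-good one for every `A ⊆ κ`. -/
def IsWitness (Pm : ZFSet → ZFSet → Prop) (κ : ZFSet) (𝒰 : Set ZFSet) : Prop :=
  (∀ U ∈ 𝒰, Pm κ U) ∧ ∀ A : ZFSet, A ⊆ κ → ∃ U ∈ 𝒰, AGood κ A U

/-- The M-order on witness collections of `Pm`-measures on `κ`; `PmIn N κ U` is the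
relativization `N ⊨ U is a Pm-measure on κ`.  `MOrder Pm PmIn κ 𝒰 𝒲` says `𝒰 ◁ 𝒲`. -/
def MOrder (Pm : ZFSet → ZFSet → Prop) (PmIn : ZFSet → ZFSet → ZFSet → Prop)
    (κ : ZFSet) (𝒰 𝒲 : Set ZFSet) : Prop :=
  IsWitness Pm κ 𝒰 ∧ IsWitness Pm κ 𝒲 ∧
  (∀ W ∈ 𝒲, ∀ A ∈ (NU κ W).toSet, A ⊆ κ →
    ∃ U ∈ 𝒰, U ∈ NU κ W ∧ AGood κ A U ∧ PmIn (NU κ W) κ U) ∧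
  (∀ U ∈ 𝒰, ∃ W ∈ 𝒲, U ∈ NU κ W)

/-! ### Ranks -/

/-- The rank of a point in an arbitrary binary relation (`0` at non-accessible points). -/
def relRank {X : Type*} (r : X → X → Prop) (x : X) : Ordinal :=
  if h : Acc r x then h.rank else 0

/-- The M-rank `o_Pm(κ)`: the strict supremum of the M-ranks of all witness collections of
`Pm`-measures on `κ` (and `0` if there are none). -/
def oRank (Pm : ZFSet → ZFSet → Prop) (PmIn : ZFSet → ZFSet → ZFSet → Prop)
    (κ : ZFSet) : Ordinal :=
  sSup { o : Ordinal |
    ∃ 𝒰 : Set ZFSet, IsWitness Pm κ 𝒰 ∧ o = relRank (MOrder Pm PmIn κ) 𝒰 + 1 }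

/-- `N ⊨ o_Pm(κ) ≥ α`, defined by the recursion: for every `A ⊆ κ` in `N` and every `β < α`
there is an `A`-good `Pm`-measure `W` in `N` (in the sense of `N`) whose ultrapower satisfies
`o_Pm(κ) ≥ β`. -/
def oGEin (PmIn : ZFSet → ZFSet → ZFSet → Prop) (κ : ZFSet) : Ordinal → ZFSet → Prop :=
  WellFounded.fix wellFounded_lt fun α ih N =>
    ∀ A ∈ N.toSet, A ⊆ κ → ∀ β, ∀ h : β < α,
      ∃ W ∈ N.toSet, PmIn N κ W ∧ AGood κ A W ∧ ih β h (NU κ W)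

/-- `N ⊨ o_Pm(κ) = α`. -/
def oEQin (PmIn : ZFSet → ZFSet → ZFSet → Prop) (κ : ZFSet) (α : Ordinal) (N : ZFSet) : Prop :=
  oGEin PmIn κ α N ∧ ¬ oGEin PmIn κ (α + 1) N

/-! ### The M-order and M-rank relativized to a model `ℳ` -/

/-- A witness collection (coded as a set) of `Pm`-measures in the sense of the model `ℳ`. -/
def IsWitnessIn (PmIn : ZFSet → ZFSet → ZFSet → Prop) (ℳ κ 𝒰 : ZFSet) : Prop :=
  𝒰 ∈ ℳ ∧ (∀ U ∈ 𝒰, PmIn ℳ κ U) ∧ ∀ A ∈ ℳ.toSet, A ⊆ κ → ∃ U ∈ 𝒰.toSet, AGood κ A U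

/-- The M-order on witness collections as computed in `ℳ`. -/
def MOrderIn (PmIn : ZFSet → ZFSet → ZFSet → Prop) (ℳ κ : ZFSet) (𝒰 𝒲 : ZFSet) : Prop :=
  IsWitnessIn PmIn ℳ κ 𝒰 ∧ IsWitnessIn PmIn ℳ κ 𝒲 ∧
  (∀ W ∈ 𝒲, ∀ A ∈ (NU κ W).toSet, A ⊆ κ →
    ∃ U ∈ 𝒰.toSet, U ∈ NU κ W ∧ AGood κ A U ∧ PmIn (NU κ W) κ U) ∧
  (∀ U ∈ 𝒰, ∃ W ∈ 𝒲.toSet, U ∈ NU κ W)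

/-- The M-rank `o_Pm(κ)` as computed in `ℳ`. -/
def oRankIn (PmIn : ZFSet → ZFSet → ZFSet → Prop) (ℳ κ : ZFSet) : Ordinal :=
  sSup { o : Ordinal |
    ∃ 𝒰 : ZFSet, IsWitnessIn PmIn ℳ κ 𝒰 ∧ o = relRank (MOrderIn PmIn ℳ κ) 𝒰 + 1 }

/-! ### Practical models, cover and approximation properties -/

/-- `ℳ` is practical for `κ`: a transitive ZFC⁻-model containing `κ` in which
`V_{κ+3}` exists. -/
def Practical (κ ℳ : ZFSet) : Prop :=
  IsTransModel ℳ ∧ κ ∈ ℳ ∧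
  ∃ v ∈ ℳ.toSet, ∀ x, x ∈ v ↔ (x ∈ ℳ ∧ ZFSet.rank x < ZFSet.rank κ + 3)

/-- `x` has size less than `δ` as witnessed inside the class `D`:
some `f ∈ D` injects `x` into an ordinal `γ ∈ δ`. -/
def SizeLTin (D : Set ZFSet) (x δ : ZFSet) : Prop :=
  ∃ γ ∈ δ.toSet, ∃ f ∈ D, IsZFunc x f ∧ MapsInto f x γ ∧ InjOnZ f x

/-- The pair `D ⊆ D'` has the `δ`-cover property. -/
def CoverProperty (δ : ZFSet) (D D' : Set ZFSet) : Prop :=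
  ∀ X ∈ D', X.toSet ⊆ D → SizeLTin D' X δ →
    ∃ Y ∈ D, X ⊆ Y ∧ SizeLTin D Y δ

/-- The pair `D ⊆ D'` has the `δ`-approximation property. -/
def ApproxProperty (δ : ZFSet) (D D' : Set ZFSet) : Prop :=
  ∀ X ∈ D', X.toSet ⊆ D → (∀ x ∈ D, SizeLTin D x δ → X ∩ x ∈ D) → X ∈ D

/-- `δ` is a cardinal from the point of view of the class `D`. -/
def IsCardIn (D : Set ZFSet) (δ : ZFSet) : Prop :=
  IsOrd δ ∧ δ ∈ D ∧ ∀ γ ∈ δ, ¬ ∃ f ∈ D, IsZFunc γ f ∧ SurjOnto f γ δ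

/-- `δ` is a regular (infinite) cardinal from the point of view of the class `D`. -/
def IsRegularIn (D : Set ZFSet) (δ : ZFSet) : Prop :=
  IsCardIn D δ ∧ ZFSet.omega ⊆ δ ∧
  ∀ γ ∈ δ, ∀ f ∈ D, IsZFunc γ f → MapsInto f γ δ →
    ∃ β ∈ δ, ∀ a ∈ γ, fapp f a ∈ β

/-- `H_λ` as computed in the model `V`: the members of `V` having, in `V`,
a transitive superset of size `< λ`. -/
def HIn (V lam : ZFSet) : Set ZFSet :=
  { x | x ∈ V ∧ ∃ t ∈ V.toSet, x ⊆ t ∧ t.IsTransitive ∧ SizeLTin V.toSet t lam }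

/-- `V` and `V'` have the same ordinals. -/
def SameOrdinals (D D' : Set ZFSet) : Prop :=
  ∀ α, IsOrd α → (α ∈ D ↔ α ∈ D')

/-- Every `ω`-sequence of elements of `ℳ` lying in `ℳ'` is an element of `ℳ`. -/
def OmegaSeqClosedPair (ℳ ℳ' : ZFSet) : Prop :=
  ∀ f ∈ ℳ'.toSet, IsZFunc ZFSet.omega f → (∀ n ∈ ZFSet.omega, fapp f n ∈ ℳ) → f ∈ ℳ

/-! ### Large cardinal properties -/

/-- `κ` is Ramsey: every `A ⊆ κ` belongs to a weak `κ`-model `M` carrying a weakly amenable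
`ω₁`-intersecting `M`-ultrafilter on `κ`. -/
def IsRamseyCard (κ : ZFSet) : Prop :=
  IsCard κ ∧ ∀ A : ZFSet, A ⊆ κ →
    ∃ M, IsWeakModel κ M ∧ A ∈ M ∧
      ∃ U, IsMUltrafilter κ M U ∧ WeaklyAmenable κ M U ∧ OmegaOneIntersecting U

/-- `κ` is strongly Ramsey: the model `M` can moreover be taken to be a `κ`-model. -/
def IsStronglyRamseyCard (κ : ZFSet) : Prop :=
  IsCard κ ∧ ∀ A : ZFSet, A ⊆ κ →
    ∃ M, IsKappaModel κ M ∧ A ∈ M ∧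
      ∃ U, IsMUltrafilter κ M U ∧ WeaklyAmenable κ M U ∧ OmegaOneIntersecting U

/-- `κ` is super Ramsey: the model `M` can moreover be taken to be a `κ`-model
elementary in `H_{κ⁺}`. -/
def IsSuperRamseyCard (κ : ZFSet) : Prop :=
  IsCard κ ∧ ∀ A : ZFSet, A ⊆ κ →
    ∃ M, IsKappaModel κ M ∧ ElemSub M.toSet (Hclass κ) ∧ A ∈ M ∧
      ∃ U, IsMUltrafilter κ M U ∧ WeaklyAmenable κ M U ∧ OmegaOneIntersecting U

/-- `κ` is weakly super Ramsey: the model `M` is a weak `κ`-model elementary in `H_{κ⁺}`. -/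
def IsWeaklySuperRamseyCard (κ : ZFSet) : Prop :=
  IsCard κ ∧ ∀ A : ZFSet, A ⊆ κ →
    ∃ M, IsWeakModel κ M ∧ ElemSub M.toSet (Hclass κ) ∧ A ∈ M ∧
      ∃ U, IsMUltrafilter κ M U ∧ WeaklyAmenable κ M U ∧ OmegaOneIntersecting U

/-- `κ` is measurable: there is a `κ`-complete nonprincipal ultrafilter on (all) subsets
of `κ`. -/
def IsMeasurableCard (κ : ZFSet) : Prop :=
  IsCard κ ∧ ZFSet.omega ∈ κ ∧
  ∃ 𝒰 : Set ZFSet,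
    (∀ A ∈ 𝒰, A ⊆ κ) ∧ (∅ : ZFSet) ∉ 𝒰 ∧ κ ∈ 𝒰 ∧
    (∀ A ∈ 𝒰, ∀ B : ZFSet, B ⊆ κ → A ⊆ B → B ∈ 𝒰) ∧
    (∀ A : ZFSet, A ⊆ κ → (A ∈ 𝒰 ∨ compl κ A ∈ 𝒰)) ∧
    (∀ γ ∈ κ.toSet, ∀ s : ZFSet → ZFSet, (∀ i ∈ γ, s i ∈ 𝒰) →
      ZFSet.sep (fun ξ => ∀ i ∈ γ, ξ ∈ s i) κ ∈ 𝒰)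

/-! ### Relativized large-cardinal properties -/

/-- `N ⊨ κ is Ramsey` (for a transitive model `N`): the witnessing models and ultrafilters
lie in `N`, smallness of the models is witnessed in `N`, and `ω₁`-intersectingness is
evaluated using the sequences in `N`. -/
def RamseyCardIn (N κ : ZFSet) : Prop :=
  ∀ A ∈ N.toSet, A ⊆ κ →
    ∃ M ∈ N.toSet, A ∈ M ∧ IsTransModel M ∧ κ ∈ M ∧
      (∃ f ∈ N.toSet, IsZFunc κ f ∧ SurjOnto f κ M) ∧
      ∃ U ∈ N.toSet, IsMUltrafilter κ M U ∧ WeaklyAmenable κ M U ∧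
        OmegaOneIntersectingIn N U

/-- `N ⊨ κ is strongly Ramsey`. -/
def StronglyRamseyCardIn (N κ : ZFSet) : Prop :=
  ∀ A ∈ N.toSet, A ⊆ κ →
    ∃ M ∈ N.toSet, A ∈ M ∧ IsTransModel M ∧ κ ∈ M ∧
      (∃ f ∈ N.toSet, IsZFunc κ f ∧ SurjOnto f κ M) ∧
      (∀ f ∈ N.toSet, ∀ γ ∈ κ, IsZFunc γ f → (∀ a ∈ γ, fapp f a ∈ M) → f ∈ M) ∧
      ∃ U ∈ N.toSet, IsMUltrafilter κ M U ∧ WeaklyAmenable κ M U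

/-- `N ⊨ κ is super Ramsey`. -/
def SuperRamseyCardIn (N κ : ZFSet) : Prop :=
  ∀ A ∈ N.toSet, A ⊆ κ →
    ∃ M ∈ N.toSet, A ∈ M ∧ IsTransModel M ∧ κ ∈ M ∧
      (∃ f ∈ N.toSet, IsZFunc κ f ∧ SurjOnto f κ M) ∧
      (∀ f ∈ N.toSet, ∀ γ ∈ κ, IsZFunc γ f → (∀ a ∈ γ, fapp f a ∈ M) → f ∈ M) ∧
      ElemSub M.toSet (HclassIn N κ) ∧
      ∃ U ∈ N.toSet, IsMUltrafilter κ M U ∧ WeaklyAmenable κ M U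

/-! ### ω-special models -/

/-- A weak `κ`-model `M` is `ω`-special: it is the union of a chain
`M₀ ≺ M₁ ≺ ⋯` of elementary substructures of `M` with each `Mₙ ∈ M` and `|Mₙ|^M = κ`. -/
def OmegaSpecial (κ M : ZFSet) : Prop :=
  ∃ s : ℕ → ZFSet,
    (∀ n, s n ∈ M) ∧
    (∀ n, (s n).toSet ⊆ (s (n + 1)).toSet) ∧
    (∀ n, ElemSub (s n).toSet M.toSet) ∧
    (∀ n, ∃ f ∈ M.toSet, IsBij f κ (s n)) ∧
    (∀ x, x ∈ M ↔ ∃ n, x ∈ s n)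

/-! ### Iterated ultrapowers and α-iterability -/

/-- `U` is an `α`-iterable `M`-ultrafilter on `κ`: there is a coherent system of transitive
models `Mod β` (`β ≤ α`), with commuting elementary embeddings `e β γ : Mod β → Mod γ`,
critical sequence `cr β` and ultrafilter sequence `Us β`, starting at `(M, κ, U)`, where each
successor step is given by an ultrapower and each limit step is a (collapsed) direct limit. -/
def IsAlphaIterable (κ M U : ZFSet) (α : Ordinal) : Prop :=
  ∃ (Mod : Ordinal → ZFSet) (cr : Ordinal → ZFSet) (Us : Ordinal → ZFSet)
    (e : Ordinal → Ordinal → ZFSet → ZFSet),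
    Mod 0 = M ∧ cr 0 = κ ∧ Us 0 = U ∧
    (∀ β ≤ α, (Mod β).IsTransitive) ∧
    (∀ β ≤ α, ∀ x ∈ Mod β, e β β x = x) ∧
    (∀ β γ ρ : Ordinal, β ≤ γ → γ ≤ ρ → ρ ≤ α →
      ∀ x ∈ Mod β, e γ ρ (e β γ x) = e β ρ x) ∧
    (∀ β γ : Ordinal, β ≤ γ → γ ≤ α →
      (∀ x ∈ Mod β, e β γ x ∈ Mod γ) ∧
      ∀ (φ : Fml) (v : ℕ → ZFSet), (∀ n, v n ∈ Mod β) →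
        (Sat (Mod β).toSet φ v ↔ Sat (Mod γ).toSet φ (fun n => e β γ (v n)))) ∧
    (∀ β : Ordinal, β + 1 ≤ α →
      IsUltrapowerEmb (cr β) (Mod β) (Us β) (Mod (β + 1)) (e β (β + 1)) ∧
      cr (β + 1) = e β (β + 1) (cr β) ∧
      (∀ A, A ∈ Us (β + 1) ↔
        ∃ X ∈ (Mod β).toSet, X ∩ Us β ∈ Mod β ∧ A ∈ e β (β + 1) (X ∩ Us β))) ∧
    (∀ lam : Ordinal, lam ≤ α → lam ≠ 0 → (∀ β < lam, β + 1 < lam) →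
      (∀ x ∈ Mod lam, ∃ β < lam, ∃ y ∈ (Mod β).toSet, e β lam y = x) ∧
      cr lam = e 0 lam κ ∧
      (∀ A, A ∈ Us lam ↔ ∃ β < lam, ∃ B, B ∈ Us β ∧ e β lam B = A))

/-- `N ⊨ κ is α-iterable`: every `A ⊆ κ` in `N` belongs to a weak `κ`-model `M ∈ N` for
which there is a weakly amenable `α`-iterable `M`-ultrafilter `U ∈ N` on `κ`. -/
def AlphaIterableCardIn (N κ : ZFSet) (α : Ordinal) : Prop :=
  ∀ A ∈ N.toSet, A ⊆ κ →
    ∃ M ∈ N.toSet, A ∈ M ∧ IsTransModel M ∧ κ ∈ M ∧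
      (∃ f ∈ N.toSet, IsZFunc κ f ∧ SurjOnto f κ M) ∧
      ∃ U ∈ N.toSet, IsMUltrafilter κ M U ∧ WeaklyAmenable κ M U ∧
        IsAlphaIterable κ M U α

/-! ### Forcing -/

/-- `R` codes a partial order (of forcing conditions) on `P`: `pair p q ∈ R` means `p ≤ q`. -/
def IsPoset (P R : ZFSet) : Prop :=
  (∀ p ∈ R, ∃ a ∈ P, ∃ b ∈ P, p = ZFSet.pair a b) ∧
  (∀ p ∈ P, ZFSet.pair p p ∈ R) ∧
  (∀ p ∈ P, ∀ q ∈ P, ∀ r ∈ P,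
    ZFSet.pair p q ∈ R → ZFSet.pair q r ∈ R → ZFSet.pair p r ∈ R)

/-- `G` is an `ℳ`-generic filter on the poset `(P, R)`. -/
def IsGenericFilter (ℳ P R : ZFSet) (G : Set ZFSet) : Prop :=
  G ⊆ P.toSet ∧ G.Nonempty ∧
  (∀ p ∈ G, ∀ q ∈ G, ∃ r ∈ G, ZFSet.pair r p ∈ R ∧ ZFSet.pair r q ∈ R) ∧
  (∀ p ∈ G, ∀ q ∈ P.toSet, ZFSet.pair p q ∈ R → q ∈ G) ∧
  ∀ Dset ∈ ℳ.toSet, Dset ⊆ P →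
    (∀ p ∈ P.toSet, ∃ q ∈ Dset.toSet, ZFSet.pair q p ∈ R) →
    ∃ q ∈ G, q ∈ Dset

/-- `ℳ'` is the generic extension `ℳ[G]`: the least transitive ZFC⁻-model containing `ℳ`
and (a set coding) `G`, with the same ordinals as `ℳ`. -/
def IsGenericExt (ℳ ℳ' : ZFSet) (G : Set ZFSet) : Prop :=
  IsTransModel ℳ' ∧ ℳ ⊆ ℳ' ∧ (∃ g ∈ ℳ'.toSet, g.toSet = G) ∧
  SameOrdinals ℳ.toSet ℳ'.toSet ∧
  ∀ N', IsTransModel N' → ℳ ⊆ N' → (∃ g ∈ N'.toSet, g.toSet = G) → ℳ' ⊆ N'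

/-- `f ∈ D` is a cofinal map from `γ` into the ordinal `α`. -/
def CofinalMapIn (D : Set ZFSet) (γ α f : ZFSet) : Prop :=
  f ∈ D ∧ IsZFunc γ f ∧ MapsInto f γ α ∧
  ∀ b ∈ α, ∃ a ∈ γ, b ∈ fapp f a ∨ b = fapp f a

/-- `γ` is the cofinality of the ordinal `α` as computed in `D`. -/
def IsCofIn (D : Set ZFSet) (α γ : ZFSet) : Prop :=
  IsOrd γ ∧ (∃ f, CofinalMapIn D γ α f) ∧ ∀ γ' ∈ γ, ¬ ∃ f, CofinalMapIn D γ' α f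

/-- The pair `ℳ ⊆ ℳ'` preserves all cofinalities. -/
def PreservesCofinalities (ℳ ℳ' : ZFSet) : Prop :=
  ∀ α ∈ ℳ.toSet, IsOrd α → ∀ γ, (IsCofIn ℳ.toSet α γ ↔ IsCofIn ℳ'.toSet α γ)

section Helpers


theorem mem_toSet_iff {x M : ZFSet} : x ∈ M.toSet ↔ x ∈ M := Iff.rfl

/-- Renaming of all variables of a formula. -/
def Fml.ren (ρ : ℕ → ℕ) : Fml → Fml
  | .mem i j => .mem (ρ i) (ρ j)
  | .eq i j => .eq (ρ i) (ρ j)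
  | .impl φ ψ => .impl (φ.ren ρ) (ψ.ren ρ)
  | .neg φ => .neg (φ.ren ρ)
  | .all n φ => .all (ρ n) (φ.ren ρ)

theorem sat_ren {D : Set ZFSet} {ρ : ℕ → ℕ} (hρ : Function.Injective ρ) (φ : Fml) :
    ∀ v : ℕ → ZFSet, Sat D (φ.ren ρ) v ↔ Sat D φ (fun n => v (ρ n)) := by
  induction φ with
  | mem i j => intro v; rfl
  | eq i j => intro v; rfl
  | impl φ ψ h1 h2 => intro v; simp only [Fml.ren, Sat, h1, h2]
  | neg φ h => intro v; simp only [Fml.ren, Sat, h]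
  | all n φ h =>
    intro v
    simp only [Fml.ren, Sat, h]
    have : ∀ x, (fun k => Function.update v (ρ n) x (ρ k)) =
        Function.update (fun k => v (ρ k)) n x := by
      intro x; funext k
      by_cases hk : k = n
      · subst hk; simp
      · simp [Function.update_of_ne hk, Function.update_of_ne (fun h => hk (hρ h))]
    simp only [this]

/-- Interleaving of a valuation `v` and a sequence of parameters `w`. -/
def mix (v w : ℕ → ZFSet) (n : ℕ) : ZFSet := if n % 2 = 0 then v (n / 2) else w (n / 2)

theorem mix_even (v w : ℕ → ZFSet) (n : ℕ) : mix v w (2 * n) = v n := by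
  simp [mix]

theorem mix_odd (v w : ℕ → ZFSet) (n : ℕ) : mix v w (2 * n + 1) = w n := by
  have h1 : (2 * n + 1) % 2 = 1 := by omega
  have h2 : (2 * n + 1) / 2 = n := by omega
  simp [mix, h1, h2]

theorem even_odd_cases {p : ℕ → Prop} (h0 : ∀ n, p (2 * n)) (h1 : ∀ n, p (2 * n + 1)) (n : ℕ) :
    p n := by
  rcases Nat.even_or_odd' n with ⟨k, rfl | rfl⟩
  · exact h0 k
  · exact h1 k

theorem mix_mem {T : ZFSet} {v w : ℕ → ZFSet} (hv : ∀ n, v n ∈ T) (hw : ∀ n, w n ∈ T) :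
    ∀ n, mix v w n ∈ T :=
  even_odd_cases (fun n => by rw [mix_even]; exact hv n) (fun n => by rw [mix_odd]; exact hw n)

/-- The renaming acting by `a` on even numbers and by `b` on odd numbers. -/
def eo (a b : ℕ → ℕ) (n : ℕ) : ℕ := if n % 2 = 0 then a (n / 2) else b (n / 2)

theorem eo_even (a b : ℕ → ℕ) (n : ℕ) : eo a b (2 * n) = a n := by simp [eo]

theorem eo_odd (a b : ℕ → ℕ) (n : ℕ) : eo a b (2 * n + 1) = b n := by
  have h1 : (2 * n + 1) % 2 = 1 := by omega
  have h2 : (2 * n + 1) / 2 = n := by omega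
  simp [eo, h1, h2]

theorem eo_inj {a b : ℕ → ℕ} (ha : Function.Injective a) (hb : Function.Injective b)
    (hab : ∀ m n, a m ≠ b n) : Function.Injective (eo a b) := by
  intro m n
  rcases Nat.even_or_odd' m with ⟨m, rfl | rfl⟩ <;>
    rcases Nat.even_or_odd' n with ⟨n, rfl | rfl⟩ <;>
    simp only [eo_even, eo_odd] <;> intro h
  · rw [ha h]
  · exact absurd h (hab _ _)
  · exact absurd h.symm (hab _ _)
  · rw [hb h]

/-- Predicates on valuations definable over `T` with parameters. -/
def Dfn (T : ZFSet) (P : (ℕ → ZFSet) → Prop) : Prop :=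
  ∃ (φ : Fml) (w : ℕ → ZFSet), (∀ n, w n ∈ T) ∧
    ∀ v : ℕ → ZFSet, (∀ n, v n ∈ T) → (Sat T.toSet φ (mix v w) ↔ P v)

/-- Prepending an element to a valuation. -/
def vcons (x : ZFSet) (v : ℕ → ZFSet) : ℕ → ZFSet
  | 0 => x
  | n + 1 => v n

theorem vcons_mem {T x : ZFSet} {v : ℕ → ZFSet} (hx : x ∈ T) (hv : ∀ n, v n ∈ T) :
    ∀ n, vcons x v n ∈ T
  | 0 => hx
  | n + 1 => hv n

namespace Dfn

variable {T : ZFSet} {P Q : (ℕ → ZFSet) → Prop}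

theorem congr (h : Dfn T P) (hPQ : ∀ v, (∀ n, v n ∈ T) → (P v ↔ Q v)) : Dfn T Q := by
  obtain ⟨φ, w, hw, h⟩ := h
  exact ⟨φ, w, hw, fun v hv => (h v hv).trans (hPQ v hv)⟩

theorem not (h : Dfn T P) : Dfn T (fun v => ¬ P v) := by
  obtain ⟨φ, w, hw, h⟩ := h
  exact ⟨.neg φ, w, hw, fun v hv => not_congr (h v hv)⟩

theorem imp (h : Dfn T P) (h' : Dfn T Q) : Dfn T (fun v => P v → Q v) := by
  obtain ⟨φ, w, hw, h⟩ := h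
  obtain ⟨ψ, w', hw', h'⟩ := h'
  have i1 : Function.Injective (eo (fun n => 2 * n) (fun n => 2 * (2 * n) + 1)) :=
    eo_inj (fun a b => by simp) (fun a b => by simp) (fun m n => by omega)
  have i2 : Function.Injective (eo (fun n => 2 * n) (fun n => 2 * (2 * n + 1) + 1)) :=
    eo_inj (fun a b => by simp) (fun a b => by simp) (fun m n => by omega)
  refine ⟨.impl (φ.ren (eo (fun n => 2 * n) (fun n => 2 * (2 * n) + 1)))
    (ψ.ren (eo (fun n => 2 * n) (fun n => 2 * (2 * n + 1) + 1))), mix w w',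
    mix_mem hw hw', fun v hv => ?_⟩
  have e1 : (fun n => mix v (mix w w') (eo (fun n => 2 * n) (fun n => 2 * (2 * n) + 1) n))
      = mix v w := by
    funext n
    rcases Nat.even_or_odd' n with ⟨n, rfl | rfl⟩
    · rw [eo_even, mix_even, mix_even]
    · rw [eo_odd, mix_odd, mix_odd, mix_even]
  have e2 : (fun n => mix v (mix w w') (eo (fun n => 2 * n) (fun n => 2 * (2 * n + 1) + 1) n))
      = mix v w' := by
    funext n
    rcases Nat.even_or_odd' n with ⟨n, rfl | rfl⟩
    · rw [eo_even, mix_even, mix_even]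
    · rw [eo_odd, mix_odd, mix_odd, mix_odd]
  simp only [Sat, sat_ren i1, sat_ren i2, e1, e2, h v hv, h' v hv]

theorem all {P : (ℕ → ZFSet) → ZFSet → Prop}
    (h : Dfn T (fun v => P (fun n => v (n + 1)) (v 0))) : Dfn T (fun v => ∀ x ∈ T, P v x) := by
  obtain ⟨φ, w, hw, h⟩ := h
  have i1 : Function.Injective (eo (fun n => if n = 0 then 1 else 2 * (n - 1))
      (fun n => 2 * (n + 1) + 1)) := by
    refine eo_inj (fun a b => ?_) (fun a b => by simp) (fun m n => ?_)
    · split_ifs <;> omega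
    · split_ifs <;> omega
  refine ⟨.all 1 (φ.ren (eo (fun n => if n = 0 then 1 else 2 * (n - 1))
      (fun n => 2 * (n + 1) + 1))), vcons (w 0) w, vcons_mem (hw 0) hw, fun v hv => ?_⟩
  simp only [Sat, sat_ren i1]
  refine forall_congr' fun x => forall_congr' fun hx => ?_
  have hx : x ∈ T := hx
  have e1 : (fun n => Function.update (mix v (vcons (w 0) w)) 1 x
      (eo (fun n => if n = 0 then 1 else 2 * (n - 1)) (fun n => 2 * (n + 1) + 1) n))
      = mix (vcons x v) w := by
    funext n
    rcases Nat.even_or_odd' n with ⟨n, rfl | rfl⟩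
    · rw [eo_even, mix_even]
      cases n with
      | zero => simp [vcons]
      | succ n =>
        have : (2 * (n + 1 - 1)) ≠ 1 := by omega
        simp [mix_even, vcons]
    · rw [eo_odd, mix_odd, Function.update_of_ne (by omega), mix_odd]; rfl
  rw [e1, h _ (vcons_mem hx hv)]
  rfl

theorem rename (h : Dfn T P) {ρ : ℕ → ℕ} (hρ : Function.Injective ρ) :
    Dfn T (fun v => P (fun n => v (ρ n))) := by
  obtain ⟨φ, w, hw, h⟩ := h
  have i1 : Function.Injective (eo (fun n => 2 * ρ n) (fun n => 2 * n + 1)) :=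
    eo_inj (fun a b hab => hρ (by simpa using hab)) (fun a b => by simp) (fun m n => by omega)
  refine ⟨φ.ren (eo (fun n => 2 * ρ n) (fun n => 2 * n + 1)), w, hw, fun v hv => ?_⟩
  beta_reduce
  rw [sat_ren i1, ← h _ (fun n => hv (ρ n))]
  have e1 : (fun n => mix v w (eo (fun n => 2 * ρ n) (fun n => 2 * n + 1) n))
      = mix (fun n => v (ρ n)) w := by
    funext n
    rcases Nat.even_or_odd' n with ⟨n, rfl | rfl⟩
    · rw [eo_even, mix_even, mix_even]
    · rw [eo_odd, mix_odd, mix_odd]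
  rw [e1]

theorem and (h : Dfn T P) (h' : Dfn T Q) : Dfn T (fun v => P v ∧ Q v) :=
  (h.imp h'.not).not.congr (fun v _ => by tauto)

theorem or (h : Dfn T P) (h' : Dfn T Q) : Dfn T (fun v => P v ∨ Q v) :=
  (h.not.imp h').congr (fun v _ => by tauto)

theorem iff (h : Dfn T P) (h' : Dfn T Q) : Dfn T (fun v => P v ↔ Q v) :=
  ((h.imp h').and (h'.imp h)).congr (fun v _ => by tauto)

theorem ex {P : (ℕ → ZFSet) → ZFSet → Prop}
    (h : Dfn T (fun v => P (fun n => v (n + 1)) (v 0))) : Dfn T (fun v => ∃ x ∈ T, P v x) :=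
  (Dfn.all (P := fun v x => ¬ P v x) h.not).not.congr (fun v _ => by push Not; rfl)

theorem var_mem {a : ZFSet} (ha : a ∈ T) (i j : ℕ) : Dfn T (fun v => v i ∈ v j) :=
  ⟨.mem (2 * i) (2 * j), fun _ => a, fun _ => ha, fun v _ => by simp [Sat, mix_even]⟩

theorem var_eq {a : ZFSet} (ha : a ∈ T) (i j : ℕ) : Dfn T (fun v => v i = v j) :=
  ⟨.eq (2 * i) (2 * j), fun _ => a, fun _ => ha, fun v _ => by simp [Sat, mix_even]⟩

theorem eq_const {a : ZFSet} (ha : a ∈ T) (i : ℕ) : Dfn T (fun v => v i = a) :=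
  ⟨.eq (2 * i) (2 * 0 + 1), fun _ => a, fun _ => ha,
    fun v _ => by simp only [Sat, mix_even, mix_odd]⟩

end Dfn

/-- Definable functions on valuations. -/
def DT (T : ZFSet) (t : (ℕ → ZFSet) → ZFSet) : Prop :=
  Dfn T (fun v => v 0 = t (fun n => v (n + 1))) ∧ ∀ v : ℕ → ZFSet, (∀ n, v n ∈ T) → t v ∈ T

theorem DT.var {T a : ZFSet} (ha : a ∈ T) (i : ℕ) : DT T (fun v => v i) :=
  ⟨Dfn.var_eq ha 0 (i + 1), fun _ hv => hv i⟩

theorem DT.const {T a : ZFSet} (ha : a ∈ T) : DT T (fun _ => a) :=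
  ⟨Dfn.eq_const ha 0, fun _ _ => ha⟩

theorem succ_inj2 : Function.Injective (fun n : ℕ => if n = 0 then 0 else n + 1) := by
  intro a b h
  have h : (if a = 0 then 0 else a + 1) = (if b = 0 then 0 else b + 1) := h
  split_ifs at h <;> omega

theorem DT.weak {T : ZFSet} {t : (ℕ → ZFSet) → ZFSet} (h : DT T t) :
    DT T (fun v => t (fun n => v (n + 1))) :=
  ⟨(h.1.rename succ_inj2).congr (fun v _ => by simp), fun v hv => h.2 _ (fun n => hv (n + 1))⟩

theorem DT.mem {T : ZFSet} {t s : (ℕ → ZFSet) → ZFSet} (ht : DT T t) (hs : DT T s) :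
    Dfn T (fun v => t v ∈ s v) := by
  by_cases hT : ∃ a, a ∈ T
  · obtain ⟨a, ha⟩ := hT
    have : Dfn T (fun v => ∃ x ∈ T, ∃ y ∈ T, y = s v ∧ (x = t v ∧ x ∈ y)) := by
      apply Dfn.ex
      apply Dfn.ex
      refine hs.weak.1.and (Dfn.and ?_ (Dfn.var_mem ha 1 0))
      exact (ht.1.rename (ρ := fun n => n + 1) (fun a b => by simp))
    refine this.congr (fun v hv => ?_)
    constructor
    · rintro ⟨x, hx, y, hy, rfl, rfl, h⟩; exact h
    · intro h; exact ⟨_, ht.2 v hv, _, hs.2 v hv, rfl, rfl, h⟩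
  · exact ⟨.mem 0 0, fun _ => ∅, fun _ => (hT ⟨_, hs.2 (fun _ => ∅) (fun _ => by
      exfalso
      obtain ⟨φ, w, hw, _⟩ := ht.1
      exact hT ⟨_, hw 0⟩)⟩).elim, fun v hv => (hT ⟨_, hv 0⟩).elim⟩

theorem DT.eq {T : ZFSet} {t s : (ℕ → ZFSet) → ZFSet} (ht : DT T t) (hs : DT T s) :
    Dfn T (fun v => t v = s v) := by
  have : Dfn T (fun v => ∃ x ∈ T, x = t v ∧ x = s v) := by
    apply Dfn.ex
    exact ht.1.and hs.1
  refine this.congr (fun v hv => ?_)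
  constructor
  · rintro ⟨x, hx, rfl, h⟩; exact h
  · intro h; exact ⟨_, ht.2 v hv, rfl, h⟩

theorem DT.ball {T : ZFSet} (tr : T.IsTransitive) {s : (ℕ → ZFSet) → ZFSet} (hs : DT T s)
    {P : (ℕ → ZFSet) → ZFSet → Prop} (h : Dfn T (fun v => P (fun n => v (n + 1)) (v 0))) :
    Dfn T (fun v => ∀ x ∈ s v, P v x) := by
  obtain ⟨a, ha⟩ : ∃ a, a ∈ T := by
    obtain ⟨φ, w, hw, _⟩ := h
    exact ⟨_, hw 0⟩
  have : Dfn T (fun v => ∀ x ∈ T, x ∈ s v → P v x) := by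
    apply Dfn.all
    exact ((DT.var ha 0).mem hs.weak).imp h
  refine this.congr (fun v hv => ?_)
  exact ⟨fun H x hx => H x (tr _ (hs.2 v hv) hx) hx, fun H x _ hx => H x hx⟩

theorem DT.bex {T : ZFSet} (tr : T.IsTransitive) {s : (ℕ → ZFSet) → ZFSet} (hs : DT T s)
    {P : (ℕ → ZFSet) → ZFSet → Prop} (h : Dfn T (fun v => P (fun n => v (n + 1)) (v 0))) :
    Dfn T (fun v => ∃ x ∈ s v, P v x) :=
  (DT.ball tr hs (P := fun v x => ¬ P v x) h.not).not.congr (fun v _ => by push Not; rfl)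

/-- A definable function from definability of membership in its values. -/
theorem DT.of_mem {T : ZFSet} (tr : T.IsTransitive) {t : (ℕ → ZFSet) → ZFSet}
    (ht : ∀ v : ℕ → ZFSet, (∀ n, v n ∈ T) → t v ∈ T)
    (h : Dfn T (fun v => v 0 ∈ t (fun n => v (n + 1)))) : DT T t := by
  obtain ⟨a, ha⟩ : ∃ a, a ∈ T := by
    obtain ⟨φ, w, hw, _⟩ := h
    exact ⟨_, hw 0⟩
  refine ⟨?_, ht⟩
  have : Dfn T (fun v => ∀ z ∈ T, z ∈ v 0 ↔ z ∈ t (fun n => v (n + 1))) := by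
    apply Dfn.all
    refine (Dfn.var_mem ha 0 1).iff ?_
    exact (h.rename succ_inj2).congr (fun v _ => by simp)
  refine this.congr (fun v hv => ?_)
  constructor
  · intro H
    ext z
    constructor
    · intro hz; exact (H z (tr _ (hv 0) hz)).1 hz
    · intro hz; exact (H z (tr _ (ht _ (fun n => hv (n + 1))) hz)).2 hz
  · intro H z _; rw [H]

/-- Satisfaction relativized to a definable class is definable. -/
theorem Dfn.sat {T a : ZFSet} (ha : a ∈ T) {D : Set ZFSet} (hD : ∀ x ∈ D, x ∈ T)
    (hDd : Dfn T (fun v => v 0 ∈ D)) (φ : Fml) : ∀ t : ℕ → (ℕ → ZFSet) → ZFSet,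
    (∀ n, DT T (t n)) → Dfn T (fun v => Sat D φ (fun n => t n v)) := by
  induction φ with
  | mem i j => intro t ht; exact (ht i).mem (ht j)
  | eq i j => intro t ht; exact (ht i).eq (ht j)
  | impl φ ψ h1 h2 => intro t ht; exact (h1 t ht).imp (h2 t ht)
  | neg φ h => intro t ht; exact (h t ht).not
  | all n φ h =>
    intro t ht
    have : Dfn T (fun v => ∀ x ∈ T, x ∈ D → Sat D φ (Function.update (fun n => t n v) n x)) := by
      apply Dfn.all
      refine hDd.imp ?_
      have := h (fun k v => if k = n then v 0 else t k (fun n => v (n + 1))) (fun k => by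
        by_cases hk : k = n
        · simp only [hk, if_true]; exact DT.var ha 0
        · simp only [hk, if_false]; exact (ht k).weak)
      refine this.congr (fun v _ => ?_)
      have e : (fun k => if k = n then v 0 else t k (fun n => v (n + 1))) =
        Function.update (fun k => t k (fun n => v (n + 1))) n (v 0) := by
        funext k
        by_cases hk : k = n
        · subst hk; simp
        · simp [hk]
      simp only [e]
    refine this.congr (fun v _ => ?_)
    exact ⟨fun H x hx => H x (hD x hx) hx, fun H x _ hx => H x hx⟩


/-- Transitive models of the choiceless fragment of ZFC without power set. -/
structure ZFm (T : ZFSet) : Prop where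
  tr : T.IsTransitive
  empty : (∅ : ZFSet) ∈ T
  pairing : ∀ x ∈ T, ∀ y ∈ T, ({x, y} : ZFSet) ∈ T
  union : ∀ x ∈ T, (⋃₀ x : ZFSet) ∈ T
  sepS : ∀ (φ : Fml) (v : ℕ → ZFSet), (∀ n, v n ∈ T) → ∀ a ∈ T,
    ∃ b ∈ T, ∀ x, x ∈ b ↔ x ∈ a ∧ Sat T.toSet φ (Function.update v 0 x)
  collS : ∀ (φ : Fml) (v : ℕ → ZFSet), (∀ n, v n ∈ T) → ∀ a ∈ T,
    (∀ x ∈ a, ∃ y ∈ T, Sat T.toSet φ (Function.update (Function.update v 0 x) 1 y)) →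
    ∃ b ∈ T, ∀ x ∈ a, ∃ y ∈ b, Sat T.toSet φ (Function.update (Function.update v 0 x) 1 y)

theorem IsTransModel.zfm {M : ZFSet} (h : IsTransModel M) : ZFm M := by
  obtain ⟨h1, h2, h3, h4, h5, h6, _⟩ := h
  exact ⟨h1, h1 _ h2 omega_zero, h3, h4, h5, h6⟩

theorem DT.rename {T : ZFSet} {t : (ℕ → ZFSet) → ZFSet} (h : DT T t) {ρ : ℕ → ℕ}
    (hρ : Function.Injective ρ) : DT T (fun v => t (fun n => v (ρ n))) := by
  refine ⟨?_, fun v hv => h.2 _ (fun n => hv _)⟩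
  have : Function.Injective (fun n : ℕ => if n = 0 then 0 else ρ (n - 1) + 1) := by
    intro a b hab
    have hab : (if a = 0 then 0 else ρ (a - 1) + 1) = (if b = 0 then 0 else ρ (b - 1) + 1) := hab
    split_ifs at hab with h1 h2
    · omega
    · have := hρ (Nat.succ_injective hab)
      omega
  exact (h.1.rename this).congr (fun v _ => by simp)

theorem Dfn.weak {T : ZFSet} {P : (ℕ → ZFSet) → Prop} (h : Dfn T P) :
    Dfn T (fun v => P (fun n => v (n + 1))) := h.rename (fun a b => by simp)

/-- The renaming skipping the index one. -/
theorem skip1_inj : Function.Injective (fun n : ℕ => if n = 0 then 0 else n + 1) := succ_inj2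

theorem DT.skip {T : ZFSet} {t : (ℕ → ZFSet) → ZFSet → ZFSet}
    (h : DT T (fun v => t (fun n => v (n + 1)) (v 0))) :
    DT T (fun v => t (fun n => v (n + 1 + 1)) (v 0)) := by
  have := h.rename skip1_inj
  simpa using this

theorem Dfn.skip {T : ZFSet} {t : (ℕ → ZFSet) → ZFSet → Prop}
    (h : Dfn T (fun v => t (fun n => v (n + 1)) (v 0))) :
    Dfn T (fun v => t (fun n => v (n + 1 + 1)) (v 0)) := by
  have := h.rename skip1_inj
  simpa using this

/-- The image of a set under a class function. -/
def zimg.{u} (f : ZFSet.{u} → ZFSet.{u}) (a : ZFSet.{u}) : ZFSet.{u} :=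
  @ZFSet.image f (Classical.allZFSetDefinable (fun s => f (s 0))) a

theorem mem_zimg {f : ZFSet → ZFSet} {a z : ZFSet} : z ∈ zimg f a ↔ ∃ x ∈ a, z = f x := by
  refine (@ZFSet.mem_image f (Classical.allZFSetDefinable _) a z).trans ?_
  simp only [eq_comm]

/-- The function with domain `a` given by a class function. -/
def zfun (f : ZFSet → ZFSet) (a : ZFSet) : ZFSet := zimg (fun x => ZFSet.pair x (f x)) a

theorem pair_mem_zfun {f : ZFSet → ZFSet} {a x y : ZFSet} :
    ZFSet.pair x y ∈ zfun f a ↔ x ∈ a ∧ y = f x := by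
  unfold zfun
  rw [mem_zimg]
  constructor
  · rintro ⟨z, hz, h⟩
    obtain ⟨rfl, rfl⟩ := ZFSet.pair_inj.1 h
    exact ⟨hz, rfl⟩
  · rintro ⟨h, rfl⟩
    exact ⟨x, h, rfl⟩

theorem mem_sUnion_pair {f a b : ZFSet} (h : ZFSet.pair a b ∈ f) : b ∈ (⋃₀ (⋃₀ f) : ZFSet) := by
  refine ZFSet.mem_sUnion.2 ⟨{a, b}, ZFSet.mem_sUnion.2 ⟨_, h, ?_⟩, by simp⟩
  simp [ZFSet.pair]

theorem mem_fapp {f a z : ZFSet} : z ∈ fapp f a ↔ ∃ b, ZFSet.pair a b ∈ f ∧ z ∈ b := by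
  unfold fapp
  rw [ZFSet.mem_sUnion]
  constructor
  · rintro ⟨b, hb, hz⟩
    exact ⟨b, (ZFSet.mem_sep.1 hb).2, hz⟩
  · rintro ⟨b, hb, hz⟩
    exact ⟨b, ZFSet.mem_sep.2 ⟨mem_sUnion_pair hb, hb⟩, hz⟩

theorem fapp_eq {f a b : ZFSet} (h : ZFSet.pair a b ∈ f) (hu : ∀ b', ZFSet.pair a b' ∈ f → b' = b) :
    fapp f a = b := by
  ext z
  rw [mem_fapp]
  constructor
  · rintro ⟨b', h', hz⟩
    rwa [← hu _ h']
  · intro hz; exact ⟨b, h, hz⟩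

theorem IsZFunc.pair_mem_iff {d f a b : ZFSet} (h : IsZFunc d f) (ha : a ∈ d) :
    ZFSet.pair a b ∈ f ↔ fapp f a = b := by
  obtain ⟨c, hc, hu⟩ := h.2 a ha
  have : fapp f a = c := fapp_eq hc hu
  constructor
  · intro hb; rw [this, hu b hb]
  · intro hb; rw [← hb, this]; exact hc

theorem fapp_zfun {f : ZFSet → ZFSet} {a x : ZFSet} (h : x ∈ a) : fapp (zfun f a) x = f x :=
  fapp_eq (pair_mem_zfun.2 ⟨h, rfl⟩) (fun _ hb => (pair_mem_zfun.1 hb).2)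

theorem isZFunc_zfun (f : ZFSet → ZFSet) (a : ZFSet) : IsZFunc a (zfun f a) := by
  constructor
  · intro p hp
    obtain ⟨x, hx, rfl⟩ := mem_zimg.1 hp
    exact ⟨x, hx, _, rfl⟩
  · intro x hx
    exact ⟨f x, pair_mem_zfun.2 ⟨hx, rfl⟩, fun y hy => (pair_mem_zfun.1 hy).2⟩

theorem IsZFunc.ext {d f g : ZFSet} (hf : IsZFunc d f) (hg : IsZFunc d g)
    (h : ∀ a ∈ d, fapp f a = fapp g a) : f = g := by
  ext p
  constructor
  · intro hp
    obtain ⟨a, ha, b, rfl⟩ := hf.1 p hp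
    rw [hg.pair_mem_iff ha, ← h a ha]
    exact (hf.pair_mem_iff ha).1 hp
  · intro hp
    obtain ⟨a, ha, b, rfl⟩ := hg.1 p hp
    rw [hf.pair_mem_iff ha, h a ha]
    exact (hg.pair_mem_iff ha).1 hp

theorem zimg_congr {f g : ZFSet → ZFSet} {a : ZFSet} (h : ∀ x ∈ a, f x = g x) :
    zimg f a = zimg g a := by
  ext z
  simp only [mem_zimg]
  constructor <;> rintro ⟨x, hx, rfl⟩
  · exact ⟨x, hx, h x hx⟩
  · exact ⟨x, hx, (h x hx).symm⟩

theorem prod_eq (a b : ZFSet) :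
    ZFSet.prod a b = ⋃₀ (zimg (fun x => zimg (fun y => ZFSet.pair x y) b) a) := by
  ext z
  simp only [ZFSet.mem_prod, ZFSet.mem_sUnion, mem_zimg]
  constructor
  · rintro ⟨x, hx, y, hy, rfl⟩
    exact ⟨_, ⟨x, hx, rfl⟩, mem_zimg.2 ⟨y, hy, rfl⟩⟩
  · rintro ⟨_, ⟨x, hx, rfl⟩, h⟩
    obtain ⟨y, hy, rfl⟩ := mem_zimg.1 h
    exact ⟨x, hx, y, hy, rfl⟩

namespace ZFm

theorem sep' {T : ZFSet} (hT : ZFm T) {P : (ℕ → ZFSet) → Prop} (h : Dfn T P) {v : ℕ → ZFSet} (hv : ∀ n, v n ∈ T)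
    {a : ZFSet} (ha : a ∈ T) : ZFSet.sep (fun x => P (vcons x v)) a ∈ T := by
  obtain ⟨φ, w, hw, h⟩ := h
  obtain ⟨b, hb, hb'⟩ := hT.sepS φ (mix (vcons a v) w) (mix_mem (vcons_mem ha hv) hw) a ha
  convert hb
  ext x
  rw [ZFSet.mem_sep, hb']
  refine and_congr_right fun hx => ?_
  have hx := hT.tr _ ha hx
  rw [← h _ (vcons_mem hx hv)]
  have : Function.update (mix (vcons a v) w) 0 x = mix (vcons x v) w := by
    funext n
    rcases Nat.even_or_odd' n with ⟨n, rfl | rfl⟩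
    · rw [mix_even]
      cases n with
      | zero => simp [vcons]
      | succ n => rw [Function.update_of_ne (by omega), mix_even]; rfl
    · rw [mix_odd, Function.update_of_ne (by omega), mix_odd]
  rw [this]

theorem coll' {T : ZFSet} (hT : ZFm T) {P : (ℕ → ZFSet) → Prop} (h : Dfn T P) {v : ℕ → ZFSet} (hv : ∀ n, v n ∈ T)
    {a : ZFSet} (ha : a ∈ T) (H : ∀ x ∈ a, ∃ y ∈ T, P (vcons x (vcons y v))) :
    ∃ b ∈ T, ∀ x ∈ a, ∃ y ∈ b, P (vcons x (vcons y v)) := by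
  obtain ⟨φ, w, hw, h⟩ := h
  have key : ∀ x ∈ T, ∀ y ∈ T, Sat T.toSet (φ.ren (Equiv.swap 1 2))
      (Function.update (Function.update
        (fun n => mix (vcons a (vcons a v)) w (Equiv.swap 1 2 n)) 0 x) 1 y) ↔
        P (vcons x (vcons y v)) := by
    intro x hx y hy
    rw [sat_ren (Equiv.injective _), ← h _ (vcons_mem hx (vcons_mem hy hv))]
    have : (fun n => Function.update (Function.update
        (fun n => mix (vcons a (vcons a v)) w (Equiv.swap 1 2 n)) 0 x) 1 y (Equiv.swap 1 2 n)) =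
        mix (vcons x (vcons y v)) w := by
      funext n
      rcases Nat.lt_or_ge n 3 with hn | hn
      · interval_cases n
        · rw [Equiv.swap_apply_of_ne_of_ne (by omega) (by omega)]
          simp [mix, vcons]
        · rw [Equiv.swap_apply_left]
          simp [mix]
        · rw [Equiv.swap_apply_right]
          simp [mix, vcons]
      · rw [Equiv.swap_apply_of_ne_of_ne (by omega) (by omega),
          Function.update_of_ne (by omega), Function.update_of_ne (by omega),
          Equiv.swap_apply_of_ne_of_ne (by omega) (by omega)]
        rcases Nat.even_or_odd' n with ⟨n, rfl | rfl⟩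
        · rw [mix_even, mix_even]
          obtain ⟨m, rfl⟩ : ∃ m, n = m + 2 := ⟨n - 2, by omega⟩
          rfl
        · rw [mix_odd, mix_odd]
    rw [this]
  have mm := mix_mem (vcons_mem ha (vcons_mem ha hv)) hw
  obtain ⟨b, hb, hb'⟩ := hT.collS (φ.ren (Equiv.swap 1 2))
    (fun n => mix (vcons a (vcons a v)) w (Equiv.swap 1 2 n)) (fun n => mm _) a ha (by
      intro x hx
      obtain ⟨y, hy, h⟩ := H x hx
      exact ⟨y, hy, (key x (hT.tr _ ha hx) y hy).2 h⟩)
  refine ⟨b, hb, fun x hx => ?_⟩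
  obtain ⟨y, hy, h⟩ := hb' x hx
  exact ⟨y, hy, (key x (hT.tr _ ha hx) y (hT.tr _ hb hy)).1 h⟩

theorem sep {T : ZFSet} (hT : ZFm T) {Q : ZFSet → Prop} (h : Dfn T (fun v => Q (v 0))) {a : ZFSet} (ha : a ∈ T) :
    ZFSet.sep Q a ∈ T := hT.sep' h (v := fun _ => a) (fun _ => ha) ha

theorem coll {T : ZFSet} (hT : ZFm T) {Q : ZFSet → ZFSet → Prop} (h : Dfn T (fun v => Q (v 0) (v 1))) {a : ZFSet}
    (ha : a ∈ T) (H : ∀ x ∈ a, ∃ y ∈ T, Q x y) :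
    ∃ b ∈ T, ∀ x ∈ a, ∃ y ∈ b, Q x y := hT.coll' h (v := fun _ => a) (fun _ => ha) ha H

theorem dvar {T : ZFSet} (hT : ZFm T) (i : ℕ) : DT T (fun v => v i) := DT.var hT.empty i

theorem dupair {T : ZFSet} (hT : ZFm T) {t s : (ℕ → ZFSet) → ZFSet} (ht : DT T t) (hs : DT T s) :
    DT T (fun v => ({t v, s v} : ZFSet)) := by
  refine DT.of_mem hT.tr (fun v hv => hT.pairing _ (ht.2 v hv) _ (hs.2 v hv)) ?_
  refine (((hT.dvar 0).eq ht.weak).or ((hT.dvar 0).eq hs.weak)).congr (fun v _ => ?_)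
  simp

theorem dsing {T : ZFSet} (hT : ZFm T) {t : (ℕ → ZFSet) → ZFSet} (ht : DT T t) :
    DT T (fun v => ({t v} : ZFSet)) := by
  have := hT.dupair ht ht
  have e : ∀ x : ZFSet, ({x, x} : ZFSet) = {x} := fun x => by ext; simp
  convert this using 2
  rw [e]

theorem dpair {T : ZFSet} (hT : ZFm T) {t s : (ℕ → ZFSet) → ZFSet} (ht : DT T t) (hs : DT T s) :
    DT T (fun v => ZFSet.pair (t v) (s v)) :=
  hT.dupair (hT.dsing ht) (hT.dupair ht hs)

theorem dsUnion {T : ZFSet} (hT : ZFm T) {t : (ℕ → ZFSet) → ZFSet} (ht : DT T t) :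
    DT T (fun v => (⋃₀ (t v) : ZFSet)) := by
  refine DT.of_mem hT.tr (fun v hv => hT.union _ (ht.2 v hv)) ?_
  refine (DT.bex hT.tr ht.weak (P := fun v x => v 0 ∈ x) ?_).congr (fun v _ => ?_)
  · exact (hT.dvar 1).mem (hT.dvar 0)
  · simp

theorem dunion {T : ZFSet} (hT : ZFm T) {t s : (ℕ → ZFSet) → ZFSet} (ht : DT T t) (hs : DT T s) :
    DT T (fun v => t v ∪ s v) := hT.dsUnion (hT.dupair ht hs)

theorem dsep {T : ZFSet} (hT : ZFm T) {s : (ℕ → ZFSet) → ZFSet} (hs : DT T s) {P : (ℕ → ZFSet) → ZFSet → Prop}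
    (h : Dfn T (fun v => P (fun n => v (n + 1)) (v 0))) :
    DT T (fun v => ZFSet.sep (P v) (s v)) := by
  refine DT.of_mem hT.tr (fun v hv => hT.sep' h hv (hs.2 v hv)) ?_
  refine (((hT.dvar 0).mem hs.weak).and h).congr (fun v _ => ?_)
  simp

theorem dzimg {T : ZFSet} (hT : ZFm T) {s : (ℕ → ZFSet) → ZFSet} (hs : DT T s) {t : (ℕ → ZFSet) → ZFSet → ZFSet}
    (h : DT T (fun v => t (fun n => v (n + 1)) (v 0))) :
    DT T (fun v => zimg (t v) (s v)) := by
  have e : ∀ (v : ℕ → ZFSet), (∀ n, v n ∈ T) → zimg (t v) (s v) ∈ T := by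
    intro v hv
    have h1 : Dfn T (fun u => u 1 = t (fun n => u (n + 1 + 1)) (u 0)) := (hT.dvar 1).eq h.skip
    have h2 : Dfn T (fun u => ∃ x ∈ s (fun n => u (n + 1)), u 0 = t (fun n => u (n + 1)) x) := by
      refine DT.bex hT.tr hs.weak (P := fun u x => u 0 = t (fun n => u (n + 1)) x) ?_
      exact (hT.dvar 1).eq h.skip
    obtain ⟨b, hb, hb'⟩ := hT.coll' h1 hv (hs.2 v hv) (fun x hx =>
      ⟨t v x, h.2 (vcons x v) (vcons_mem (hT.tr _ (hs.2 v hv) hx) hv), rfl⟩)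
    have := hT.sep' h2 hv hb
    convert this
    ext z
    rw [mem_zimg, ZFSet.mem_sep]
    constructor
    · rintro ⟨x, hx, rfl⟩
      obtain ⟨y, hy, hxy⟩ := hb' x hx
      have hxy : y = t v x := hxy
      rw [← hxy]
      exact ⟨hy, x, hx, hxy⟩
    · rintro ⟨_, x, hx, h⟩
      exact ⟨x, hx, h⟩
  refine DT.of_mem hT.tr e ?_
  refine (DT.bex hT.tr hs.weak (P := fun u x => u 0 = t (fun n => u (n + 1)) x) ?_).congr
    (fun v _ => ?_)
  · exact (hT.dvar 1).eq h.skip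
  · rw [mem_zimg]

theorem dzfun {T : ZFSet} (hT : ZFm T) {s : (ℕ → ZFSet) → ZFSet} (hs : DT T s) {t : (ℕ → ZFSet) → ZFSet → ZFSet}
    (h : DT T (fun v => t (fun n => v (n + 1)) (v 0))) :
    DT T (fun v => zfun (t v) (s v)) :=
  hT.dzimg hs (t := fun v x => ZFSet.pair x (t v x)) (hT.dpair (hT.dvar 0) h)

theorem dprod {T : ZFSet} (hT : ZFm T) {t s : (ℕ → ZFSet) → ZFSet} (ht : DT T t) (hs : DT T s) :
    DT T (fun v => ZFSet.prod (t v) (s v)) := by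
  simp only [prod_eq]
  apply hT.dsUnion
  apply hT.dzimg ht
  apply hT.dzimg hs.weak
  exact hT.dpair (hT.dvar 1) (hT.dvar 0)

theorem dfapp {T : ZFSet} (hT : ZFm T) {t s : (ℕ → ZFSet) → ZFSet} (ht : DT T t) (hs : DT T s) :
    DT T (fun v => fapp (t v) (s v)) := by
  unfold fapp
  apply hT.dsUnion
  apply hT.dsep (hT.dsUnion (hT.dsUnion ht))
  exact (hT.dpair hs.weak (hT.dvar 0)).mem ht.weak

theorem const_mem {T : ZFSet} (hT : ZFm T) {t : ZFSet} (h : DT T (fun _ => t)) : t ∈ T :=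
  h.2 (fun _ => ∅) (fun _ => hT.empty)

theorem pair_mem {T : ZFSet} (hT : ZFm T) {a b : ZFSet} (ha : a ∈ T) (hb : b ∈ T) : ZFSet.pair a b ∈ T :=
  hT.const_mem (hT.dpair (.const ha) (.const hb))

theorem of_pair_mem {T : ZFSet} (hT : ZFm T) {a b : ZFSet} (h : ZFSet.pair a b ∈ T) : a ∈ T ∧ b ∈ T := by
  have h1 : ({a, b} : ZFSet) ∈ T := hT.tr _ h (by simp [ZFSet.pair])
  exact ⟨hT.tr _ h1 (by simp), hT.tr _ h1 (by simp)⟩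

theorem fapp_mem {T : ZFSet} (hT : ZFm T) {a b : ZFSet} (ha : a ∈ T) (hb : b ∈ T) : fapp a b ∈ T :=
  hT.const_mem (hT.dfapp (.const ha) (.const hb))

theorem union_mem {T : ZFSet} (hT : ZFm T) {a b : ZFSet} (ha : a ∈ T) (hb : b ∈ T) : a ∪ b ∈ T :=
  hT.const_mem (hT.dunion (.const ha) (.const hb))

theorem prod_mem {T : ZFSet} (hT : ZFm T) {a b : ZFSet} (ha : a ∈ T) (hb : b ∈ T) : ZFSet.prod a b ∈ T :=
  hT.const_mem (hT.dprod (.const ha) (.const hb))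

theorem zimg_mem {T : ZFSet} (hT : ZFm T) {f : ZFSet → ZFSet} {a : ZFSet} (h : DT T (fun v => f (v 0))) (ha : a ∈ T) :
    zimg f a ∈ T :=
  hT.const_mem (hT.dzimg (.const ha) (t := fun _ => f) h)

theorem zfun_mem {T : ZFSet} (hT : ZFm T) {f : ZFSet → ZFSet} {a : ZFSet} (h : DT T (fun v => f (v 0))) (ha : a ∈ T) :
    zfun f a ∈ T :=
  hT.const_mem (hT.dzfun (.const ha) (t := fun _ => f) h)

end ZFm


theorem Dfn.inst2 {T : ZFSet} {E : ZFSet → ZFSet → Prop} (hT : ZFm T)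
    (hE : Dfn T (fun v => E (v 0) (v 1))) {t s : (ℕ → ZFSet) → ZFSet} (ht : DT T t)
    (hs : DT T s) : Dfn T (fun v => E (t v) (s v)) := by
  have : Dfn T (fun v => ∃ x ∈ T, ∃ y ∈ T, y = s v ∧ x = t v ∧ E x y) := by
    apply Dfn.ex
    apply Dfn.ex
    refine ((hT.dvar 0).eq hs.weak.weak).and (((hT.dvar 1).eq ht.weak.weak).and ?_)
    exact hE.rename (Equiv.swap 0 1).injective |>.congr (fun v _ => by
      simp)
  refine this.congr (fun v hv => ?_)
  constructor
  · rintro ⟨x, _, y, _, rfl, rfl, h⟩; exact h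
  · intro h; exact ⟨_, ht.2 v hv, _, hs.2 v hv, rfl, rfl, h⟩

theorem Dfn.inst1 {T : ZFSet} {E : ZFSet → Prop} (hT : ZFm T)
    (hE : Dfn T (fun v => E (v 0))) {t : (ℕ → ZFSet) → ZFSet} (ht : DT T t) :
    Dfn T (fun v => E (t v)) :=
  Dfn.inst2 (E := fun x _ => E x) hT hE ht ht

theorem DT.inst1 {T : ZFSet} {f : ZFSet → ZFSet} (hT : ZFm T)
    (h : DT T (fun v => f (v 0))) {t : (ℕ → ZFSet) → ZFSet} (ht : DT T t) :
    DT T (fun v => f (t v)) :=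
  ⟨Dfn.inst2 (E := fun x y => x = f y) hT h.1 (hT.dvar 0) ht.weak,
    fun v hv => h.2 (fun _ => t v) (fun _ => ht.2 v hv)⟩

/-- Approximations to a collapse function. -/
def CAtt (T D : ZFSet) (E : ZFSet → ZFSet → Prop) (g : ZFSet) : Prop :=
  ∀ a ∈ D, ∀ b ∈ T, ZFSet.pair a b ∈ g → (∀ e ∈ D, E e a → ∃ c ∈ T, ZFSet.pair e c ∈ g) ∧
    ∀ z ∈ T, (z ∈ b ↔ ∃ e ∈ D, E e a ∧ ZFSet.pair e z ∈ g)

theorem dfn_catt {T D : ZFSet} {E : ZFSet → ZFSet → Prop} (hT : ZFm T) (hD : D ∈ T)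
    (hE : Dfn T (fun v => E (v 0) (v 1))) : Dfn T (fun v => CAtt T D E (v 0)) := by
  unfold CAtt
  have cD : DT T (fun _ => D) := .const hD
  have hE' := @Dfn.inst2 T E hT hE
  repeat' first
    | apply DT.var hT.empty
    | exact cD
    | apply hT.dpair
    | apply hE'
    | apply DT.mem
    | apply DT.eq
    | apply Dfn.iff
    | apply Dfn.and
    | apply Dfn.or
    | apply Dfn.ex
    | apply Dfn.all
    | apply DT.bex hT.tr
    | apply DT.ball hT.tr
    | apply Dfn.imp

theorem catt_iff {T D : ZFSet} {E : ZFSet → ZFSet → Prop} (hT : ZFm T) (hD : D ∈ T)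
    {G : ZFSet → ZFSet} (hG : ∀ a ∈ D, ∀ z, z ∈ G a ↔ ∃ e ∈ D, E e a ∧ z = G e)
    {g : ZFSet} (hg : g ∈ T) : CAtt T D E g ↔ ∀ a ∈ D, ∀ b, ZFSet.pair a b ∈ g →
      b = G a ∧ ∀ e ∈ D, E e a → ∃ c, ZFSet.pair e c ∈ g := by
  have hm : ∀ {a b}, ZFSet.pair a b ∈ g → b ∈ T := fun h =>
    (hT.of_pair_mem (hT.tr _ hg h)).2
  constructor
  · intro H
    have key : ∀ x, ∀ a ∈ D, G a = x → ∀ b, ZFSet.pair a b ∈ g → b = G a := by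
      intro x
      induction x using ZFSet.inductionOn with
      | _ x ih =>
        rintro a ha rfl b hb
        obtain ⟨h1, h2⟩ := H a ha b (hm hb) hb
        have ih' : ∀ e ∈ D, E e a → ∀ c, ZFSet.pair e c ∈ g → c = G e := fun e he hea c hc =>
          ih (G e) ((hG a ha _).2 ⟨e, he, hea, rfl⟩) e he rfl c hc
        ext z
        constructor
        · intro hz
          obtain ⟨e, he, hea, hez⟩ := (h2 z (hT.tr _ (hm hb) hz)).1 hz
          exact (hG a ha _).2 ⟨e, he, hea, ih' e he hea z hez⟩
        · intro hz
          obtain ⟨e, he, hea, rfl⟩ := (hG a ha _).1 hz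
          obtain ⟨c, hc, hec⟩ := h1 e he hea
          have := ih' e he hea c hec
          subst this
          exact (h2 _ hc).2 ⟨e, he, hea, hec⟩
    intro a ha b hb
    refine ⟨key _ a ha rfl b hb, fun e he hea => ?_⟩
    obtain ⟨c, _, hc⟩ := (H a ha b (hm hb) hb).1 e he hea
    exact ⟨c, hc⟩
  · intro H a ha b _ hb
    obtain ⟨rfl, h2⟩ := H a ha b hb
    refine ⟨fun e he hea => ?_, fun z _ => ?_⟩
    · obtain ⟨c, hc⟩ := h2 e he hea
      exact ⟨c, hm hc, hc⟩
    · rw [hG a ha]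
      refine exists_congr fun e => and_congr_right fun he => and_congr_right fun hea => ?_
      constructor
      · rintro rfl
        obtain ⟨c, hc⟩ := h2 e he hea
        rw [← (H e he c hc).1]; exact hc
      · intro hz
        exact (H e he z hz).1

theorem catt_gather {T D : ZFSet} {E : ZFSet → ZFSet → Prop} (hT : ZFm T) (hD : D ∈ T)
    (hE : Dfn T (fun v => E (v 0) (v 1)))
    {G : ZFSet → ZFSet} (hG : ∀ a ∈ D, ∀ z, z ∈ G a ↔ ∃ e ∈ D, E e a ∧ z = G e)
    {S : ZFSet} (hS : S ∈ T) (hSD : S ⊆ D)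
    (H : ∀ e ∈ S, ∃ g ∈ T, CAtt T D E g ∧ ∃ b ∈ T, ZFSet.pair e b ∈ g) :
    ∃ g ∈ T, CAtt T D E g ∧ ∀ e ∈ S, ZFSet.pair e (G e) ∈ g ∧ fapp g e = G e := by
  have d1 : Dfn T (fun v => CAtt T D E (v 1) ∧ ∃ b ∈ T, ZFSet.pair (v 0) b ∈ v 1) := by
    refine ((dfn_catt hT hD hE).inst1 hT (hT.dvar 1)).and ?_
    apply Dfn.ex
    exact (hT.dpair (hT.dvar 1) (hT.dvar 0)).mem (hT.dvar 2)
  obtain ⟨B, hB, hB'⟩ := hT.coll (Q := fun e g => CAtt T D E g ∧ ∃ b ∈ T, ZFSet.pair e b ∈ g)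
    d1 hS H
  have hBs := hT.sep (dfn_catt hT hD hE) hB
  have hg0 := hT.union _ hBs
  set g0 : ZFSet := ⋃₀ (ZFSet.sep (CAtt T D E) B) with hg0d
  have hatt : ∀ g ∈ B, CAtt T D E g → _ := fun g hg h => (catt_iff hT hD hG (hT.tr _ hB hg)).1 h
  have h0' : ∀ a ∈ D, ∀ b, ZFSet.pair a b ∈ g0 →
      b = G a ∧ ∀ e ∈ D, E e a → ∃ c, ZFSet.pair e c ∈ g0 := by
    intro a ha b hb
    obtain ⟨g, hg, hab⟩ := ZFSet.mem_sUnion.1 hb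
    obtain ⟨hgB, hga⟩ := ZFSet.mem_sep.1 hg
    obtain ⟨h1, h2⟩ := hatt g hgB hga a ha b hab
    refine ⟨h1, fun e he hea => ?_⟩
    obtain ⟨c, hc⟩ := h2 e he hea
    exact ⟨c, ZFSet.mem_sUnion.2 ⟨g, hg, hc⟩⟩
  refine ⟨g0, hg0, (catt_iff hT hD hG hg0).2 h0', fun e he => ?_⟩
  obtain ⟨g, hg, hga, b, hb, heb⟩ := hB' e he
  have h1 : ZFSet.pair e b ∈ g0 := ZFSet.mem_sUnion.2 ⟨g, ZFSet.mem_sep.2 ⟨hg, hga⟩, heb⟩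
  have h2 := (h0' e (hSD he) b h1).1
  subst h2
  exact ⟨h1, fapp_eq h1 (fun b' hb' => (h0' e (hSD he) b' hb').1)⟩

theorem collapse {T D : ZFSet} {E : ZFSet → ZFSet → Prop} (hT : ZFm T) (hD : D ∈ T)
    (hE : Dfn T (fun v => E (v 0) (v 1)))
    {G : ZFSet → ZFSet} (hG : ∀ a ∈ D, ∀ z, z ∈ G a ↔ ∃ e ∈ D, E e a ∧ z = G e) :
    zfun G D ∈ T := by
  have key : ∀ x, ∀ a ∈ D, G a = x → ∃ g ∈ T, CAtt T D E g ∧ ∃ b ∈ T, ZFSet.pair a b ∈ g := by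
    intro x
    induction x using ZFSet.inductionOn with
    | _ x ih =>
      rintro a ha rfl
      have haT := hT.tr _ hD ha
      have hS : ZFSet.sep (fun e => E e a) D ∈ T :=
        hT.sep (Dfn.inst2 (E := E) (s := fun _ => a) hT hE (hT.dvar 0) (.const haT)) hD
      obtain ⟨g, hg, hga, hgS⟩ := catt_gather hT hD hE hG hS (fun z hz => (ZFSet.mem_sep.1 hz).1)
        (fun e he => by
          obtain ⟨he, hea⟩ := ZFSet.mem_sep.1 he
          exact ih _ ((hG a ha _).2 ⟨e, he, hea, rfl⟩) e he rfl)
      have hGa : G a = zimg (fapp g) (ZFSet.sep (fun e => E e a) D) := by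
        ext z
        rw [mem_zimg, hG a ha]
        constructor
        · rintro ⟨e, he, hea, rfl⟩
          have : e ∈ ZFSet.sep (fun e => E e a) D := ZFSet.mem_sep.2 ⟨he, hea⟩
          exact ⟨e, this, (hgS e this).2.symm⟩
        · rintro ⟨e, he, rfl⟩
          obtain ⟨he', hea⟩ := ZFSet.mem_sep.1 he
          exact ⟨e, he', hea, (hgS e he).2⟩
      have hGaT : G a ∈ T := by
        rw [hGa]
        exact hT.zimg_mem (hT.dfapp (.const hg) (hT.dvar 0)) hS
      have hg1 : g ∪ {ZFSet.pair a (G a)} ∈ T :=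
        hT.const_mem (hT.dunion (.const hg) (hT.dsing (hT.dpair (.const haT) (.const hGaT))))
      refine ⟨_, hg1, (catt_iff hT hD hG hg1).2 ?_, G a, hGaT, by simp⟩
      intro a' ha' b' hab
      rcases ZFSet.mem_union.1 hab with h | h
      · obtain ⟨h1, h2⟩ := (catt_iff hT hD hG hg).1 hga a' ha' b' h
        refine ⟨h1, fun e he hea => ?_⟩
        obtain ⟨c, hc⟩ := h2 e he hea
        exact ⟨c, ZFSet.mem_union.2 (Or.inl hc)⟩
      · obtain ⟨rfl, rfl⟩ := ZFSet.pair_inj.1 (ZFSet.mem_singleton.1 h)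
        refine ⟨rfl, fun e he hea => ⟨G e, ?_⟩⟩
        exact ZFSet.mem_union.2 (Or.inl (hgS e (ZFSet.mem_sep.2 ⟨he, hea⟩)).1)
  obtain ⟨g, hg, hga, hgS⟩ := catt_gather hT hD hE hG hD (fun z hz => hz)
    (fun e he => key _ e he rfl)
  have : zfun G D = zfun (fapp g) D :=
    zimg_congr (fun x hx => by rw [(hgS x hx).2])
  rw [this]
  exact hT.zfun_mem (hT.dfapp (.const hg) (hT.dvar 0)) hD

/-- The collapse function of a well-founded relation on a set. -/
theorem exists_collapse.{u} {D : ZFSet.{u}} {E : ZFSet.{u} → ZFSet.{u} → Prop}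
    (wf : WellFounded (fun a b => a ∈ D ∧ E a b)) :
    ∃ G : ZFSet.{u} → ZFSet.{u}, ∀ a, ∀ z, z ∈ G a ↔ ∃ e ∈ D, E e a ∧ z = G e := by
  let F : (a : ZFSet.{u}) → ((b : ZFSet.{u}) → (b ∈ D ∧ E b a) → ZFSet.{u}) → ZFSet.{u} := fun a ih =>
    zimg (fun e => if h : e ∈ D ∧ E e a then ih e h else ∅) (ZFSet.sep (fun e => E e a) D)
  refine ⟨wf.fix F, fun a z => ?_⟩
  rw [wf.fix_eq]
  simp only [F, mem_zimg, ZFSet.mem_sep]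
  constructor
  · rintro ⟨e, ⟨he, hea⟩, rfl⟩
    refine ⟨e, he, hea, ?_⟩
    rw [dif_pos ⟨he, hea⟩]
  · rintro ⟨e, he, hea, rfl⟩
    refine ⟨e, ⟨he, hea⟩, ?_⟩
    rw [dif_pos ⟨he, hea⟩]


theorem IsOrd.isOrdinal {x : ZFSet} (h : IsOrd x) : x.IsOrdinal :=
  ZFSet.isOrdinal_iff_forall_mem_isTransitive.2 h

/-- `κ` is an infinite cardinal. -/
structure InfCard (κ : ZFSet) : Prop where
  ord : κ.IsOrdinal
  lt : ∀ α ∈ κ, zcard α < zcard κ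
  inf : Cardinal.aleph0 ≤ zcard κ

theorem zcard_mono {x y : ZFSet} (h : x ⊆ y) : zcard x ≤ zcard y :=
  Cardinal.mk_le_mk_of_subset (fun _ hz => h hz)

/-- The finite von Neumann ordinals. -/
def vnat : ℕ → ZFSet
  | 0 => ∅
  | n + 1 => insert (vnat n) (vnat n)

theorem vnat_inj : Function.Injective vnat := by
  have : StrictMono (fun n => ZFSet.rank (vnat n)) := by
    refine strictMono_nat_of_lt_succ (fun n => ?_)
    exact ZFSet.rank_lt_of_mem (by simp [vnat])
  intro a b h
  exact this.injective (congrArg ZFSet.rank h)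

theorem vnat_omega (n : ℕ) : vnat n ∈ ZFSet.omega := by
  induction n with
  | zero => exact ZFSet.omega_zero
  | succ n ih => exact ZFSet.omega_succ ih

theorem aleph0_le_zcard {x : ZFSet} (h : ∀ n, vnat n ∈ x) : Cardinal.aleph0 ≤ zcard x := by
  have : Infinite x.toSet := Infinite.of_injective (fun n : ℕ => (⟨vnat n, h n⟩ : x.toSet))
    (fun a b hab => vnat_inj (congrArg Subtype.val hab))
  exact Cardinal.aleph0_le_mk _

theorem IsWeakModel.infCard {κ M : ZFSet} (hκ : IsCard κ) (h : IsWeakModel κ M) : InfCard κ := by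
  refine ⟨hκ.1.isOrdinal, hκ.2, ?_⟩
  rw [← h.2.2]
  exact aleph0_le_zcard (fun n => h.1.1 _ h.1.2.1 (vnat_omega n))

theorem InfCard.succ_mem {κ a : ZFSet} (h : InfCard κ) (ha : a ∈ κ) : insert a a ∈ κ := by
  rcases (ZFSet.isOrdinal_succ (h.ord.mem ha)).mem_trichotomous h.ord with h1 | h1 | h1
  · exact h1
  · exfalso
    have h2 : zcard (insert a a) ≤ zcard a + 1 := by
      have : (insert a a : ZFSet).toSet ⊆ insert a a.toSet := by
        intro z hz
        rcases ZFSet.mem_insert_iff.1 hz with h | h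
        · exact Or.inl h
        · exact Or.inr h
      exact (Cardinal.mk_le_mk_of_subset this).trans (Cardinal.mk_insert_le)
    have h3 : zcard a + 1 < zcard κ := Cardinal.add_lt_of_lt h.inf (h.lt a ha)
      (lt_of_lt_of_le Cardinal.one_lt_aleph0 h.inf)
    rw [h1] at h2
    exact absurd h3 (not_lt.2 h2)
  · exfalso
    rcases ZFSet.mem_insert_iff.1 h1 with h | h
    · subst h; exact ZFSet.mem_irrefl _ ha
    · exact ZFSet.mem_asymm h ha

theorem InfCard.empty_mem {κ : ZFSet} (h : InfCard κ) : (∅ : ZFSet) ∈ κ := by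
  rcases ZFSet.isOrdinal_empty.mem_or_subset h.ord with h1 | h1
  · exact h1
  · exfalso
    have : zcard κ ≤ zcard ∅ := zcard_mono h1
    have h2 : zcard (∅ : ZFSet) = 0 := by
      unfold zcard
      rw [Cardinal.mk_eq_zero_iff]
      exact ⟨fun x => ZFSet.notMem_empty _ x.2⟩
    rw [h2] at this
    exact absurd (h.inf.trans this) (not_le.2 Cardinal.aleph0_pos)

theorem InfCard.one_mem {κ : ZFSet} (h : InfCard κ) : ({∅} : ZFSet) ∈ κ := by
  have := h.succ_mem h.empty_mem
  have e : (insert ∅ ∅ : ZFSet) = {∅} := by ext; simp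
  rwa [e] at this

theorem InfCard.union_mem {κ a b : ZFSet} (h : InfCard κ) (ha : a ∈ κ) (hb : b ∈ κ) :
    a ∪ b ∈ κ ∧ (a ∪ b = a ∨ a ∪ b = b) := by
  rcases (h.ord.mem ha).subset_total (h.ord.mem hb) with h1 | h1
  · have : a ∪ b = b := by
      ext z
      rw [ZFSet.mem_union]
      exact ⟨fun h => h.elim (fun h => h1 h) id, Or.inr⟩
    rw [this]; exact ⟨hb, Or.inr rfl⟩
  · have : a ∪ b = a := by
      ext z
      rw [ZFSet.mem_union]
      exact ⟨fun h => h.elim id (fun h => h1 h), Or.inl⟩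
    rw [this]; exact ⟨ha, Or.inl rfl⟩

/-- The Goedel order on pairs of ordinals. -/
def GE (κ p q : ZFSet) : Prop := ∃ a ∈ κ, ∃ b ∈ κ, ∃ c ∈ κ, ∃ d ∈ κ,
  p = ZFSet.pair a b ∧ q = ZFSet.pair c d ∧
    (a ∪ b ∈ c ∪ d ∨ (a ∪ b = c ∪ d ∧ (a ∈ c ∨ (a = c ∧ b ∈ d))))

theorem GE_iff {κ a b c d : ZFSet} (ha : a ∈ κ) (hb : b ∈ κ) (hc : c ∈ κ) (hd : d ∈ κ) :
    GE κ (ZFSet.pair a b) (ZFSet.pair c d) ↔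
    (a ∪ b ∈ c ∪ d ∨ (a ∪ b = c ∪ d ∧ (a ∈ c ∨ (a = c ∧ b ∈ d)))) := by
  constructor
  · rintro ⟨a', _, b', _, c', _, d', _, h1, h2, h⟩
    obtain ⟨rfl, rfl⟩ := ZFSet.pair_inj.1 h1
    obtain ⟨rfl, rfl⟩ := ZFSet.pair_inj.1 h2
    exact h
  · intro h
    exact ⟨a, ha, b, hb, c, hc, d, hd, rfl, rfl, h⟩

theorem dfn_GE {T κ : ZFSet} (hT : ZFm T) (hκ : κ ∈ T) : Dfn T (fun v => GE κ (v 0) (v 1)) := by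
  unfold GE
  have cD : DT T (fun _ => κ) := .const hκ
  repeat' first
    | apply DT.var hT.empty
    | exact cD
    | apply hT.dpair
    | apply hT.dunion
    | apply DT.mem
    | apply DT.eq
    | apply Dfn.and
    | apply Dfn.or
    | apply DT.bex hT.tr

theorem GE_wf {κ : ZFSet} (h : InfCard κ) : WellFounded (fun p q => p ∈ ZFSet.prod κ κ ∧ GE κ p q) := by
  let m : ZFSet → Ordinal × Ordinal × Ordinal := fun p =>
    if h : ∃ a b, p = ZFSet.pair a b then
      (ZFSet.rank (h.choose ∪ h.choose_spec.choose), ZFSet.rank h.choose,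
        ZFSet.rank h.choose_spec.choose) else (0, 0, 0)
  have hm : ∀ a b, m (ZFSet.pair a b) = (ZFSet.rank (a ∪ b), ZFSet.rank a, ZFSet.rank b) := by
    intro a b
    have H : ∃ c d, ZFSet.pair a b = ZFSet.pair c d := ⟨a, b, rfl⟩
    have h2 := H.choose_spec.choose_spec
    obtain ⟨h3, h4⟩ := ZFSet.pair_inj.1 h2
    simp only [m]
    rw [dif_pos H, ← h4, ← h3]
  have wf : WellFounded (Prod.Lex (· < ·) (Prod.Lex (· < ·) (· < ·)) :
      Ordinal × Ordinal × Ordinal → Ordinal × Ordinal × Ordinal → Prop) :=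
    WellFounded.prod_lex wellFounded_lt (WellFounded.prod_lex wellFounded_lt wellFounded_lt)
  refine Subrelation.wf (r := InvImage _ m) ?_ (InvImage.wf m wf)
  rintro _ _ ⟨_, a, ha, b, hb, c, hc, d, hd, rfl, rfl, h⟩
  simp only [InvImage, hm]
  rcases h with h | ⟨h1, h | ⟨rfl, h⟩⟩
  · exact Prod.Lex.left _ _ (ZFSet.rank_lt_of_mem h)
  · rw [h1]
    exact Prod.Lex.right _ (Prod.Lex.left _ _ (ZFSet.rank_lt_of_mem h))
  · rw [h1]
    exact Prod.Lex.right _ (Prod.Lex.right _ (ZFSet.rank_lt_of_mem h))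

theorem GE_trans {κ : ZFSet} (h : InfCard κ) {p q r : ZFSet} (h1 : GE κ p q) (h2 : GE κ q r) :
    GE κ p r := by
  obtain ⟨a, ha, b, hb, c, hc, d, hd, rfl, rfl, h1⟩ := h1
  obtain ⟨c', _, d', _, e, he, f, hf, h3, rfl, h2⟩ := h2
  obtain ⟨rfl, rfl⟩ := ZFSet.pair_inj.1 h3
  rw [GE_iff ha hb he hf]
  have oef := h.ord.mem (h.union_mem he hf).1
  rcases h1 with h1 | ⟨h1, h1'⟩
  · rcases h2 with h2 | ⟨h2, _⟩
    · exact Or.inl (oef.mem_trans h1 h2)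
    · exact Or.inl (h2 ▸ h1)
  · rcases h2 with h2 | ⟨h2, h2'⟩
    · exact Or.inl (h1 ▸ h2)
    · refine Or.inr ⟨h1.trans h2, ?_⟩
      rcases h1' with h1' | ⟨rfl, h1'⟩
      · rcases h2' with h2' | ⟨rfl, h2'⟩
        · exact Or.inl ((h.ord.mem he).mem_trans h1' h2')
        · exact Or.inl h1'
      · rcases h2' with h2' | ⟨rfl, h2'⟩
        · exact Or.inl h2'
        · exact Or.inr ⟨rfl, (h.ord.mem hf).mem_trans h1' h2'⟩

theorem GE_tri {κ : ZFSet} (h : InfCard κ) {a b c d : ZFSet} (ha : a ∈ κ) (hb : b ∈ κ)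
    (hc : c ∈ κ) (hd : d ∈ κ) (hne : ZFSet.pair a b ≠ ZFSet.pair c d) :
    GE κ (ZFSet.pair a b) (ZFSet.pair c d) ∨ GE κ (ZFSet.pair c d) (ZFSet.pair a b) := by
  rw [GE_iff ha hb hc hd, GE_iff hc hd ha hb]
  rcases (h.ord.mem (h.union_mem ha hb).1).mem_trichotomous (h.ord.mem (h.union_mem hc hd).1) with
    h1 | h1 | h1
  · exact Or.inl (Or.inl h1)
  · rcases (h.ord.mem ha).mem_trichotomous (h.ord.mem hc) with h2 | h2 | h2
    · exact Or.inl (Or.inr ⟨h1, Or.inl h2⟩)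
    · rcases (h.ord.mem hb).mem_trichotomous (h.ord.mem hd) with h3 | h3 | h3
      · exact Or.inl (Or.inr ⟨h1, Or.inr ⟨h2, h3⟩⟩)
      · exact absurd (by rw [h2, h3]) hne
      · exact Or.inr (Or.inr ⟨h1.symm, Or.inr ⟨h2.symm, h3⟩⟩)
    · exact Or.inr (Or.inr ⟨h1.symm, Or.inl h2⟩)
  · exact Or.inr (Or.inl h1)

/-- There is a pairing function on `κ` lying in all models containing `κ`. -/
theorem exists_gp {κ : ZFSet} (h : InfCard κ) : ∃ G : ZFSet → ZFSet,
    (∀ a ∈ κ, ∀ b ∈ κ, G (ZFSet.pair a b) ∈ κ) ∧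
    (∀ a ∈ κ, ∀ b ∈ κ, ∀ c ∈ κ, ∀ d ∈ κ, G (ZFSet.pair a b) = G (ZFSet.pair c d) →
      a = c ∧ b = d) ∧
    ∀ T, ZFm T → κ ∈ T → zfun G (ZFSet.prod κ κ) ∈ T := by
  obtain ⟨G, hG⟩ := exists_collapse (GE_wf h)
  have tr : ∀ p, (G p).IsTransitive := by
    intro p z hz w hw
    obtain ⟨e, he, hep, rfl⟩ := (hG p z).1 hz
    obtain ⟨e', he', hep', rfl⟩ := (hG _ w).1 hw
    exact (hG p _).2 ⟨e', he', GE_trans h hep' hep, rfl⟩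
  have ord : ∀ p, (G p).IsOrdinal := by
    intro p
    refine ZFSet.isOrdinal_iff_forall_mem_isTransitive.2 ⟨tr p, fun y hy => ?_⟩
    obtain ⟨e, he, hep, rfl⟩ := (hG p y).1 hy
    exact tr e
  refine ⟨G, ?_, ?_, ?_⟩
  · intro c hc d hd
    rcases (ord (ZFSet.pair c d)).mem_or_subset h.ord with h1 | h1
    · exact h1
    · exfalso
      have hm := (h.union_mem hc hd).1
      set m := c ∪ d
      have hm' := h.succ_mem hm
      have sub : (G (ZFSet.pair c d)).toSet ⊆ (fun x : ZFSet × ZFSet => G (ZFSet.pair x.1 x.2)) ''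
          ((insert m m : ZFSet).toSet ×ˢ (insert m m : ZFSet).toSet) := by
        intro z hz
        obtain ⟨e, he, hep, rfl⟩ := (hG _ z).1 hz
        obtain ⟨a, ha, b, hb, rfl⟩ := ZFSet.mem_prod.1 he
        have hab : a ∪ b ∈ (insert m m : ZFSet) := by
          rcases (GE_iff ha hb hc hd).1 hep with h | ⟨h, _⟩
          · exact ZFSet.mem_insert_iff.2 (Or.inr h)
          · exact ZFSet.mem_insert_iff.2 (Or.inl h)
        have osm := h.ord.mem hm'
        refine ⟨(a, b), ⟨?_, ?_⟩, rfl⟩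
        · exact (h.ord.mem ha).mem_of_subset_of_mem osm
            (fun z hz => ZFSet.mem_union.2 (Or.inl hz)) hab
        · exact (h.ord.mem hb).mem_of_subset_of_mem osm
            (fun z hz => ZFSet.mem_union.2 (Or.inr hz)) hab
      have c1 : zcard (G (ZFSet.pair c d)) ≤ zcard (insert m m) * zcard (insert m m) :=
        ((Cardinal.mk_le_mk_of_subset sub).trans Cardinal.mk_image_le).trans
          (Cardinal.mk_setProd _ _).le
      have c2 := Cardinal.mul_lt_of_lt h.inf (h.lt _ hm') (h.lt _ hm')
      exact absurd ((zcard_mono h1).trans c1) (not_le.2 c2)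
  · intro a ha b hb c hc d hd hab
    by_contra hne
    have hne' : ZFSet.pair a b ≠ ZFSet.pair c d := fun h => hne (ZFSet.pair_inj.1 h)
    rcases GE_tri h ha hb hc hd hne' with h1 | h1
    · have : G (ZFSet.pair a b) ∈ G (ZFSet.pair c d) :=
        (hG _ _).2 ⟨_, ZFSet.pair_mem_prod.2 ⟨ha, hb⟩, h1, rfl⟩
      rw [hab] at this
      exact ZFSet.mem_irrefl _ this
    · have : G (ZFSet.pair c d) ∈ G (ZFSet.pair a b) :=
        (hG _ _).2 ⟨_, ZFSet.pair_mem_prod.2 ⟨hc, hd⟩, h1, rfl⟩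
      rw [hab] at this
      exact ZFSet.mem_irrefl _ this
  · intro T hT hκ
    exact collapse hT (hT.prod_mem hκ hκ) (dfn_GE hT hκ) (fun a _ z => hG a z)


theorem DT.ite {T : ZFSet} {P : (ℕ → ZFSet) → Prop} {t s : (ℕ → ZFSet) → ZFSet}
    (hP : Dfn T P) (ht : DT T t) (hs : DT T s) :
    DT T (fun v => if P v then t v else s v) := by
  constructor
  · refine ((hP.weak.and ht.1).or (hP.weak.not.and hs.1)).congr ?_
    intro v _
    dsimp only
    split_ifs with h <;> simp [h]
  · intro v hv
    dsimp only
    split_ifs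
    · exact ht.2 v hv
    · exact hs.2 v hv

/-- A function coding the pairing of elements of `κ`. -/
def gpf.{u} (κ : ZFSet.{u}) : ZFSet.{u} :=
  if h : InfCard κ then zfun (exists_gp h).choose (ZFSet.prod κ κ) else ∅

/-- The pairing of elements of `κ`. -/
def gp.{u} (κ a b : ZFSet.{u}) : ZFSet.{u} := fapp (gpf κ) (ZFSet.pair a b)

theorem gp_eq {κ a b : ZFSet} (h : InfCard κ) (ha : a ∈ κ) (hb : b ∈ κ) :
    gp κ a b = (exists_gp h).choose (ZFSet.pair a b) := by
  unfold gp gpf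
  rw [dif_pos h, fapp_zfun]
  simp [ha, hb]

theorem gp_mem {κ a b : ZFSet} (h : InfCard κ) (ha : a ∈ κ) (hb : b ∈ κ) : gp κ a b ∈ κ := by
  rw [gp_eq h ha hb]
  exact (exists_gp h).choose_spec.1 a ha b hb

theorem gp_inj {κ a b c d : ZFSet} (h : InfCard κ) (ha : a ∈ κ) (hb : b ∈ κ) (hc : c ∈ κ)
    (hd : d ∈ κ) (e : gp κ a b = gp κ c d) : a = c ∧ b = d := by
  rw [gp_eq h ha hb, gp_eq h hc hd] at e
  exact (exists_gp h).choose_spec.2.1 a ha b hb c hc d hd e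

theorem gpf_mem {κ T : ZFSet} (h : InfCard κ) (hT : ZFm T) (hκ : κ ∈ T) : gpf κ ∈ T := by
  unfold gpf
  rw [dif_pos h]
  exact (exists_gp h).choose_spec.2.2 T hT hκ

theorem dgp {κ T : ZFSet} (h : InfCard κ) (hT : ZFm T) (hκ : κ ∈ T)
    {t s : (ℕ → ZFSet) → ZFSet} (ht : DT T t) (hs : DT T s) :
    DT T (fun v => gp κ (t v) (s v)) :=
  hT.dfapp (DT.const (gpf_mem h hT hκ)) (hT.dpair ht hs)

theorem DT.inst2 {T : ZFSet} {f : ZFSet → ZFSet → ZFSet} (hT : ZFm T)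
    (h : DT T (fun v => f (v 0) (v 1))) {t s : (ℕ → ZFSet) → ZFSet} (ht : DT T t)
    (hs : DT T s) : DT T (fun v => f (t v) (s v)) := by
  constructor
  · have h1 : Dfn T (fun v => ∃ x ∈ T, ∃ y ∈ T, x = t (fun n => v (n + 1)) ∧
        y = s (fun n => v (n+1)) ∧ v 0 = f x y) := by
      apply Dfn.ex
      apply Dfn.ex
      refine Dfn.and ?_ (Dfn.and ?_ ?_)
      · exact DT.eq (hT.dvar 1) ht.weak.weak.weak
      · exact DT.eq (hT.dvar 0) hs.weak.weak.weak
      · have i : Function.Injective (fun n : ℕ => if n = 0 then 2 else if n = 1 then 1 else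
          if n = 2 then 0 else n) := by
          intro a b hab
          dsimp only at hab
          split_ifs at hab <;> omega
        exact (h.1.rename i).congr (fun v _ => by simp)
    refine h1.congr ?_
    intro v hv
    constructor
    · rintro ⟨x, _, y, _, rfl, rfl, e⟩
      exact e
    · intro e
      exact ⟨_, ht.2 _ (fun n => hv (n+1)), _, hs.2 _ (fun n => hv (n+1)), rfl, rfl, e⟩
  · intro v hv
    exact h.2 (vcons (t v) (vcons (s v) v))
      (vcons_mem (ht.2 v hv) (vcons_mem (hs.2 v hv) hv))

theorem reindex {κ M : ZFSet} (h : InfCard κ) (hM : ZFm M) (hκ : κ ∈ M)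
    {val : ZFSet → ZFSet → ZFSet} (hv : DT M (fun v => val (v 0) (v 1))) :
    ∃ k ∈ M, IsZFunc κ k ∧ (∀ ξ ∈ κ, ∀ η ∈ κ, fapp k (gp κ ξ η) = val ξ η) ∧
      ∀ ζ ∈ κ, fapp k ζ = ∅ ∨ ∃ ξ ∈ κ, ∃ η ∈ κ, fapp k ζ = val ξ η := by
  let t : ZFSet → ZFSet := fun ζ => ⋃₀ (⋃₀ (zimg (fun ξ => zimg (fun η =>
    if gp κ ξ η = ζ then val ξ η else ∅) κ) κ) : ZFSet)
  have ht : DT M (fun v => t (v 0)) := by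
    apply hM.dsUnion
    apply hM.dsUnion
    apply hM.dzimg (.const hκ)
    apply hM.dzimg (.const hκ)
    apply DT.ite
    · exact DT.eq (dgp h hM hκ (hM.dvar 1) (hM.dvar 0)) (hM.dvar 2)
    · exact DT.inst2 hM hv (hM.dvar 1) (hM.dvar 0)
    · exact .const hM.empty
  have memt : ∀ ζ z, z ∈ t ζ ↔ ∃ ξ ∈ κ, ∃ η ∈ κ, gp κ ξ η = ζ ∧ z ∈ val ξ η := by
    intro ζ z
    simp only [t, mem_sUnion, mem_zimg]
    constructor
    · rintro ⟨w, ⟨_, ⟨ξ, hξ, rfl⟩, hw⟩, hz⟩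
      obtain ⟨η, hη, rfl⟩ := mem_zimg.1 hw
      split_ifs at hz with e
      · exact ⟨ξ, hξ, η, hη, e, hz⟩
      · simp at hz
    · rintro ⟨ξ, hξ, η, hη, e, hz⟩
      exact ⟨_, ⟨_, ⟨ξ, hξ, rfl⟩, mem_zimg.2 ⟨η, hη, rfl⟩⟩, by rw [if_pos e]; exact hz⟩
  have tval : ∀ ξ ∈ κ, ∀ η ∈ κ, t (gp κ ξ η) = val ξ η := by
    intro ξ hξ η hη
    ext z
    rw [memt]
    constructor
    · rintro ⟨ξ', hξ', η', hη', e, hz⟩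
      obtain ⟨rfl, rfl⟩ := gp_inj h hξ' hη' hξ hη e
      exact hz
    · intro hz
      exact ⟨ξ, hξ, η, hη, rfl, hz⟩
  refine ⟨zfun t κ, hM.zfun_mem ht hκ, isZFunc_zfun _ _, ?_, ?_⟩
  · intro ξ hξ η hη
    rw [fapp_zfun (gp_mem h hξ hη), tval ξ hξ η hη]
  · intro ζ hζ
    rw [fapp_zfun hζ]
    by_cases e : ∃ ξ ∈ κ, ∃ η ∈ κ, gp κ ξ η = ζ
    · obtain ⟨ξ, hξ, η, hη, rfl⟩ := e
      exact Or.inr ⟨ξ, hξ, η, hη, tval ξ hξ η hη⟩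
    · left
      rw [eq_empty]
      intro z hz
      obtain ⟨ξ, hξ, η, hη, e', _⟩ := (memt _ _).1 hz
      exact e ⟨ξ, hξ, η, hη, e'⟩

theorem uniformize {M : ZFSet} (hM : IsTransModel M) {Q : ZFSet → ZFSet → Prop}
    (hQ : Dfn M (fun v => Q (v 0) (v 1))) {a : ZFSet} (ha : a ∈ M) :
    ∃ h ∈ M, IsZFunc a h ∧ ∀ x ∈ a, (∃ y ∈ M, Q x y) → Q x (fapp h x) := by
  have hz := hM.zfm
  have hQ' := @Dfn.inst2 M Q hz hQ
  have hC : Dfn M (fun v => Q (v 0) (v 1) ∨ ¬ ∃ y ∈ M, Q (v 0) y) := by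
    apply Dfn.or hQ
    apply Dfn.not
    apply Dfn.ex
    exact hQ' (hz.dvar 1) (hz.dvar 0)
  obtain ⟨b, hb, Hb⟩ := hz.coll (Q := fun x y => Q x y ∨ ¬ ∃ y ∈ M, Q x y) hC ha (by
    intro x hx
    by_cases e : ∃ y ∈ M, Q x y
    · obtain ⟨y, hy, e⟩ := e
      exact ⟨y, hy, Or.inl e⟩
    · exact ⟨∅, hz.empty, Or.inr e⟩)
  obtain ⟨r, hr, hwo⟩ := hM.2.2.2.2.2.2 b hb
  let t : ZFSet → ZFSet := fun x => ⋃₀ (ZFSet.sep (fun y => Q x y ∧ ∀ y' ∈ b, Q x y' →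
    ZFSet.pair y' y ∉ r) b : ZFSet)
  have ht : DT M (fun v => t (v 0)) := by
    apply hz.dsUnion
    apply hz.dsep (.const hb)
    apply Dfn.and
    · exact hQ' (hz.dvar 1) (hz.dvar 0)
    · apply DT.ball hz.tr (.const hb)
      apply Dfn.imp
      · exact hQ' (hz.dvar 2) (hz.dvar 0)
      · apply Dfn.not
        exact DT.mem (hz.dpair (hz.dvar 0) (hz.dvar 1)) (.const hr)
  refine ⟨zfun t a, hz.zfun_mem ht ha, isZFunc_zfun _ _, ?_⟩
  intro x hx e
  rw [fapp_zfun hx]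
  obtain ⟨y0, hy0, hy0'⟩ := Hb x hx
  have hy0' := hy0'.resolve_right (not_not.2 e)
  obtain ⟨y, hy, hmin⟩ := hwo.2.2.2.2 {y | y ∈ b ∧ Q x y} (fun y hy => hy.1) ⟨y0, hy0, hy0'⟩
  have : t x = y := by
    have : ZFSet.sep (fun y => Q x y ∧ ∀ y' ∈ b, Q x y' → ZFSet.pair y' y ∉ r) b = {y} := by
      ext w
      rw [mem_sep, mem_singleton]
      constructor
      · rintro ⟨hw, hw1, hw2⟩
        rcases hwo.2.1 w hw y hy.1 with e | e | e
        · exact e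
        · exact absurd e (hmin w ⟨hw, hw1⟩)
        · exact absurd e (hw2 y hy.1 hy.2)
      · rintro rfl
        exact ⟨hy.1, hy.2, fun y' hy' hq => hmin y' ⟨hy', hq⟩⟩
    simp only [t, this, sUnion_singleton]
  rw [this]
  exact hy.2



theorem mem_omega {x : ZFSet} (h : x ∈ ZFSet.omega) : ∃ n, x = vnat n := by
  have key : ∀ n : ℕ, ZFSet.mk (PSet.ofNat n) = vnat n := by
    intro n
    induction n with
    | zero => rfl
    | succ n ih =>
      show ZFSet.mk (PSet.insert (PSet.ofNat n) (PSet.ofNat n)) = insert (vnat n) (vnat n)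
      rw [← ih]
      rfl
  induction x using Quotient.inductionOn with
  | h p =>
    obtain ⟨⟨n⟩, hn⟩ := h
    exact ⟨n, by rw [← key]; exact Quotient.sound hn⟩

theorem InfCard.vnat_mem {κ : ZFSet} (h : InfCard κ) (n : ℕ) : vnat n ∈ κ := by
  induction n with
  | zero => exact h.empty_mem
  | succ n ih => exact h.succ_mem ih

theorem InfCard.omega_sub {κ : ZFSet} (h : InfCard κ) : ZFSet.omega ⊆ κ := by
  intro x hx
  obtain ⟨n, rfl⟩ := mem_omega hx
  exact h.vnat_mem n

/-- The range of `f` on `κ` is transitive. -/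
def TrR (κ f : ZFSet) : Prop := ∀ ξ ∈ κ, ∀ y ∈ fapp f ξ, ∃ η ∈ κ, fapp f η = y

/-- `f` enumerates a transitive set containing `x`. -/
def SW (κ f x : ZFSet) : Prop := TrR κ f ∧ ∃ η ∈ κ, fapp f η = x

/-- The elements of `M` of hereditary size at most `κ` in `M`. -/
def HM.{u} (κ M : ZFSet.{u}) : ZFSet.{u} := ZFSet.sep (fun x => ∃ f ∈ M, SW κ f x) M

theorem dfn_SW {κ M : ZFSet} (hM : ZFm M) (hκ : κ ∈ M) : Dfn M (fun v => SW κ (v 0) (v 1)) := by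
  unfold SW TrR
  have cD : DT M (fun _ => κ) := .const hκ
  repeat' first | apply DT.var hM.empty | exact cD | apply hM.dfapp | apply DT.mem | apply DT.eq | apply Dfn.and | apply DT.bex hM.tr | apply DT.ball hM.tr

theorem HM_sub {κ M x : ZFSet} (h : x ∈ HM κ M) : x ∈ M := (mem_sep.1 h).1

theorem HM_of_sub {κ M x f : ZFSet} (h : InfCard κ) (hM : ZFm M) (hκ : κ ∈ M)
    (hx : x ∈ M) (hf : f ∈ M) (hT : TrR κ f) (hs : ∀ y ∈ x, ∃ η ∈ κ, fapp f η = y) :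
    x ∈ HM κ M := by
  obtain ⟨k, hk, -, hk1, hk2⟩ := reindex (val := fun ξ η => if ξ = ∅ then x else fapp f η) h hM hκ
    (DT.ite (DT.eq (hM.dvar 0) (.const hM.empty)) (.const hx)
      (hM.dfapp (.const hf) (hM.dvar 1)))
  have key : ∀ η ∈ κ, fapp k (gp κ {∅} η) = fapp f η := by
    intro η hη
    rw [hk1 _ h.one_mem _ hη, if_neg]
    intro e
    have : (∅ : ZFSet) ∈ ({∅} : ZFSet) := by simp
    rw [e] at this
    simp at this
  refine mem_sep.2 ⟨hx, k, hk, ?_, gp κ ∅ ∅, gp_mem h h.empty_mem h.empty_mem, ?_⟩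
  · intro ζ hζ y hy
    have : ∃ η ∈ κ, fapp f η = y := by
      rcases hk2 ζ hζ with e | ⟨ξ, hξ, η, hη, e⟩
      · rw [e] at hy; simp at hy
      · rw [e] at hy
        split_ifs at hy with e
        · exact hs y hy
        · exact hT η hη y hy
    obtain ⟨η, hη, rfl⟩ := this
    exact ⟨_, gp_mem h h.one_mem hη, key η hη⟩
  · rw [hk1 _ h.empty_mem _ h.empty_mem, if_pos rfl]

theorem HM_of_card {κ M z g : ZFSet} (h : InfCard κ) (hM : IsTransModel M) (hκ : κ ∈ M)
    (hz : z ∈ M) (hg : g ∈ M) (hgH : ∀ ξ ∈ κ, fapp g ξ ∈ HM κ M)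
    (hs : ∀ y ∈ z, ∃ ξ ∈ κ, fapp g ξ = y) : z ∈ HM κ M := by
  have zM := hM.zfm
  obtain ⟨F, hF, -, hF2⟩ := uniformize (Q := fun ξ f => SW κ f (fapp g ξ)) hM
    (Dfn.inst2 (E := SW κ) zM (dfn_SW zM hκ) (zM.dvar 1) (zM.dfapp (.const hg) (zM.dvar 0))) hκ
  have hF3 : ∀ ξ ∈ κ, SW κ (fapp F ξ) (fapp g ξ) := by
    intro ξ hξ
    exact hF2 ξ hξ (mem_sep.1 (hgH ξ hξ)).2
  obtain ⟨k, hk, -, hk1, hk2⟩ := reindex (val := fun ξ η => fapp (fapp F ξ) η) h zM hκ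
    (zM.dfapp (zM.dfapp (.const hF) (zM.dvar 0)) (zM.dvar 1))
  refine HM_of_sub h zM hκ hz hk ?_ ?_
  · intro ζ hζ y hy
    rcases hk2 ζ hζ with e | ⟨ξ, hξ, η, hη, e⟩
    · rw [e] at hy; simp at hy
    · rw [e] at hy
      obtain ⟨η', hη', e'⟩ := (hF3 ξ hξ).1 η hη y hy
      exact ⟨_, gp_mem h hξ hη', by rw [hk1 _ hξ _ hη', e']⟩
  · intro y hy
    obtain ⟨ξ, hξ, rfl⟩ := hs y hy
    obtain ⟨η, hη, e⟩ := (hF3 ξ hξ).2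
    exact ⟨_, gp_mem h hξ hη, by rw [hk1 _ hξ _ hη, e]⟩

theorem HM_subset_kappa {κ M A : ZFSet} (h : InfCard κ) (hM : ZFm M) (hκ : κ ∈ M)
    (hA : A ∈ M) (hs : A ⊆ κ) : A ∈ HM κ M := by
  refine HM_of_sub (f := zfun (fun x => x) κ) h hM hκ hA (hM.zfun_mem (hM.dvar 0) hκ) ?_ ?_
  · intro ξ hξ y hy
    rw [fapp_zfun hξ] at hy
    have := h.ord.1.mem_trans hy hξ
    exact ⟨y, this, fapp_zfun this⟩
  · intro y hy
    exact ⟨y, hs hy, fapp_zfun (hs hy)⟩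

theorem HM_pair {κ M x y : ZFSet} (h : InfCard κ) (hM : IsTransModel M) (hκ : κ ∈ M)
    (hx : x ∈ HM κ M) (hy : y ∈ HM κ M) : ({x, y} : ZFSet) ∈ HM κ M := by
  have zM := hM.zfm
  refine HM_of_card (g := zfun (fun ξ => if ξ = ∅ then x else y) κ) h hM hκ
    (zM.pairing _ (HM_sub hx) _ (HM_sub hy)) (zM.zfun_mem
    (DT.ite (DT.eq (zM.dvar 0) (.const zM.empty)) (.const (HM_sub hx)) (.const (HM_sub hy))) hκ) ?_ ?_
  · intro ξ hξ
    rw [fapp_zfun hξ]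
    split_ifs
    · exact hx
    · exact hy
  · intro w hw
    rcases mem_pair.1 hw with rfl | rfl
    · exact ⟨∅, h.empty_mem, by rw [fapp_zfun h.empty_mem, if_pos rfl]⟩
    · refine ⟨{∅}, h.one_mem, ?_⟩
      rw [fapp_zfun h.one_mem, if_neg]
      intro e
      have : (∅ : ZFSet) ∈ ({∅} : ZFSet) := by simp
      rw [e] at this
      simp at this

theorem HM_tr {κ M : ZFSet} (hM : ZFm M) : (HM κ M).IsTransitive := by
  intro x hx y hy
  obtain ⟨hxM, f, hf, hT, η, hη, rfl⟩ := mem_sep.1 hx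
  exact mem_sep.2 ⟨hM.tr.mem_trans hy hxM, f, hf, hT, hT η hη y hy⟩

theorem dfn_HM {κ M : ZFSet} (hM : ZFm M) (hκ : κ ∈ M) : Dfn M (fun v => v 0 ∈ (HM κ M).toSet) := by
  have : Dfn M (fun v => ∃ f ∈ M, SW κ f (v 0)) := by
    apply Dfn.ex
    exact Dfn.inst2 (E := SW κ) hM (dfn_SW hM hκ) (hM.dvar 0) (hM.dvar 1)
  refine this.congr ?_
  intro v hv
  rw [mem_toSet_iff, HM, mem_sep]
  simp [hv 0]

theorem HM_model {κ M : ZFSet} (h : InfCard κ) (hM : IsTransModel M) (hκ : κ ∈ M) :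
    IsTransModel (HM κ M) := by
  have zM := hM.zfm
  have hempty : ∅ ∈ HM κ M := HM_subset_kappa h zM hκ zM.empty (empty_subset _)
  refine ⟨HM_tr zM, HM_subset_kappa h zM hκ hM.2.1 h.omega_sub, ?_, ?_, ?_, ?_, ?_⟩
  · intro x hx y hy
    exact HM_pair h hM hκ hx hy
  · intro x hx
    obtain ⟨hxM, f, hf, hT, η, hη, rfl⟩ := mem_sep.1 hx
    refine HM_of_sub h zM hκ (zM.union _ hxM) hf hT ?_
    intro y hy
    obtain ⟨w, hw, hy⟩ := mem_sUnion.1 hy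
    obtain ⟨η', hη', rfl⟩ := hT η hη w hw
    exact hT η' hη' y hy
  · intro φ v hv a ha
    obtain ⟨haM, f, hf, hT, η, hη, e⟩ := mem_sep.1 ha
    have hb : ZFSet.sep (fun x => Sat (HM κ M).toSet φ (Function.update v 0 x)) a ∈ M := by
      refine zM.sep ?_ haM
      have := Dfn.sat zM.empty (D := (HM κ M).toSet) (fun x hx => HM_sub hx) (dfn_HM zM hκ) φ
        (fun n (w : ℕ → ZFSet) => Function.update v 0 (w 0) n) (by
          intro n
          by_cases e : n = 0
          · subst e; simpa using zM.dvar 0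
          · simpa [Function.update, e] using DT.const (HM_sub (hv n)))
      exact this
    refine ⟨_, HM_of_sub h zM hκ hb hf hT ?_, ?_⟩
    · intro y hy
      have := (mem_sep.1 hy).1
      rw [← e] at this
      exact hT η hη y this
    · intro x
      rw [mem_sep]
  · intro φ v hv a ha H
    obtain ⟨haM, f, hf, hT, η, hη, e⟩ := mem_sep.1 ha
    obtain ⟨g, hg, -, hg2⟩ := uniformize (Q := fun ξ y => y ∈ (HM κ M).toSet ∧
      Sat (HM κ M).toSet φ (Function.update (Function.update v 0 (fapp f ξ)) 1 y)) hM (by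
        apply Dfn.and
        · exact Dfn.inst1 (E := fun x => x ∈ (HM κ M).toSet) zM (dfn_HM zM hκ) (zM.dvar 1)
        · exact Dfn.sat zM.empty (D := (HM κ M).toSet) (fun x hx => HM_sub hx) (dfn_HM zM hκ) φ
            (fun n (w : ℕ → ZFSet) =>
              Function.update (Function.update v 0 (fapp f (w 0))) 1 (w 1) n) (by
            intro n
            by_cases e : n = 1
            · subst e; simpa using zM.dvar 1
            · by_cases e' : n = 0
              · subst e'; simpa [Function.update] using zM.dfapp (.const hf) (zM.dvar 0)
              · simpa [Function.update, e, e'] using DT.const (HM_sub (hv n)))) hκ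
    let t : ZFSet → ZFSet := fun ξ => if fapp f ξ ∈ a then fapp g ξ else ∅
    have ht : DT M (fun v => t (v 0)) :=
      DT.ite (DT.mem (zM.dfapp (.const hf) (zM.dvar 0)) (.const haM))
        (zM.dfapp (.const hg) (zM.dvar 0)) (.const zM.empty)
    have hgood : ∀ ξ ∈ κ, fapp f ξ ∈ a → fapp g ξ ∈ (HM κ M).toSet ∧
      Sat (HM κ M).toSet φ (Function.update (Function.update v 0 (fapp f ξ)) 1 (fapp g ξ)) := by
      intro ξ hξ hξa
      obtain ⟨y, hy, hy'⟩ := H _ hξa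
      exact hg2 ξ hξ ⟨y, HM_sub hy, hy, hy'⟩
    refine ⟨zimg t κ, ?_, ?_⟩
    · refine HM_of_card (g := zfun t κ) h hM hκ (zM.zimg_mem ht hκ) (zM.zfun_mem ht hκ) ?_ ?_
      · intro ξ hξ
        rw [fapp_zfun hξ]
        dsimp only [t]
        split_ifs with e
        · exact (hgood ξ hξ e).1
        · exact hempty
      · intro y hy
        obtain ⟨ξ, hξ, rfl⟩ := mem_zimg.1 hy
        exact ⟨ξ, hξ, fapp_zfun hξ⟩
    · intro x hx
      obtain ⟨ξ, hξ, rfl⟩ := hT η hη x (by rw [e]; exact hx)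
      refine ⟨fapp g ξ, mem_zimg.2 ⟨ξ, hξ, ?_⟩, (hgood ξ hξ hx).2⟩
      simp only [t, if_pos hx]
  · intro x hx
    obtain ⟨hxM, f, hf, hT, η, hη, e⟩ := mem_sep.1 hx
    obtain ⟨r, hr, hwo⟩ := hM.2.2.2.2.2.2 x hxM
    refine ⟨r, ?_, hwo⟩
    have hfH : ∀ ξ ∈ κ, fapp f ξ ∈ HM κ M := fun ξ hξ =>
      mem_sep.2 ⟨zM.fapp_mem hf (zM.tr.mem_trans hξ hκ), f, hf, hT, ξ, hξ, rfl⟩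
    obtain ⟨k, hk, -, hk1, hk2⟩ := reindex (val := fun ξ η => ZFSet.pair (fapp f ξ) (fapp f η))
      h zM hκ (zM.dpair (zM.dfapp (.const hf) (zM.dvar 0)) (zM.dfapp (.const hf) (zM.dvar 1)))
    refine HM_of_card h hM hκ hr hk ?_ ?_
    · intro ζ hζ
      rcases hk2 ζ hζ with e | ⟨ξ, hξ, η, hη, e⟩
      · rw [e]; exact hempty
      · rw [e]
        have h1 : ({fapp f ξ} : ZFSet) ∈ HM κ M := by
          have := HM_pair h hM hκ (hfH ξ hξ) (hfH ξ hξ)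
          rwa [pair_eq_singleton] at this
        exact HM_pair h hM hκ h1 (HM_pair h hM hκ (hfH ξ hξ) (hfH η hη))
    · intro p hp
      obtain ⟨a, ha, b, hb, rfl⟩ := hwo.1 p hp
      rw [← e] at ha hb
      obtain ⟨ξ, hξ, rfl⟩ := hT η hη a ha
      obtain ⟨ζ, hζ, rfl⟩ := hT η hη b hb
      exact ⟨_, gp_mem h hξ hζ, hk1 _ hξ _ hζ⟩

theorem IsMUModel.exists_SW {κ U M x : ZFSet} (h : InfCard κ) (hM : IsMUModel κ U M) (hx : x ∈ M) :
    ∃ f ∈ M, SW κ f x := by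
  obtain ⟨⟨hMt, hκ, -⟩, -, hU, hmin⟩ := hM
  have zM := hMt.zfm
  have : M ⊆ HM κ M := by
    apply hmin _ (HM_model h hMt hκ) (HM_subset_kappa h zM hκ hκ (fun _ h => h))
    obtain ⟨h1, h2, h3, h4, h5, h6, h7⟩ := hU
    refine ⟨?_, h2, h3, h4, ?_, ?_, ?_⟩
    · intro A hA
      exact ⟨HM_subset_kappa h zM hκ (h1 A hA).1 (h1 A hA).2, (h1 A hA).2⟩
    · intro A hA B hB
      exact h5 A hA B (HM_sub hB)
    · intro B hB
      exact h6 B (HM_sub hB)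
    · intro f hf
      exact h7 f (HM_sub hf)
  exact (mem_sep.1 (this hx)).2



theorem dcompl {κ T : ZFSet} (hT : ZFm T) (hκ : κ ∈ T) {t : (ℕ → ZFSet) → ZFSet} (ht : DT T t) :
    DT T (fun v => compl κ (t v)) := by
  unfold compl
  apply hT.dsep (.const hκ)
  apply Dfn.not
  exact DT.mem (hT.dvar 0) ht.weak

theorem compl_compl {κ A : ZFSet} (h : A ⊆ κ) : compl κ (compl κ A) = A := by
  ext x
  simp only [compl, mem_sep]
  constructor
  · rintro ⟨h1, h2⟩
    by_contra h3
    exact h2 ⟨h1, h3⟩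
  · intro hx
    exact ⟨h hx, fun h' => h'.2 hx⟩

/-- `g` is a collapse of the relation on `κ` coded by `R`. -/
def isCol (κ R g : ZFSet) : Prop :=
  ∀ ξ ∈ κ, fapp g ξ = zimg (fun η => fapp g η) (ZFSet.sep (fun η => gp κ η ξ ∈ R) κ)

theorem dfn_isCol {κ T : ZFSet} (h : InfCard κ) (hT : ZFm T) (hκ : κ ∈ T) :
    Dfn T (fun v => isCol κ (v 0) (v 1)) := by
  unfold isCol
  apply DT.ball hT.tr (.const hκ)
  apply DT.eq (hT.dfapp (hT.dvar 2) (hT.dvar 0))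
  apply hT.dzimg
  · apply hT.dsep (.const hκ)
    exact DT.mem (dgp h hT hκ (hT.dvar 0) (hT.dvar 1)) (hT.dvar 2)
  · exact hT.dfapp (hT.dvar 3) (hT.dvar 0)

theorem isCol_iff {κ R g : ZFSet} : isCol κ R g ↔
    ∀ ξ ∈ κ, ∀ z, z ∈ fapp g ξ ↔ ∃ η ∈ κ, gp κ η ξ ∈ R ∧ z = fapp g η := by
  unfold isCol
  refine forall₂_congr fun ξ hξ => ?_
  rw [ZFSet.ext_iff]
  refine forall_congr' fun z => ?_
  simp only [mem_zimg, mem_sep, and_assoc]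

theorem isCol_unique {κ R g g' : ZFSet} (h : isCol κ R g) (h' : isCol κ R g') :
    ∀ x, ∀ ξ ∈ κ, fapp g ξ = x → fapp g' ξ = fapp g ξ := by
  intro x
  induction x using ZFSet.inductionOn with
  | _ x ih =>
    intro ξ hξ e
    have h1 := isCol_iff.1 h ξ hξ
    ext z
    rw [h1, isCol_iff.1 h' ξ hξ]
    refine exists_congr fun η => and_congr_right fun hη => and_congr_right fun hR => ?_
    rw [ih (fapp g η) (by rw [← e, h1]; exact ⟨η, hη, hR, rfl⟩) η hη rfl]

theorem isCol_transfer {κ R g T : ZFSet} (h : InfCard κ) (hT : ZFm T) (hκ : κ ∈ T) (hR : R ∈ T)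
    (hg : isCol κ R g) : zfun (fapp g) κ ∈ T :=
  collapse (E := fun η ξ => gp κ η ξ ∈ R) hT hκ
    (DT.mem (dgp h hT hκ (hT.dvar 0) (hT.dvar 1)) (.const hR)) (isCol_iff.1 hg)

theorem isCol_zfun {κ R g : ZFSet} (hg : isCol κ R g) : isCol κ R (zfun (fapp g) κ) := by
  rw [isCol_iff] at hg ⊢
  intro ξ hξ z
  rw [fapp_zfun hξ, hg ξ hξ]
  refine exists_congr fun η => and_congr_right fun hη => ?_
  rw [fapp_zfun hη]

theorem MU_mem {κ U M N : ZFSet} (h : InfCard κ) (hM : IsMUModel κ U M) (hN : ZFm N)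
    (hκN : κ ∈ N) (hUN : U ∈ N) : M ∈ N := by
  have hSW := fun x (hx : x ∈ M) => hM.exists_SW h hx
  obtain ⟨⟨hMt, hκ, -⟩, -, hU, -⟩ := hM
  have zM := hMt.zfm
  let PU := U ∪ zimg (compl κ) U
  have hPN : PU ∈ N := hN.union_mem hUN (hN.zimg_mem (dcompl hN hκN (hN.dvar 0)) hUN)
  have hP1 : ∀ R ∈ PU, R ∈ M := by
    intro R hR
    rcases mem_union.1 hR with hR | hR
    · exact (hU.1 R hR).1
    · obtain ⟨A, hA, rfl⟩ := mem_zimg.1 hR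
      exact zM.const_mem (dcompl zM hκ (.const (hU.1 A hA).1))
  have hP2 : ∀ R ∈ M, R ⊆ κ → R ∈ PU := by
    intro R hR hRκ
    rcases hU.2.2.2.2.2.1 R hR hRκ with h | h
    · exact mem_union.2 (Or.inl h)
    · exact mem_union.2 (Or.inr (mem_zimg.2 ⟨_, h, (compl_compl hRκ).symm⟩))
  obtain ⟨b, hb, Hb⟩ := hN.coll (Q := fun R g => isCol κ R g ∨ ¬ ∃ g ∈ N, isCol κ R g) (by
    apply Dfn.or (dfn_isCol h hN hκN)
    apply Dfn.not
    apply Dfn.ex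
    exact Dfn.inst2 (E := isCol κ) hN (dfn_isCol h hN hκN) (hN.dvar 1) (hN.dvar 0)) hPN (by
    intro x hx
    by_cases e : ∃ g ∈ N, isCol κ x g
    · obtain ⟨y, hy, e⟩ := e
      exact ⟨y, hy, Or.inl e⟩
    · exact ⟨∅, hN.empty, Or.inr e⟩)
  have : M = ⋃₀ (zimg (fun g => zimg (fapp g) κ) (ZFSet.sep (fun g => ∃ R ∈ PU, isCol κ R g) b)) := by
    ext x
    rw [mem_sUnion]
    constructor
    · intro hx
      obtain ⟨f, hf, hT, η, hη, e⟩ := hSW x hx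
      let R := ZFSet.sep (fun ζ => ∃ η ∈ κ, ∃ ξ ∈ κ, ζ = gp κ η ξ ∧ fapp f η ∈ fapp f ξ) κ
      have hRM : R ∈ M := by
        apply zM.sep _ hκ
        apply DT.bex zM.tr (.const hκ)
        apply DT.bex zM.tr (.const hκ)
        exact Dfn.and (DT.eq (zM.dvar 2) (dgp h zM hκ (zM.dvar 1) (zM.dvar 0)))
          (DT.mem (zM.dfapp (.const hf) (zM.dvar 1)) (zM.dfapp (.const hf) (zM.dvar 0)))
      have hRP : R ∈ PU := hP2 R hRM (fun x hx => (mem_sep.1 hx).1)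
      have hRg : ∀ η ∈ κ, ∀ ξ ∈ κ, gp κ η ξ ∈ R ↔ fapp f η ∈ fapp f ξ := by
        intro η hη ξ hξ
        simp only [R, mem_sep]
        constructor
        · rintro ⟨_, η', hη', ξ', hξ', e, he⟩
          obtain ⟨rfl, rfl⟩ := gp_inj h hη hξ hη' hξ' e
          exact he
        · intro he
          exact ⟨gp_mem h hη hξ, η, hη, ξ, hξ, rfl, he⟩
      have hcol : isCol κ R f := by
        rw [isCol_iff]
        intro ξ hξ z
        constructor
        · intro hz
          obtain ⟨η', hη', rfl⟩ := hT ξ hξ z hz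
          exact ⟨η', hη', (hRg _ hη' _ hξ).2 hz, rfl⟩
        · rintro ⟨η', hη', hR, rfl⟩
          exact (hRg _ hη' _ hξ).1 hR
      have hgN := isCol_transfer h hN hκN (hN.tr.mem_trans hRP hPN) hcol
      obtain ⟨g, hg, hg'⟩ := Hb R hRP
      have hg' := hg'.resolve_right (not_not.2 ⟨_, hgN, isCol_zfun hcol⟩)
      refine ⟨_, mem_zimg.2 ⟨g, mem_sep.2 ⟨hg, R, hRP, hg'⟩, rfl⟩, mem_zimg.2 ⟨η, hη, ?_⟩⟩
      rw [isCol_unique hcol hg' _ η hη rfl, e]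
    · rintro ⟨w, hw, hx⟩
      obtain ⟨g, hg, rfl⟩ := mem_zimg.1 hw
      obtain ⟨ξ, hξ, rfl⟩ := mem_zimg.1 hx
      obtain ⟨hgb, R, hR, hcol⟩ := mem_sep.1 hg
      have hgM := isCol_transfer h zM hκ (hP1 R hR) hcol
      rw [← fapp_zfun (f := fapp g) hξ]
      exact zM.fapp_mem hgM (zM.tr.mem_trans hξ hκ)
  rw [this]
  apply hN.union
  apply hN.zimg_mem
  · apply hN.dzimg (.const hκN)
    exact hN.dfapp (hN.dvar 1) (hN.dvar 0)
  · apply hN.sep _ hb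
    apply DT.bex hN.tr (.const hPN)
    exact Dfn.inst2 (E := isCol κ) hN (dfn_isCol h hN hκN) (hN.dvar 0) (hN.dvar 1)



/-- The standing assumptions on an ultrafilter over a model. -/
structure UFS (κ M U : ZFSet) : Prop where
  card : InfCard κ
  tm : IsTransModel M
  hκ : κ ∈ M
  uf : IsMUltrafilter κ M U

theorem isZFunc_iff {κ f : ZFSet} : IsZFunc κ f ↔ f = zfun (fapp f) κ := by
  constructor
  · intro h
    exact h.ext (isZFunc_zfun _ _) (fun a ha => (fapp_zfun ha).symm)
  · intro h
    rw [h]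
    exact isZFunc_zfun _ _

/-- The functions on `κ` in `M`. -/
def FD.{u} (κ M : ZFSet.{u}) : ZFSet.{u} := ZFSet.sep (fun f => IsZFunc κ f) M

theorem mem_FD {κ M f : ZFSet} : f ∈ FD κ M ↔ f ∈ M ∧ IsZFunc κ f := mem_sep

/-- The statement `P` holds `U`-almost everywhere. -/
def UP (κ U : ZFSet) (P : ZFSet → Prop) : Prop := ZFSet.sep P κ ∈ U

namespace UFS

theorem zM {κ M U : ZFSet} (h : UFS κ M U) : ZFm M := h.tm.zfm

theorem mono {κ M U : ZFSet} (h : UFS κ M U) {P Q : ZFSet → Prop} (hQ : Dfn M (fun v => Q (v 0)))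
    (hP : UP κ U P) (H : ∀ ξ ∈ κ, P ξ → Q ξ) : UP κ U Q := by
  refine h.uf.2.2.2.2.1 _ hP _ (h.zM.sep hQ h.hκ) (fun x hx => (mem_sep.1 hx).1) ?_
  intro x hx
  rw [mem_sep] at hx ⊢
  exact ⟨hx.1, H x hx.1 hx.2⟩

theorem univ {κ M U : ZFSet} (h : UFS κ M U) {Q : ZFSet → Prop} (H : ∀ ξ ∈ κ, Q ξ) : UP κ U Q := by
  have := h.uf.2.1 ∅ h.card.empty_mem
  unfold UP
  convert this using 1
  unfold tailSet
  ext x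
  simp only [mem_sep]
  simp
  exact H x

theorem kmem {κ M U : ZFSet} (h : UFS κ M U) : κ ∈ U := by
  have := h.univ (Q := fun _ => True) (fun _ _ => trivial)
  unfold UP at this
  convert this using 1
  ext x
  simp

theorem and {κ M U : ZFSet} (h : UFS κ M U) {P Q : ZFSet → Prop} (hP : UP κ U P) (hQ : UP κ U Q) :
    UP κ U (fun ξ => P ξ ∧ Q ξ) := by
  have := h.uf.2.2.2.1 _ hP _ hQ
  unfold UP
  convert this using 1
  ext x
  simp only [mem_sep, mem_inter]
  tauto

theorem exists_of {κ M U : ZFSet} (h : UFS κ M U) {P : ZFSet → Prop} (hP : UP κ U P) :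
    ∃ ξ ∈ κ, P ξ := by
  by_contra e
  push Not at e
  apply h.uf.2.2.1
  unfold UP at hP
  convert hP using 1
  symm
  rw [eq_empty]
  intro y hy
  rw [mem_sep] at hy
  exact e y hy.1 hy.2

theorem not {κ M U : ZFSet} (h : UFS κ M U) {P : ZFSet → Prop} (hP : Dfn M (fun v => P (v 0))) :
    UP κ U (fun ξ => ¬ P ξ) ↔ ¬ UP κ U P := by
  constructor
  · intro h1 h2
    obtain ⟨ξ, _, h3, h4⟩ := h.exists_of (h.and h1 h2)
    exact h3 h4
  · intro h1
    have := (h.uf.2.2.2.2.2.1 _ (h.zM.sep hP h.hκ) (fun x hx => (mem_sep.1 hx).1)).resolve_left h1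
    unfold UP
    convert this using 1
    unfold compl
    ext x
    simp only [mem_sep]
    tauto

theorem congr {κ M U : ZFSet} {P Q : ZFSet → Prop} (_ : UFS κ M U)
    (H : ∀ ξ ∈ κ, (P ξ ↔ Q ξ)) : UP κ U P ↔ UP κ U Q := by
  unfold UP
  have : ZFSet.sep P κ = ZFSet.sep Q κ := by
    ext x
    simp only [mem_sep]
    exact and_congr_right (H x)
  rw [this]

theorem imp {κ M U : ZFSet} (h : UFS κ M U) {P Q : ZFSet → Prop} (hP : Dfn M (fun v => P (v 0)))
    (hQ : Dfn M (fun v => Q (v 0))) : UP κ U (fun ξ => P ξ → Q ξ) ↔ (UP κ U P → UP κ U Q) := by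
  constructor
  · intro h1 h2
    exact h.mono hQ (h.and h1 h2) (fun ξ _ h => h.1 h.2)
  · intro h1
    by_cases e : UP κ U P
    · exact h.mono (hP.imp hQ) (h1 e) (fun ξ _ h _ => h)
    · exact h.mono (hP.imp hQ) ((h.not hP).2 e) (fun ξ _ h h' => absurd h' h)

theorem or {κ M U : ZFSet} (h : UFS κ M U) {P Q : ZFSet → Prop} (hP : Dfn M (fun v => P (v 0)))
    (hQ : Dfn M (fun v => Q (v 0))) : UP κ U (fun ξ => P ξ ∨ Q ξ) ↔ (UP κ U P ∨ UP κ U Q) := by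
  constructor
  · intro h1
    by_contra e
    push Not at e
    obtain ⟨ξ, _, h3, h4, h5⟩ := h.exists_of (h.and h1 (h.and ((h.not hP).2 e.1) ((h.not hQ).2 e.2)))
    tauto
  · rintro (h1 | h1)
    · exact h.mono (hP.or hQ) h1 (fun ξ _ h => Or.inl h)
    · exact h.mono (hP.or hQ) h1 (fun ξ _ h => Or.inr h)

theorem pick {κ M U : ZFSet} (h : UFS κ M U) {Q : ZFSet → ZFSet → Prop}
    (hQ : Dfn M (fun v => Q (v 0) (v 1))) (H : UP κ U (fun ξ => ∃ y ∈ M, Q ξ y)) :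
    ∃ f ∈ FD κ M, UP κ U (fun ξ => Q ξ (fapp f ξ)) := by
  obtain ⟨f, hf, hf1, hf2⟩ := uniformize h.tm hQ h.hκ
  refine ⟨f, mem_FD.2 ⟨hf, hf1⟩, h.mono ?_ H ?_⟩
  · exact Dfn.inst2 (E := Q) h.zM hQ (h.zM.dvar 0) (h.zM.dfapp (.const hf) (h.zM.dvar 0))
  · exact hf2

theorem pick_mem {κ M U : ZFSet} (h : UFS κ M U) {Q : ZFSet → ZFSet → Prop}
    (hQ : Dfn M (fun v => Q (v 0) (v 1))) {g : ZFSet} (hg : g ∈ FD κ M)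
    (H : UP κ U (fun ξ => ∃ y ∈ fapp g ξ, Q ξ y)) :
    ∃ f ∈ FD κ M, UP κ U (fun ξ => fapp f ξ ∈ fapp g ξ ∧ Q ξ (fapp f ξ)) := by
  have hgM := (mem_FD.1 hg).1
  have hQ1 : Dfn M (fun v => v 1 ∈ fapp g (v 0) ∧ Q (v 0) (v 1)) :=
    Dfn.and (DT.mem (h.zM.dvar 1) (h.zM.dfapp (.const hgM) (h.zM.dvar 0))) hQ
  refine h.pick (Q := fun ξ y => y ∈ fapp g ξ ∧ Q ξ y) hQ1 (h.mono ?_ H ?_)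
  · apply Dfn.ex
    exact Dfn.inst2 (E := fun ξ y => y ∈ fapp g ξ ∧ Q ξ y) h.zM hQ1 (h.zM.dvar 1) (h.zM.dvar 0)
  · rintro ξ hξ ⟨y, hy, hy'⟩
    exact ⟨y, h.zM.tr.mem_trans hy (h.zM.fapp_mem hgM (h.zM.tr.mem_trans hξ h.hκ)), hy, hy'⟩

/-- definability of evaluation of a function in the model -/
theorem dev {κ M U f : ZFSet} (h : UFS κ M U) (hf : f ∈ FD κ M) (i : ℕ) :
    DT M (fun v => fapp f (v i)) := h.zM.dfapp (.const (mem_FD.1 hf).1) (h.zM.dvar i)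

theorem lam {κ M U : ZFSet} (h : UFS κ M U) {t : ZFSet → ZFSet} (ht : DT M (fun v => t (v 0))) :
    zfun t κ ∈ FD κ M := mem_FD.2 ⟨h.zM.zfun_mem ht h.hκ, isZFunc_zfun _ _⟩

theorem con {κ M U x : ZFSet} (h : UFS κ M U) (hx : x ∈ M) : zfun (fun _ => x) κ ∈ FD κ M :=
  h.lam (.const hx)

theorem idf {κ M U : ZFSet} (h : UFS κ M U) : zfun (fun x => x) κ ∈ FD κ M :=
  h.lam (h.zM.dvar 0)

end UFS

/-- `G` is a collapse of the ultrapower. -/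
def IsUC (κ M U : ZFSet) (G : ZFSet → ZFSet) : Prop :=
  ∀ f ∈ FD κ M, ∀ z, z ∈ G f ↔ ∃ e ∈ FD κ M, UP κ U (fun ξ => fapp e ξ ∈ fapp f ξ) ∧ z = G e

namespace UFS

theorem eq_of {κ M U : ZFSet} (h : UFS κ M U) {G : ZFSet → ZFSet} (hG : IsUC κ M U G)
    {f g : ZFSet} (hf : f ∈ FD κ M) (hg : g ∈ FD κ M)
    (H : UP κ U (fun ξ => fapp f ξ = fapp g ξ)) : G f = G g := by
  ext z
  rw [hG f hf, hG g hg]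
  refine exists_congr fun e => and_congr_right fun he => and_congr_left fun _ => ?_
  constructor
  · intro h1
    exact h.mono (DT.mem (h.dev he 0) (h.dev hg 0)) (h.and h1 H) (fun ξ _ h => h.2 ▸ h.1)
  · intro h1
    exact h.mono (DT.mem (h.dev he 0) (h.dev hf 0)) (h.and h1 H) (fun ξ _ h => h.2 ▸ h.1)

theorem diff_aux {κ M U : ZFSet} (h : UFS κ M U) {G : ZFSet → ZFSet} (hG : IsUC κ M U G)
    {f g : ZFSet} (hf : f ∈ FD κ M) (hg : g ∈ FD κ M) (e : G f = G g)
    (ih : ∀ y ∈ G f, ∀ f ∈ FD κ M, ∀ g ∈ FD κ M, G f = y → G g = y →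
      UP κ U (fun ξ => fapp f ξ = fapp g ξ)) :
    ¬ UP κ U (fun ξ => ∃ y ∈ fapp f ξ, y ∉ fapp g ξ) := by
  intro H
  obtain ⟨k, hk, hk'⟩ := h.pick_mem (Q := fun ξ y => y ∉ fapp g ξ)
    (Dfn.not (DT.mem (h.zM.dvar 1) (h.dev hg 0))) hf H
  have h1 : UP κ U (fun ξ => fapp k ξ ∈ fapp f ξ) :=
    h.mono (DT.mem (h.dev hk 0) (h.dev hf 0)) hk' (fun _ _ h => h.1)
  have h2 : G k ∈ G f := (hG f hf _).2 ⟨k, hk, h1, rfl⟩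
  have h3 := h2
  rw [e] at h3
  obtain ⟨l, hl, hl1, hl2⟩ := (hG g hg _).1 h3
  have h4 := ih _ h2 k hk l hl rfl hl2.symm
  obtain ⟨ξ, _, a, b, c⟩ := h.exists_of (h.and hl1 (h.and h4 hk'))
  rw [b] at c
  exact c.2 a

theorem eq_iff {κ M U : ZFSet} (h : UFS κ M U) {G : ZFSet → ZFSet} (hG : IsUC κ M U G)
    {f g : ZFSet} (hf : f ∈ FD κ M) (hg : g ∈ FD κ M) :
    G f = G g ↔ UP κ U (fun ξ => fapp f ξ = fapp g ξ) := by
  refine ⟨?_, h.eq_of hG hf hg⟩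
  have key : ∀ x, ∀ f ∈ FD κ M, ∀ g ∈ FD κ M, G f = x → G g = x →
      UP κ U (fun ξ => fapp f ξ = fapp g ξ) := by
    intro x
    induction x using ZFSet.inductionOn with
    | _ x ih =>
      intro f hf g hg ef eg
      have d1 : ∀ a ∈ FD κ M, ∀ b ∈ FD κ M,
          Dfn M (fun v => ∃ y ∈ fapp a (v 0), y ∉ fapp b (v 0)) := by
        intro a ha b hb
        apply DT.bex h.zM.tr (h.dev ha 0)
        exact Dfn.not (DT.mem (h.zM.dvar 0) (h.dev hb 1))
      have h1 := (h.not (d1 f hf g hg)).2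
        (h.diff_aux hG hf hg (ef.trans eg.symm) (by rw [ef]; exact ih))
      have h2 := (h.not (d1 g hg f hf)).2
        (h.diff_aux hG hg hf (eg.trans ef.symm) (by rw [eg]; exact ih))
      refine h.mono (DT.eq (h.dev hf 0) (h.dev hg 0)) (h.and h1 h2) ?_
      rintro ξ _ ⟨a, b⟩
      push Not at a b
      ext z
      exact ⟨a z, b z⟩
  intro e
  exact key _ f hf g hg e rfl

theorem mem_iff {κ M U : ZFSet} (h : UFS κ M U) {G : ZFSet → ZFSet} (hG : IsUC κ M U G)
    {f g : ZFSet} (hf : f ∈ FD κ M) (hg : g ∈ FD κ M) :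
    G f ∈ G g ↔ UP κ U (fun ξ => fapp f ξ ∈ fapp g ξ) := by
  rw [hG g hg]
  constructor
  · rintro ⟨e, he, h1, h2⟩
    rw [h.eq_iff hG hf he] at h2
    exact h.mono (DT.mem (h.dev hf 0) (h.dev hg 0)) (h.and h1 h2) (fun ξ _ h => h.2 ▸ h.1)
  · intro h1
    exact ⟨f, hf, h1, rfl⟩

theorem dfn_sat {κ M U : ZFSet} (h : UFS κ M U) (φ : Fml) (t : ℕ → (ℕ → ZFSet) → ZFSet)
    (ht : ∀ n, DT M (t n)) : Dfn M (fun v => Sat M.toSet φ (fun n => t n v)) :=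
  Dfn.sat h.zM.empty (D := M.toSet) (fun _ hx => hx)
    ((DT.eq (h.zM.dvar 0) (h.zM.dvar 0)).congr (fun v hv => by simp [mem_toSet_iff, hv 0])) φ t ht

theorem dfn_satF {κ M U : ZFSet} (h : UFS κ M U) (φ : Fml) {F : ℕ → ZFSet}
    (hF : ∀ n, F n ∈ FD κ M) (i : ℕ) : Dfn M (fun v => Sat M.toSet φ (fun n => fapp (F n) (v i))) :=
  h.dfn_sat φ _ (fun n => h.dev (hF n) i)

theorem los {κ M U : ZFSet} (h : UFS κ M U) {G : ZFSet → ZFSet} (hG : IsUC κ M U G) (φ : Fml) :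
    ∀ F : ℕ → ZFSet, (∀ n, F n ∈ FD κ M) →
      (Sat (zimg G (FD κ M)).toSet φ (fun n => G (F n)) ↔
        UP κ U (fun ξ => Sat M.toSet φ (fun n => fapp (F n) ξ))) := by
  induction φ with
  | mem i j => intro F hF; exact h.mem_iff hG (hF i) (hF j)
  | eq i j => intro F hF; exact h.eq_iff hG (hF i) (hF j)
  | impl φ ψ ih1 ih2 =>
    intro F hF
    have := h.imp (P := fun ξ => Sat M.toSet φ (fun n => fapp (F n) ξ))
      (Q := fun ξ => Sat M.toSet ψ (fun n => fapp (F n) ξ))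
      (h.dfn_satF φ hF 0) (h.dfn_satF ψ hF 0)
    simp only [Sat]
    rw [ih1 F hF, ih2 F hF]
    exact this.symm
  | neg φ ih =>
    intro F hF
    simp only [Sat]
    rw [ih F hF]
    exact (h.not (h.dfn_satF φ hF 0)).symm
  | all m φ ih =>
    intro F hF
    simp only [Sat]
    have upd : ∀ k, (Function.update (fun n => G (F n)) m (G k)) =
        fun n => G (Function.update F m k n) := by
      intro k
      funext n
      by_cases e : n = m
      · subst e; simp
      · simp [Function.update, e]
    have upd2 : ∀ k ξ, (fun n => fapp (Function.update F m k n) ξ) =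
        Function.update (fun n => fapp (F n) ξ) m (fapp k ξ) := by
      intro k ξ
      funext n
      by_cases e : n = m
      · subst e; simp
      · simp [Function.update, e]
    have hFk : ∀ k ∈ FD κ M, ∀ n, Function.update F m k n ∈ FD κ M := by
      intro k hk n
      by_cases e : n = m
      · subst e; simpa using hk
      · simpa [Function.update, e] using hF n
    have dQ : Dfn M (fun v => ¬ Sat M.toSet φ (Function.update (fun n => fapp (F n) (v 0)) m (v 1))) := by
      apply Dfn.not
      exact h.dfn_sat φ (fun n v => Function.update (fun n => fapp (F n) (v 0)) m (v 1) n) (by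
        intro n
        by_cases e : n = m
        · subst e; simpa using h.zM.dvar 1
        · simpa [Function.update, e] using h.dev (hF n) 0)
    have dAll : Dfn M (fun v => ∀ x ∈ M, Sat M.toSet φ
        (Function.update (fun n => fapp (F n) (v 0)) m x)) := by
      apply Dfn.all
      refine (Dfn.inst2 (E := fun ξ y => ¬ Sat M.toSet φ
        (Function.update (fun n => fapp (F n) ξ) m y)) h.zM dQ (h.zM.dvar 1)
        (h.zM.dvar 0)).not.congr ?_
      intro v _
      exact not_not
    constructor
    · intro H
      by_contra hc
      have hc := (h.not dAll).2 hc
      obtain ⟨k, hk, hk'⟩ := h.pick (Q := fun ξ y => ¬ Sat M.toSet φ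
        (Function.update (fun n => fapp (F n) ξ) m y)) dQ
        ((h.congr (fun ξ _ => by push Not; rfl)).1 hc)
      have := H (G k) (mem_zimg.2 ⟨k, hk, rfl⟩)
      rw [upd, ih _ (hFk k hk)] at this
      obtain ⟨ξ, _, h1, h2⟩ := h.exists_of (h.and hk' this)
      rw [upd2] at h2
      exact h1 h2
    · intro H x hx
      obtain ⟨k, hk, rfl⟩ := mem_zimg.1 hx
      rw [upd, ih _ (hFk k hk)]
      refine h.mono (h.dfn_satF φ (hFk k hk) 0) H ?_
      intro ξ hξ h1
      rw [upd2]
      exact h1 _ (h.zM.fapp_mem (mem_FD.1 hk).1 (h.zM.tr.mem_trans hξ h.hκ))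

end UFS


universe uu


theorem upd_comp (G : ZFSet → ZFSet) (F : ℕ → ZFSet) (m : ℕ) (k : ZFSet) :
    Function.update (fun n => G (F n)) m (G k) = fun n => G (Function.update F m k n) := by
  funext n
  by_cases e : n = m
  · subst e; simp
  · simp [Function.update, e]

theorem upd_mem {D : ZFSet} {F : ℕ → ZFSet} (hF : ∀ n, F n ∈ D) (m : ℕ) {k : ZFSet} (hk : k ∈ D) :
    ∀ n, Function.update F m k n ∈ D := by
  intro n
  by_cases e : n = m
  · subst e; simpa using hk
  · simpa [Function.update, e] using hF n

namespace UFS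

theorem dS1 {κ M U : ZFSet} (h : UFS κ M U) (φ : Fml) {F : ℕ → ZFSet} (hF : ∀ n, F n ∈ FD κ M)
    {a b : (ℕ → ZFSet) → ZFSet} (ha : DT M a) (hb : DT M b) (i : ℕ) :
    Dfn M (fun v => Sat M.toSet φ (Function.update (fun n => fapp (F n) (a v)) i (b v))) :=
  h.dfn_sat φ (fun n v => Function.update (fun n => fapp (F n) (a v)) i (b v) n) (by
    intro n
    by_cases e : n = i
    · subst e; simpa using hb
    · simpa [Function.update, e] using h.zM.dfapp (.const (mem_FD.1 (hF n)).1) ha)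

theorem dS2 {κ M U : ZFSet} (h : UFS κ M U) (φ : Fml) {F : ℕ → ZFSet} (hF : ∀ n, F n ∈ FD κ M)
    {a b c : (ℕ → ZFSet) → ZFSet} (ha : DT M a) (hb : DT M b) (hc : DT M c) :
    Dfn M (fun v => Sat M.toSet φ
      (Function.update (Function.update (fun n => fapp (F n) (a v)) 0 (b v)) 1 (c v))) :=
  h.dfn_sat φ (fun n v =>
    Function.update (Function.update (fun n => fapp (F n) (a v)) 0 (b v)) 1 (c v) n) (by
    intro n
    by_cases e : n = 1
    · subst e; simpa using hc
    · by_cases e' : n = 0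
      · subst e'; simpa [Function.update] using hb
      · simpa [Function.update, e, e'] using h.zM.dfapp (.const (mem_FD.1 (hF n)).1) ha)

theorem los1 {κ M U : ZFSet} (h : UFS κ M U) {G : ZFSet → ZFSet} (hG : IsUC κ M U G) (φ : Fml)
    {F : ℕ → ZFSet} (hF : ∀ n, F n ∈ FD κ M) (i : ℕ) {k : ZFSet} (hk : k ∈ FD κ M) :
    Sat (zimg G (FD κ M)).toSet φ (Function.update (fun n => G (F n)) i (G k)) ↔
    UP κ U (fun ξ => Sat M.toSet φ (Function.update (fun n => fapp (F n) ξ) i (fapp k ξ))) := by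
  rw [upd_comp, h.los hG φ _ (upd_mem hF i hk)]
  apply h.congr
  intro ξ _
  rw [upd_comp (fun f => fapp f ξ)]

theorem los2 {κ M U : ZFSet} (h : UFS κ M U) {G : ZFSet → ZFSet} (hG : IsUC κ M U G) (φ : Fml)
    {F : ℕ → ZFSet} (hF : ∀ n, F n ∈ FD κ M) {k l : ZFSet} (hk : k ∈ FD κ M) (hl : l ∈ FD κ M) :
    Sat (zimg G (FD κ M)).toSet φ
      (Function.update (Function.update (fun n => G (F n)) 0 (G k)) 1 (G l)) ↔
    UP κ U (fun ξ => Sat M.toSet φ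
      (Function.update (Function.update (fun n => fapp (F n) ξ) 0 (fapp k ξ)) 1 (fapp l ξ))) := by
  rw [upd_comp G F 0 k, h.los1 hG φ (upd_mem hF 0 hk) 1 hl]
  apply h.congr
  intro ξ _
  rw [upd_comp (fun f => fapp f ξ) F 0 k]

theorem mem_lam {κ M U : ZFSet} (h : UFS κ M U) {G : ZFSet → ZFSet} (hG : IsUC κ M U G)
    {t : ZFSet → ZFSet} (ht : DT M (fun v => t (v 0))) {z : ZFSet} :
    z ∈ G (zfun t κ) ↔ ∃ e ∈ FD κ M, UP κ U (fun ξ => fapp e ξ ∈ t ξ) ∧ z = G e := by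
  rw [hG _ (h.lam ht)]
  refine exists_congr fun e => and_congr_right fun he => and_congr_left fun _ => ?_
  apply h.congr
  intro ξ hξ
  rw [fapp_zfun hξ]

theorem G_upair {κ M U : ZFSet.{uu}} (h : UFS κ M U) {G : ZFSet.{uu} → ZFSet.{uu}} (hG : IsUC κ M U G)
    {f g : ZFSet} (hf : f ∈ FD κ M) (hg : g ∈ FD κ M) :
    G (zfun (fun ξ => ({fapp f ξ, fapp g ξ} : ZFSet)) κ) = {G f, G g} := by
  ext z
  rw [h.mem_lam hG (t := fun ξ => ({fapp f ξ, fapp g ξ} : ZFSet))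
    (h.zM.dupair (h.dev hf 0) (h.dev hg 0)), mem_pair]
  have key : ∀ e ∈ FD κ M, UP κ U (fun ξ => fapp e ξ ∈ ({fapp f ξ, fapp g ξ} : ZFSet)) ↔
      (G e = G f ∨ G e = G g) := by
    intro e he
    rw [h.eq_iff hG he hf, h.eq_iff hG he hg, ← h.or (P := fun ξ => fapp e ξ = fapp f ξ) (Q := fun ξ => fapp e ξ = fapp g ξ)
      (DT.eq (h.dev he 0) (h.dev hf 0))
      (DT.eq (h.dev he 0) (h.dev hg 0))]
    exact h.congr (fun ξ _ => mem_pair)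
  constructor
  · rintro ⟨e, he, h1, rfl⟩
    exact (key e he).1 h1
  · rintro (rfl | rfl)
    · exact ⟨f, hf, (key f hf).2 (Or.inl rfl), rfl⟩
    · exact ⟨g, hg, (key g hg).2 (Or.inr rfl), rfl⟩

theorem G_con_empty {κ M U : ZFSet.{uu}} (h : UFS κ M U) {G : ZFSet.{uu} → ZFSet.{uu}} (hG : IsUC κ M U G) :
    G (zfun (fun _ => ∅) κ) = ∅ := by
  rw [eq_empty]
  intro z hz
  rw [h.mem_lam hG (.const h.zM.empty)] at hz
  obtain ⟨e, he, h1, _⟩ := hz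
  obtain ⟨ξ, _, h2⟩ := h.exists_of h1
  simp at h2

theorem N_tr {κ M U : ZFSet.{uu}} (_ : UFS κ M U) {G : ZFSet.{uu} → ZFSet.{uu}} (hG : IsUC κ M U G) :
    (zimg G (FD κ M)).IsTransitive := by
  intro x hx z hz
  obtain ⟨f, hf, rfl⟩ := mem_zimg.1 hx
  obtain ⟨e, he, _, rfl⟩ := (hG f hf z).1 hz
  exact mem_zimg.2 ⟨e, he, rfl⟩

theorem N_zfm {κ M U : ZFSet.{uu}} (h : UFS κ M U) {G : ZFSet.{uu} → ZFSet.{uu}} (hG : IsUC κ M U G) :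
    ZFm (zimg G (FD κ M)) where
  tr := h.N_tr hG
  empty := mem_zimg.2 ⟨_, h.con h.zM.empty, (h.G_con_empty hG).symm⟩
  pairing := by
    intro x hx y hy
    obtain ⟨f, hf, rfl⟩ := mem_zimg.1 hx
    obtain ⟨g, hg, rfl⟩ := mem_zimg.1 hy
    exact mem_zimg.2 ⟨_, h.lam (t := fun ξ => ({fapp f ξ, fapp g ξ} : ZFSet))
      (h.zM.dupair (h.dev hf 0) (h.dev hg 0)), (h.G_upair hG hf hg).symm⟩
  union := by
    intro x hx
    obtain ⟨f, hf, rfl⟩ := mem_zimg.1 hx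
    have dt : DT M (fun v => (fun ξ => (⋃₀ (fapp f ξ) : ZFSet)) (v 0)) := h.zM.dsUnion (h.dev hf 0)
    refine mem_zimg.2 ⟨_, h.lam (t := fun ξ => (⋃₀ (fapp f ξ) : ZFSet)) dt, ?_⟩
    ext z
    rw [h.mem_lam hG (t := fun ξ => (⋃₀ (fapp f ξ) : ZFSet)) dt, mem_sUnion]
    constructor
    · rintro ⟨w, hw, hz⟩
      obtain ⟨g, hg, hg1, rfl⟩ := (hG f hf w).1 hw
      obtain ⟨e, he, he1, rfl⟩ := (hG g hg z).1 hz
      refine ⟨e, he, h.mono (DT.mem (h.dev he 0) dt) (h.and hg1 he1) ?_, rfl⟩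
      rintro ξ _ ⟨h1, h2⟩
      exact mem_sUnion.2 ⟨_, h1, h2⟩
    · rintro ⟨e, he, h1, rfl⟩
      obtain ⟨w, hw, hw'⟩ := h.pick_mem (Q := fun ξ y => fapp e ξ ∈ y)
        (DT.mem (h.dev he 0) (h.zM.dvar 1)) hf ((h.congr (fun ξ _ => mem_sUnion)).1 h1)
      refine ⟨G w, (h.mem_iff hG hw hf).2 ?_, (h.mem_iff hG he hw).2 ?_⟩
      · exact h.mono (DT.mem (h.dev hw 0) (h.dev hf 0)) hw' (fun _ _ h => h.1)
      · exact h.mono (DT.mem (h.dev he 0) (h.dev hw 0)) hw' (fun _ _ h => h.2)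
  sepS := by
    intro φ v hv a ha
    obtain ⟨g, hg, rfl⟩ := mem_zimg.1 ha
    choose F hF hF' using fun n => mem_zimg.1 (hv n)
    obtain rfl : v = fun n => G (F n) := funext hF'
    let t : ZFSet → ZFSet := fun ξ => ZFSet.sep (fun x => Sat M.toSet φ
        (Function.update (fun n => fapp (F n) ξ) 0 x)) (fapp g ξ)
    have dt : DT M (fun w => t (w 0)) := by
      apply h.zM.dsep (h.dev hg 0)
      exact h.dS1 φ hF (h.zM.dvar 1) (h.zM.dvar 0) 0
    refine ⟨_, mem_zimg.2 ⟨_, h.lam (t := t) dt, rfl⟩, ?_⟩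
    intro x
    rw [h.mem_lam hG (t := t) dt]
    constructor
    · rintro ⟨e, he, h1, rfl⟩
      rw [h.mem_iff hG he hg, h.los1 hG φ hF 0 he]
      exact ⟨h.mono (DT.mem (h.dev he 0) (h.dev hg 0)) h1 (fun _ _ h => (mem_sep.1 h).1),
        h.mono (h.dS1 φ hF (h.zM.dvar 0) (h.dev he 0) 0) h1 (fun _ _ h => (mem_sep.1 h).2)⟩
    · rintro ⟨h1, h2⟩
      obtain ⟨e, he, h3, rfl⟩ := (hG g hg x).1 h1
      rw [h.los1 hG φ hF 0 he] at h2
      exact ⟨e, he, h.mono (DT.mem (h.dev he 0) dt) (h.and h3 h2) (fun _ _ h => mem_sep.2 h), rfl⟩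
  collS := by
    intro φ v hv a ha H
    obtain ⟨g, hg, rfl⟩ := mem_zimg.1 ha
    choose F hF hF' using fun n => mem_zimg.1 (hv n)
    obtain rfl : v = fun n => G (F n) := funext hF'
    let S : ZFSet → ZFSet → ZFSet → Prop := fun ξ x y => Sat M.toSet φ
      (Function.update (Function.update (fun n => fapp (F n) ξ) 0 x) 1 y)
    have dS : ∀ {a b c : (ℕ → ZFSet) → ZFSet}, DT M a → DT M b → DT M c →
      Dfn M (fun v => S (a v) (b v) (c v)) := fun ha hb hc => h.dS2 φ hF ha hb hc
    obtain ⟨k, hk, hk'⟩ := h.pick (Q := fun ξ b => ∀ x ∈ fapp g ξ, (∃ y ∈ M, S ξ x y) →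
        ∃ y ∈ b, S ξ x y) (by
        apply DT.ball h.zM.tr (h.dev hg 0)
        apply Dfn.imp
        · apply Dfn.ex
          exact dS (h.zM.dvar 2) (h.zM.dvar 1) (h.zM.dvar 0)
        · apply DT.bex h.zM.tr (h.zM.dvar 2)
          exact dS (h.zM.dvar 2) (h.zM.dvar 1) (h.zM.dvar 0)) (h.univ (by
        intro ξ hξ
        have hξM := h.zM.tr.mem_trans hξ h.hκ
        obtain ⟨b, hb, hb'⟩ := h.zM.coll (Q := fun x y => S ξ x y ∨ ¬ ∃ y ∈ M, S ξ x y) (by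
          apply Dfn.or
          · exact dS (.const hξM) (h.zM.dvar 0) (h.zM.dvar 1)
          · apply Dfn.not
            apply Dfn.ex
            exact dS (.const hξM) (h.zM.dvar 1) (h.zM.dvar 0))
          (h.zM.fapp_mem (mem_FD.1 hg).1 hξM) (by
          intro x hx
          by_cases e : ∃ y ∈ M, S ξ x y
          · obtain ⟨y, hy, e⟩ := e
            exact ⟨y, hy, Or.inl e⟩
          · exact ⟨∅, h.zM.empty, Or.inr e⟩)
        refine ⟨b, hb, ?_⟩
        intro x hx e
        obtain ⟨y, hy, hy'⟩ := hb' x hx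
        exact ⟨y, hy, hy'.resolve_right (not_not.2 e)⟩))
    refine ⟨_, mem_zimg.2 ⟨k, hk, rfl⟩, ?_⟩
    intro x hx
    obtain ⟨y, hy, hy'⟩ := H x hx
    obtain ⟨e, he, h1, rfl⟩ := (hG g hg x).1 hx
    obtain ⟨l, hl, rfl⟩ := mem_zimg.1 hy
    rw [h.los2 hG φ hF he hl] at hy'
    have d3 : Dfn M (fun v => ∃ y ∈ fapp k (v 0), S (v 0) (fapp e (v 0)) y) := by
      apply DT.bex h.zM.tr (h.dev hk 0)
      exact dS (h.zM.dvar 1) (h.dev he 1) (h.zM.dvar 0)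
    have h2 := h.mono d3 (h.and hk' (h.and h1 hy')) (by
      rintro ξ hξ ⟨a, b, c⟩
      exact a _ b ⟨_, h.zM.fapp_mem (mem_FD.1 hl).1 (h.zM.tr.mem_trans hξ h.hκ), c⟩)
    obtain ⟨m, hm, hm'⟩ := h.pick_mem (Q := fun ξ y => S ξ (fapp e ξ) y)
      (dS (h.zM.dvar 0) (h.dev he 0) (h.zM.dvar 1)) hk h2
    refine ⟨G m, (h.mem_iff hG hm hk).2 ?_, (h.los2 hG φ hF he hm).2 ?_⟩
    · exact h.mono (DT.mem (h.dev hm 0) (h.dev hk 0)) hm' (fun _ _ h => h.1)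
    · exact h.mono (dS (h.zM.dvar 0) (h.dev he 0) (h.dev hm 0)) hm' (fun _ _ h => h.2)

theorem tail {κ M U γ : ZFSet} (h : UFS κ M U) (hγ : γ ∈ κ) : UP κ U (fun ξ => γ ∈ ξ) := by
  have hγM := h.zM.tr.mem_trans hγ h.hκ
  have := h.uf.2.1 _ (h.card.succ_mem hγ)
  refine h.mono (P := fun ξ => ξ ∉ insert γ γ) (DT.mem (.const hγM) (h.zM.dvar 0)) this ?_
  intro ξ hξ hn
  rw [mem_insert_iff] at hn
  push Not at hn
  rcases (h.card.ord.mem hξ).mem_trichotomous (h.card.ord.mem hγ) with e | e | e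
  · exact absurd e hn.2
  · exact absurd e hn.1
  · exact e

theorem normal {κ M U e : ZFSet} (h : UFS κ M U) (he : e ∈ FD κ M)
    (H : UP κ U (fun ξ => fapp e ξ ∈ ξ)) : ∃ γ ∈ κ, UP κ U (fun ξ => fapp e ξ = γ) :=
  h.uf.2.2.2.2.2.2 e (mem_FD.1 he).1 (mem_FD.1 he).2 H

theorem G_con {κ M U : ZFSet.{uu}} (h : UFS κ M U) {G : ZFSet.{uu} → ZFSet.{uu}} (hG : IsUC κ M U G) :
    ∀ γ ∈ κ, G (zfun (fun _ => γ) κ) = γ := by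
  intro γ
  induction γ using ZFSet.inductionOn with
  | _ γ ih =>
    intro hγ
    have hM : ∀ {δ}, δ ∈ κ → δ ∈ M := fun hδ => h.zM.tr.mem_trans hδ h.hκ
    ext z
    rw [h.mem_lam hG (.const (hM hγ))]
    constructor
    · rintro ⟨e, he, h1, rfl⟩
      obtain ⟨δ, hδ, h2⟩ := h.normal he (h.mono (DT.mem (h.dev he 0) (h.zM.dvar 0))
        (h.and h1 (h.tail hγ)) (by
          rintro ξ hξ ⟨a, b⟩
          exact (h.card.ord.mem hξ).1.mem_trans a b))
      obtain ⟨ξ, hξ, a, b⟩ := h.exists_of (h.and h1 h2)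
      rw [b] at a
      have : G e = G (zfun (fun _ => δ) κ) := h.eq_of hG he (h.con (hM hδ))
        ((h.congr (fun ξ hξ => by rw [fapp_zfun hξ])).1 h2)
      rw [this, ih δ a hδ]
      exact a
    · intro hz
      have hzκ := h.card.ord.1.mem_trans hz hγ
      refine ⟨_, h.con (hM hzκ), h.univ ?_, (ih z hz hzκ).symm⟩
      intro ξ hξ
      rw [fapp_zfun hξ]
      exact hz

theorem G_id {κ M U : ZFSet.{uu}} (h : UFS κ M U) {G : ZFSet.{uu} → ZFSet.{uu}} (hG : IsUC κ M U G) :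
    G (zfun (fun x => x) κ) = κ := by
  have hM : ∀ {δ}, δ ∈ κ → δ ∈ M := fun hδ => h.zM.tr.mem_trans hδ h.hκ
  ext z
  rw [h.mem_lam hG (h.zM.dvar 0)]
  constructor
  · rintro ⟨e, he, h1, rfl⟩
    obtain ⟨δ, hδ, h2⟩ := h.normal he h1
    have : G e = G (zfun (fun _ => δ) κ) := h.eq_of hG he (h.con (hM hδ))
      ((h.congr (fun ξ hξ => by rw [fapp_zfun hξ])).1 h2)
    rw [this, h.G_con hG δ hδ]
    exact hδ
  · intro hz
    refine ⟨_, h.con (hM hz), ?_, (h.G_con hG z hz).symm⟩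
    exact (h.congr (fun ξ hξ => by rw [fapp_zfun hξ])).1 (h.tail hz)

theorem N_kappa {κ M U : ZFSet.{uu}} (h : UFS κ M U) {G : ZFSet.{uu} → ZFSet.{uu}} (hG : IsUC κ M U G) :
    κ ∈ zimg G (FD κ M) := mem_zimg.2 ⟨_, h.idf, (h.G_id hG).symm⟩

theorem N_subset {κ M U : ZFSet.{uu}} (h : UFS κ M U) {G : ZFSet.{uu} → ZFSet.{uu}} (hG : IsUC κ M U G)
    {A : ZFSet} (hA : A ∈ M) (hAκ : A ⊆ κ) : A ∈ zimg G (FD κ M) := by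
  have hM : ∀ {δ}, δ ∈ κ → δ ∈ M := fun hδ => h.zM.tr.mem_trans hδ h.hκ
  have zN := h.N_zfm hG
  have : A = ZFSet.sep (fun γ => γ ∈ G (zfun (fun _ => A) κ)) κ := by
    ext γ
    rw [mem_sep]
    have key : γ ∈ κ → (γ ∈ G (zfun (fun _ => A) κ) ↔ γ ∈ A) := by
      intro hγ
      conv_lhs => rw [← h.G_con hG γ hγ]
      rw [h.mem_iff hG (h.con (hM hγ)) (h.con hA)]
      constructor
      · intro h1
        obtain ⟨ξ, hξ, h2⟩ := h.exists_of h1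
        rwa [fapp_zfun hξ, fapp_zfun hξ] at h2
      · intro h1
        refine h.univ ?_
        intro ξ hξ
        rwa [fapp_zfun hξ, fapp_zfun hξ]
    constructor
    · intro h1
      exact ⟨hAκ h1, (key (hAκ h1)).2 h1⟩
    · rintro ⟨h1, h2⟩
      exact (key h1).1 h2
  rw [this]
  apply zN.sep _ (h.N_kappa hG)
  exact DT.mem (zN.dvar 0) (.const (mem_zimg.2 ⟨_, h.con hA, rfl⟩))

theorem N_mem {κ M U N : ZFSet.{uu}} (h : UFS κ M U) {G : ZFSet.{uu} → ZFSet.{uu}} (hG : IsUC κ M U G)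
    (hN : ZFm N) (hκN : κ ∈ N) (hM : M ∈ N) (hU : U ∈ N) : zimg G (FD κ M) ∈ N := by
  have hD : FD κ M ∈ N := by
    unfold FD
    apply hN.sep _ hM
    simp only [isZFunc_iff]
    apply DT.eq (hN.dvar 0)
    apply hN.dzfun (.const hκN)
    exact hN.dfapp (hN.dvar 1) (hN.dvar 0)
  have hE : Dfn N (fun v => (fun e f => UP κ U (fun ξ => fapp e ξ ∈ fapp f ξ)) (v 0) (v 1)) := by
    unfold UP
    apply DT.mem _ (.const hU)
    apply hN.dsep (.const hκN)
    exact DT.mem (hN.dfapp (hN.dvar 1) (hN.dvar 0)) (hN.dfapp (hN.dvar 2) (hN.dvar 0))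
  have := collapse hN hD hE hG
  have e : zimg G (FD κ M) = zimg (fapp (zfun G (FD κ M))) (FD κ M) :=
    zimg_congr (fun f hf => (fapp_zfun hf).symm)
  rw [e]
  exact hN.zimg_mem (hN.dfapp (.const this) (hN.dvar 0)) hD

end UFS



namespace UFS

theorem upair_self (x : ZFSet) : ({x, x} : ZFSet) = {x} := by ext; simp

theorem G_pair {κ M U : ZFSet.{uu}} (h : UFS κ M U) {G : ZFSet.{uu} → ZFSet.{uu}}
    (hG : IsUC κ M U G) {f g : ZFSet.{uu}} (hf : f ∈ FD κ M) (hg : g ∈ FD κ M) :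
    G (zfun (fun ξ => ZFSet.pair (fapp f ξ) (fapp g ξ)) κ) = ZFSet.pair (G f) (G g) := by
  have h1 : zfun (fun ξ => ({fapp f ξ, fapp f ξ} : ZFSet.{uu})) κ ∈ FD κ M :=
    h.lam (t := fun ξ => ({fapp f ξ, fapp f ξ} : ZFSet.{uu})) (h.zM.dupair (h.dev hf 0) (h.dev hf 0))
  have h2 : zfun (fun ξ => ({fapp f ξ, fapp g ξ} : ZFSet.{uu})) κ ∈ FD κ M :=
    h.lam (t := fun ξ => ({fapp f ξ, fapp g ξ} : ZFSet.{uu})) (h.zM.dupair (h.dev hf 0) (h.dev hg 0))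
  have h3 := h.G_upair hG h1 h2
  rw [h.G_upair hG hf hf, h.G_upair hG hf hg, upair_self] at h3
  unfold ZFSet.pair
  rw [← h3]
  congr 1
  refine (isZFunc_zfun _ _).ext (isZFunc_zfun _ _) ?_
  intro ξ hξ
  rw [fapp_zfun hξ, fapp_zfun hξ, fapp_zfun hξ, fapp_zfun hξ, upair_self]

theorem G_app {κ M U : ZFSet.{uu}} (h : UFS κ M U) {G : ZFSet.{uu} → ZFSet.{uu}}
    (hG : IsUC κ M U G) {f : ZFSet.{uu}} (hf : f ∈ FD κ M) :
    fapp (G (zfun (fun _ => f) κ)) κ = G f := by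
  have hfM := (mem_FD.1 hf).1
  have zN := h.N_zfm hG
  have key : ∀ k ∈ FD κ M, (ZFSet.pair κ (G k) ∈ G (zfun (fun _ => f) κ) ↔ G f = G k) := by
    intro k hk
    have h1 : zfun (fun ξ => ZFSet.pair (fapp (zfun (fun x => x) κ) ξ) (fapp k ξ)) κ ∈ FD κ M :=
      h.lam (t := fun ξ => ZFSet.pair (fapp (zfun (fun x => x) κ) ξ) (fapp k ξ))
        (h.zM.dpair (h.dev h.idf 0) (h.dev hk 0))
    have h2 := h.G_pair hG h.idf hk
    rw [h.G_id hG] at h2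
    rw [← h2, h.mem_iff hG h1 (h.con hfM), h.eq_iff hG hf hk]
    apply h.congr
    intro ξ hξ
    rw [fapp_zfun hξ, fapp_zfun hξ, fapp_zfun hξ]
    exact (mem_FD.1 hf).2.pair_mem_iff hξ
  refine fapp_eq ((key f hf).2 rfl) ?_
  intro b hb
  have hb' := (zN.of_pair_mem (zN.tr.mem_trans hb (mem_zimg.2 ⟨_, h.con hfM, rfl⟩))).2
  obtain ⟨k, hk, rfl⟩ := mem_zimg.1 hb'
  exact ((key k hk).1 hb).symm

theorem UP_const {κ M U : ZFSet} (h : UFS κ M U) {p : Prop} : UP κ U (fun _ => p) ↔ p := by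
  constructor
  · intro h1
    obtain ⟨_, _, h2⟩ := h.exists_of h1
    exact h2
  · intro h1
    exact h.univ (fun _ _ => h1)

theorem isEmb {κ M U : ZFSet.{uu}} (h : UFS κ M U) {G : ZFSet.{uu} → ZFSet.{uu}}
    (hG : IsUC κ M U G) :
    IsUltrapowerEmb κ M U (zimg G (FD κ M)) (fun x => G (zfun (fun _ => x) κ)) := by
  refine ⟨h.N_tr hG, fun x hx => mem_zimg.2 ⟨_, h.con hx, rfl⟩, ?_, ?_, ?_⟩
  · intro φ v hv
    have := h.los hG φ (fun n => zfun (fun _ => v n) κ) (fun n => h.con (hv n))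
    rw [this]
    refine Iff.trans h.UP_const.symm (h.congr ?_)
    intro ξ hξ
    simp only [fapp_zfun hξ]
  · intro a ha
    obtain ⟨f, hf, rfl⟩ := mem_zimg.1 ha
    refine ⟨f, (mem_FD.1 hf).1, (mem_FD.1 hf).2, ?_, h.G_app hG hf⟩
    intro ξ hξ
    exact h.zM.fapp_mem (mem_FD.1 hf).1 (h.zM.tr.mem_trans hξ h.hκ)
  · intro A hA hAκ
    show A ∈ U ↔ κ ∈ G (zfun (fun _ => A) κ)
    have e : κ ∈ G (zfun (fun _ => A) κ) ↔ G (zfun (fun x => x) κ) ∈ G (zfun (fun _ => A) κ) := by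
      rw [h.G_id hG]
    rw [e, h.mem_iff hG h.idf (h.con hA)]
    unfold UP
    have : ZFSet.sep (fun ξ => fapp (zfun (fun x => x) κ) ξ ∈ fapp (zfun (fun _ => A) κ) ξ) κ = A := by
      ext ξ
      rw [mem_sep]
      constructor
      · rintro ⟨h1, h2⟩
        rwa [fapp_zfun h1, fapp_zfun h1] at h2
      · intro h1
        have h2 := hAκ h1
        rw [fapp_zfun h2, fapp_zfun h2]
        exact ⟨h2, h1⟩
    rw [this]

theorem exists_UC {κ M U : ZFSet.{uu}} (_ : UFS κ M U) (ho : OmegaOneIntersecting U) :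
    ∃ G : ZFSet.{uu} → ZFSet.{uu}, IsUC κ M U G := by
  have wf : WellFounded (fun a b => a ∈ FD κ M ∧
      (fun e f => UP κ U (fun ξ => fapp e ξ ∈ fapp f ξ)) a b) := by
    rw [wellFounded_iff_isEmpty_descending_chain]
    constructor
    rintro ⟨s, hs⟩
    obtain ⟨ξ, hξ⟩ := ho (fun n => ZFSet.sep (fun ξ => fapp (s (n + 1)) ξ ∈ fapp (s n) ξ) κ)
      (fun n => (hs n).2)
    have : WellFounded (fun a b : ZFSet.{uu} => a ∈ b) := ZFSet.mem_wf
    rw [wellFounded_iff_isEmpty_descending_chain] at this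
    exact this.false ⟨fun n => fapp (s n) ξ, fun n => (mem_sep.1 (hξ n)).2⟩
  obtain ⟨G, hG⟩ := exists_collapse wf
  exact ⟨G, fun f _ z => hG f z⟩

end UFS



/-- Conjunction of formulas. -/
def Fml.conj (φ ψ : Fml) : Fml := .neg (.impl φ (.neg ψ))
/-- Disjunction of formulas. -/
def Fml.disj (φ ψ : Fml) : Fml := .impl (.neg φ) ψ
/-- Equivalence of formulas. -/
def Fml.equi (φ ψ : Fml) : Fml := .conj (.impl φ ψ) (.impl ψ φ)
/-- Existential quantification. -/
def Fml.exi (n : ℕ) (φ : Fml) : Fml := .neg (.all n (.neg φ))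

theorem sat_conj {D : Set ZFSet} {φ ψ : Fml} {v : ℕ → ZFSet} :
    Sat D (φ.conj ψ) v ↔ Sat D φ v ∧ Sat D ψ v := by
  simp only [Fml.conj, Sat]; tauto

theorem sat_disj {D : Set ZFSet} {φ ψ : Fml} {v : ℕ → ZFSet} :
    Sat D (φ.disj ψ) v ↔ Sat D φ v ∨ Sat D ψ v := by
  simp only [Fml.disj, Sat]; tauto

theorem sat_equi {D : Set ZFSet} {φ ψ : Fml} {v : ℕ → ZFSet} :
    Sat D (φ.equi ψ) v ↔ (Sat D φ v ↔ Sat D ψ v) := by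
  simp only [Fml.equi, sat_conj, Sat]; tauto

theorem sat_exi {D : Set ZFSet} {φ : Fml} {v : ℕ → ZFSet} {n : ℕ} :
    Sat D (φ.exi n) v ↔ ∃ x ∈ D, Sat D φ (Function.update v n x) := by
  simp only [Fml.exi, Sat]; push Not; rfl

/-- `x = {a, b}` -/
def upF (x a b : ℕ) : Fml := .all 9 (.equi (.mem 9 x) (.disj (.eq 9 a) (.eq 9 b)))

theorem sat_upF {D : ZFSet} (hD : D.IsTransitive) {v : ℕ → ZFSet} (hv : ∀ n, v n ∈ D)
    {x a b : ℕ} (hx : x < 9) (ha : a < 9) (hb : b < 9) :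
    Sat D.toSet (upF x a b) v ↔ v x = {v a, v b} := by
  have e1 : x ≠ 9 := by omega
  have e2 : a ≠ 9 := by omega
  have e3 : b ≠ 9 := by omega
  simp only [upF, Sat, sat_equi, sat_disj, Function.update_self, Function.update_of_ne e1,
    Function.update_of_ne e2, Function.update_of_ne e3, mem_toSet_iff]
  constructor
  · intro h
    ext z
    rw [mem_pair]
    constructor
    · intro hz
      exact (h z (hD.mem_trans hz (hv x))).1 hz
    · intro hz
      refine (h z ?_).2 hz
      rcases hz with rfl | rfl
      exacts [hv a, hv b]
  · intro h z _
    rw [h, mem_pair]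

/-- `(a, b) ∈ f` -/
def pinF (a b f : ℕ) : Fml := .exi 7 (.conj (.mem 7 f)
  (.conj (.exi 8 (.conj (.mem 8 7) (upF 8 a a)))
    (.conj (.exi 8 (.conj (.mem 8 7) (upF 8 a b)))
      (.all 8 (.impl (.mem 8 7) (.disj (upF 8 a a) (upF 8 a b)))))))

theorem sat_pinF {D : ZFSet} (hD : D.IsTransitive) {v : ℕ → ZFSet} (hv : ∀ n, v n ∈ D)
    {a b f : ℕ} (ha : a < 7) (hb : b < 7) (hf : f < 7) :
    Sat D.toSet (pinF a b f) v ↔ ZFSet.pair (v a) (v b) ∈ v f := by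
  have a1 : a ≠ 7 := by omega
  have a2 : a ≠ 8 := by omega
  have b1 : b ≠ 7 := by omega
  have b2 : b ≠ 8 := by omega
  have f1 : f ≠ 7 := by omega
  have key : ∀ p ∈ D, (Sat D.toSet (Fml.conj (.mem 7 f)
  (.conj (.exi 8 (.conj (.mem 8 7) (upF 8 a a)))
    (.conj (.exi 8 (.conj (.mem 8 7) (upF 8 a b)))
      (.all 8 (.impl (.mem 8 7) (.disj (upF 8 a a) (upF 8 a b))))))) (Function.update v 7 p) ↔
      p ∈ v f ∧ p = ZFSet.pair (v a) (v b)) := by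
    intro p hp
    have h1 := upd_mem hv 7 hp
    have h2 : ∀ x ∈ D, (Sat D.toSet (upF 8 a a) (Function.update (Function.update v 7 p) 8 x) ↔
        x = {v a, v a}) := by
      intro x hx
      rw [sat_upF hD (upd_mem h1 8 hx) (by omega) (by omega) (by omega)]
      simp only [Function.update_self, Function.update_of_ne a1, Function.update_of_ne a2]
    have h3 : ∀ x ∈ D, (Sat D.toSet (upF 8 a b) (Function.update (Function.update v 7 p) 8 x) ↔
        x = {v a, v b}) := by
      intro x hx
      rw [sat_upF hD (upd_mem h1 8 hx) (by omega) (by omega) (by omega)]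
      simp only [Function.update_self, Function.update_of_ne a1, Function.update_of_ne a2,
        Function.update_of_ne b1, Function.update_of_ne b2]
    have n7 : (7 : ℕ) ≠ 8 := by omega
    simp only [sat_conj, sat_exi, sat_disj, Sat, Function.update_self, Function.update_of_ne f1,
      Function.update_of_ne n7, mem_toSet_iff]
    refine and_congr_right fun _ => ?_
    have tr : ∀ x ∈ p, x ∈ D := fun x hx => hD.mem_trans hx hp
    have e0 : ({v a} : ZFSet) = {v a, v a} := by ext; simp
    constructor
    · rintro ⟨⟨x, hx, hxp, hx'⟩, ⟨y, hy, hyp, hy'⟩, h4⟩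
      rw [h2 x hx] at hx'
      rw [h3 y hy] at hy'
      subst hx' hy'
      ext z
      unfold ZFSet.pair
      rw [mem_pair, e0]
      constructor
      · intro hz
        have := h4 z (tr z hz) hz
        rwa [h2 z (tr z hz), h3 z (tr z hz)] at this
      · rintro (rfl | rfl) <;> assumption
    · intro e
      have m1 : ({v a, v a} : ZFSet) ∈ p := by rw [e, ← e0]; simp [ZFSet.pair]
      have m2 : ({v a, v b} : ZFSet) ∈ p := by rw [e]; simp [ZFSet.pair]
      refine ⟨⟨_, tr _ m1, m1, (h2 _ (tr _ m1)).2 rfl⟩, ⟨_, tr _ m2, m2, (h3 _ (tr _ m2)).2 rfl⟩, ?_⟩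
      intro x hx hxp
      rw [h2 x hx, h3 x hx]
      rw [e] at hxp
      unfold ZFSet.pair at hxp
      rwa [mem_pair, e0] at hxp
  unfold pinF
  rw [sat_exi]
  constructor
  · rintro ⟨p, hp, h⟩
    obtain ⟨h1, rfl⟩ := (key p hp).1 h
    exact h1
  · intro h
    have hp := hD.mem_trans h (hv f)
    exact ⟨_, hp, (key _ hp).2 ⟨h, rfl⟩⟩

/-- `f` is single-valued and total on `K`. -/
def fmA : Fml := .all 4 (.impl (.mem 4 0) (.exi 5 (.all 6 (.equi (pinF 4 6 1) (.eq 6 5)))))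

theorem sat_fmA {D : ZFSet} (hD : D.IsTransitive) {v : ℕ → ZFSet} (hv : ∀ n, v n ∈ D) :
    Sat D.toSet fmA v ↔ ∀ ξ ∈ D, ξ ∈ v 0 → ∃ b ∈ D, ∀ c ∈ D, (ZFSet.pair ξ c ∈ v 1 ↔ c = b) := by
  simp only [fmA, Sat, sat_exi, sat_equi, mem_toSet_iff]
  refine forall_congr' fun ξ => forall_congr' fun hξ => ?_
  have e : Function.update v 4 ξ 0 = v 0 := by simp [Function.update]
  rw [e, Function.update_self]
  refine forall_congr' fun _ => exists_congr fun b => and_congr_right fun hb =>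
    forall_congr' fun c => forall_congr' fun hc => ?_
  rw [sat_pinF hD (upd_mem (upd_mem (upd_mem hv 4 hξ) 5 hb) 6 hc) (by omega) (by omega) (by omega)]
  simp [Function.update]

/-- `A` is the set of `ξ ∈ K` with `f ξ ∈ g ξ`. -/
def fmB : Fml := .all 4 (.equi (.mem 4 3) (.conj (.mem 4 0) (.exi 5 (.exi 6
  (.conj (pinF 4 5 1) (.conj (pinF 4 6 2) (.mem 5 6)))))))

theorem sat_fmB {D : ZFSet} (hD : D.IsTransitive) {v : ℕ → ZFSet} (hv : ∀ n, v n ∈ D) :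
    Sat D.toSet fmB v ↔ ∀ ξ ∈ D, (ξ ∈ v 3 ↔ ξ ∈ v 0 ∧ ∃ b ∈ D, ∃ c ∈ D,
      (ZFSet.pair ξ b ∈ v 1 ∧ ZFSet.pair ξ c ∈ v 2 ∧ b ∈ c)) := by
  simp only [fmB, Sat, sat_exi, sat_equi, sat_conj, mem_toSet_iff]
  refine forall_congr' fun ξ => forall_congr' fun hξ => ?_
  have e : Function.update v 4 ξ 0 = v 0 := by simp [Function.update]
  have e' : Function.update v 4 ξ 3 = v 3 := by simp [Function.update]
  rw [e, e', Function.update_self]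
  refine iff_congr Iff.rfl (and_congr_right fun _ => exists_congr fun b => and_congr_right fun hb =>
    exists_congr fun c => and_congr_right fun hc => ?_)
  have hv' := upd_mem (upd_mem (upd_mem hv 4 hξ) 5 hb) 6 hc
  rw [sat_pinF hD hv' (by omega) (by omega) (by omega), sat_pinF hD hv' (by omega) (by omega) (by omega)]
  simp [Function.update]

namespace UFS

theorem emb_app {κ M U N : ZFSet.{uu}} (h : UFS κ M U) {j : ZFSet.{uu} → ZFSet.{uu}}
    (hj : IsUltrapowerEmb κ M U N j) {f : ZFSet.{uu}} (hf : f ∈ FD κ M) :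
    fapp (j f) κ ∈ N ∧ ∀ c ∈ N, (ZFSet.pair κ c ∈ j f ↔ c = fapp (j f) κ) := by
  obtain ⟨trN, jN, el, -, hU⟩ := hj
  have hfM := (mem_FD.1 hf).1
  let v : ℕ → ZFSet.{uu} := fun n => if n = 0 then κ else f
  have hv : ∀ n, v n ∈ M := by
    intro n
    by_cases e : n = 0
    · simp only [v, if_pos e]; exact h.hκ
    · simp only [v, if_neg e]; exact hfM
  have h1 := (el fmA v hv).1 ((sat_fmA h.zM.tr hv).2 (by
    intro ξ hξ hξκ
    refine ⟨fapp f ξ, h.zM.fapp_mem hfM hξ, fun c _ => ?_⟩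
    show ZFSet.pair ξ c ∈ f ↔ _
    rw [(mem_FD.1 hf).2.pair_mem_iff hξκ, eq_comm]))
  rw [sat_fmA trN (fun n => jN _ (hv n))] at h1
  have hk : κ ∈ j κ := (hU κ h.hκ (fun _ h => h)).1 h.kmem
  obtain ⟨b, hb, hb'⟩ := h1 κ (trN.mem_trans hk (jN _ h.hκ)) hk
  have hb' : ∀ c ∈ N, (ZFSet.pair κ c ∈ j f ↔ c = b) := hb'
  have e : fapp (j f) κ = b := by
    refine fapp_eq ((hb' b hb).2 rfl) ?_
    intro c hc
    refine (hb' c ?_).1 hc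
    have h2 := trN.mem_trans hc (jN _ hfM)
    have h3 : ({κ, c} : ZFSet) ∈ N := trN.mem_trans (by simp [ZFSet.pair]) h2
    exact trN.mem_trans (by simp) h3
  rw [e]
  exact ⟨hb, hb'⟩

theorem emb_mem {κ M U N : ZFSet.{uu}} (h : UFS κ M U) {j : ZFSet.{uu} → ZFSet.{uu}}
    (hj : IsUltrapowerEmb κ M U N j) {f g : ZFSet.{uu}} (hf : f ∈ FD κ M) (hg : g ∈ FD κ M) :
    UP κ U (fun ξ => fapp f ξ ∈ fapp g ξ) ↔ fapp (j f) κ ∈ fapp (j g) κ := by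
  obtain ⟨f1, f2⟩ := h.emb_app hj hf
  obtain ⟨g1, g2⟩ := h.emb_app hj hg
  obtain ⟨trN, jN, el, -, hU⟩ := hj
  have hfM := (mem_FD.1 hf).1
  have hgM := (mem_FD.1 hg).1
  obtain ⟨A, hAd⟩ : ∃ A, A = ZFSet.sep (fun ξ => fapp f ξ ∈ fapp g ξ) κ := ⟨_, rfl⟩
  have hA : A ∈ M := by
    rw [hAd]
    exact h.zM.sep (Q := fun ξ => fapp f ξ ∈ fapp g ξ) (DT.mem (h.dev hf 0) (h.dev hg 0)) h.hκ
  have hAκ : A ⊆ κ := by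
    rw [hAd]
    exact fun x hx => (mem_sep.1 hx).1
  let v : ℕ → ZFSet.{uu} := fun n => if n = 0 then κ else if n = 1 then f else if n = 2 then g else A
  have hv : ∀ n, v n ∈ M := by
    intro n
    simp only [v]
    split_ifs
    exacts [h.hκ, hfM, hgM, hA]
  have h1 := (el fmB v hv).1 ((sat_fmB h.zM.tr hv).2 (by
    intro ξ hξ
    show ξ ∈ A ↔ ξ ∈ κ ∧ ∃ b ∈ M, ∃ c ∈ M, ZFSet.pair ξ b ∈ f ∧ ZFSet.pair ξ c ∈ g ∧ b ∈ c
    rw [hAd, mem_sep]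
    refine and_congr_right fun hξκ => ?_
    constructor
    · intro h2
      exact ⟨_, h.zM.fapp_mem hfM hξ, _, h.zM.fapp_mem hgM hξ,
        ((mem_FD.1 hf).2.pair_mem_iff hξκ).2 rfl, ((mem_FD.1 hg).2.pair_mem_iff hξκ).2 rfl, h2⟩
    · rintro ⟨b, _, c, _, h3, h4, h5⟩
      rw [(mem_FD.1 hf).2.pair_mem_iff hξκ] at h3
      rw [(mem_FD.1 hg).2.pair_mem_iff hξκ] at h4
      rw [h3, h4]
      exact h5))
  rw [sat_fmB trN (fun n => jN _ (hv n))] at h1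
  have hk : κ ∈ j κ := (hU κ h.hκ (fun _ h => h)).1 h.kmem
  have h2 : κ ∈ j A ↔ κ ∈ j κ ∧ ∃ b ∈ N, ∃ c ∈ N,
    ZFSet.pair κ b ∈ j f ∧ ZFSet.pair κ c ∈ j g ∧ b ∈ c := h1 κ (trN.mem_trans hk (jN _ h.hκ))
  unfold UP
  rw [← hAd, hU A hA hAκ, h2]
  constructor
  · rintro ⟨_, b, hb, c, hc, h3, h4, h5⟩
    rw [f2 b hb] at h3
    rw [g2 c hc] at h4
    rw [← h3, ← h4]
    exact h5
  · intro h3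
    exact ⟨hk, _, f1, _, g1, (f2 _ f1).2 rfl, (g2 _ g1).2 rfl, h3⟩

theorem emb_UC {κ M U N : ZFSet.{uu}} (h : UFS κ M U) {j : ZFSet.{uu} → ZFSet.{uu}}
    (hj : IsUltrapowerEmb κ M U N j) :
    ∃ G : ZFSet.{uu} → ZFSet.{uu}, IsUC κ M U G ∧ N = zimg G (FD κ M) := by
  refine ⟨fun f => fapp (j f) κ, ?_, ?_⟩
  · intro f hf z
    constructor
    · intro hz
      have hzN := hj.1.mem_trans hz (h.emb_app hj hf).1
      obtain ⟨e, he, he1, -, rfl⟩ := hj.2.2.2.1 z hzN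
      have he' : e ∈ FD κ M := mem_FD.2 ⟨he, he1⟩
      exact ⟨e, he', (h.emb_mem hj he' hf).2 hz, rfl⟩
    · rintro ⟨e, he, h1, rfl⟩
      exact (h.emb_mem hj he hf).1 h1
  · ext z
    rw [mem_zimg]
    constructor
    · intro hz
      obtain ⟨e, he, he1, -, rfl⟩ := hj.2.2.2.1 z hz
      exact ⟨e, mem_FD.2 ⟨he, he1⟩, rfl⟩
    · rintro ⟨e, he, rfl⟩
      exact (h.emb_app hj he).1

end UFS



theorem IsSUMeasure.spec {κ U : ZFSet} (h : IsSUMeasure κ U) : IsMUModel κ U (MU κ U) := by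
  unfold MU
  rw [dif_pos h.2.2]
  exact h.2.2.choose_spec

theorem IsSUMeasure.ufs {κ U : ZFSet} (hκ : IsCard κ) (h : IsSUMeasure κ U) :
    UFS κ (MU κ U) U :=
  ⟨h.spec.1.infCard hκ, h.spec.1.1, h.spec.1.2.1, h.spec.2.2.1⟩

theorem NU_spec {κ U : ZFSet.{uu}} (hκ : IsCard κ) (h : IsRamseyMeasure κ U) :
    ∃ G : ZFSet.{uu} → ZFSet.{uu}, IsUC κ (MU κ U) U G ∧ NU κ U = zimg G (FD κ (MU κ U)) := by
  have hu := h.1.ufs hκ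
  obtain ⟨G, hG⟩ := hu.exists_UC h.2.2
  have hex : ∃ p : ZFSet.{uu} × (ZFSet.{uu} → ZFSet.{uu}),
      IsUltrapowerEmb κ (MU κ U) U p.1 p.2 := ⟨(_, _), hu.isEmb hG⟩
  have : IsUltrapowerEmb κ (MU κ U) U (upData κ U).1 (upData κ U).2 := by
    unfold upData
    rw [dif_pos hex]
    exact hex.choose_spec
  exact hu.emb_UC this

theorem NU_zfm {κ U : ZFSet.{uu}} (hκ : IsCard κ) (h : IsRamseyMeasure κ U) : ZFm (NU κ U) := by
  obtain ⟨G, hG, e⟩ := NU_spec hκ h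
  rw [e]
  exact (h.1.ufs hκ).N_zfm hG

theorem NU_sub {κ U A : ZFSet.{uu}} (hκ : IsCard κ) (h : IsRamseyMeasure κ U)
    (hA : A ⊆ κ) (hg : AGood κ A U) : A ∈ NU κ U := by
  obtain ⟨G, hG, e⟩ := NU_spec hκ h
  rw [e]
  exact (h.1.ufs hκ).N_subset hG hg hA

theorem NU_mem {κ U W : ZFSet.{uu}} (hκ : IsCard κ) (hU : IsRamseyMeasure κ U)
    (hW : IsRamseyMeasure κ W) (h : U ∈ NU κ W) : NU κ U ∈ NU κ W := by
  have zN := NU_zfm hκ hW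
  have hκN : κ ∈ NU κ W := by
    obtain ⟨G, hG, e⟩ := NU_spec hκ hW
    rw [e]
    exact (hW.1.ufs hκ).N_kappa hG
  have hu := hU.1.ufs hκ
  have hM := MU_mem hu.card hU.1.spec zN hκN h
  obtain ⟨G, hG, e⟩ := NU_spec hκ hU
  rw [e]
  exact hu.N_mem hG zN hκN hM h

theorem ramseyIn {κ U N : ZFSet.{uu}} (hU : IsRamseyMeasure κ U) (h : U ∈ N) :
    RamseyMeasureIn N κ U := by
  refine ⟨h, hU.1, hU.2.1, ?_⟩
  intro f _ _ hf
  obtain ⟨x, hx⟩ := hU.2.2 (fun n => fapp f (vnat n)) (fun n => hf _ (vnat_omega n))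
  refine ⟨x, ?_⟩
  intro n hn
  obtain ⟨k, rfl⟩ := mem_omega hn
  exact hx k

end Helpers

/-- For any cardinal `κ`, the M-order `◁` on witness collections of
Ramsey measures on `κ` is transitive and well-founded. -/
theorem mOrder_transitive_wellFounded (κ : ZFSet) (hκ : IsCard κ) :
    Transitive (MOrder IsRamseyMeasure RamseyMeasureIn κ) ∧
    WellFounded (MOrder IsRamseyMeasure RamseyMeasureIn κ) := by
  constructor
  · rintro 𝒰 𝒲 𝒴 ⟨hU, hW, h1, h2⟩ ⟨_, hY, h3, h4⟩
    refine ⟨hU, hY, ?_, ?_⟩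
    · intro Y hYY A hA hAκ
      obtain ⟨W, hWW, hWN, hg, _⟩ := h3 Y hYY A hA hAκ
      obtain ⟨V, hVU, hVN, hg', _⟩ := h1 W hWW A (NU_sub hκ (hW.1 W hWW) hAκ hg) hAκ
      have hN := NU_mem hκ (hW.1 W hWW) (hY.1 Y hYY) hWN
      have hV := (NU_zfm hκ (hY.1 Y hYY)).tr.mem_trans hVN hN
      exact ⟨V, hVU, hV, hg', ramseyIn (hU.1 V hVU) hV⟩
    · intro V hV
      obtain ⟨W, hWW, hVW⟩ := h2 V hV
      obtain ⟨Y, hYY, hWY⟩ := h4 W hWW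
      exact ⟨Y, hYY, (NU_zfm hκ (hY.1 Y hYY)).tr.mem_trans hVW
        (NU_mem hκ (hW.1 W hWW) (hY.1 Y hYY) hWY)⟩
  · have key : ∀ x : ZFSet, ∀ W, NU κ W = x → ∀ 𝒲, W ∈ 𝒲 →
        Acc (MOrder IsRamseyMeasure RamseyMeasureIn κ) 𝒲 := by
      intro x
      induction x using ZFSet.inductionOn with
      | _ x ih =>
        rintro W rfl 𝒲 hW
        constructor
        rintro 𝒰 ⟨hU, hW', h1, _⟩
        obtain ⟨V, hVU, hVN, _⟩ := h1 W hW ∅ (NU_zfm hκ (hW'.1 W hW)).empty (ZFSet.empty_subset κ)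
        exact ih _ (NU_mem hκ (hU.1 V hVU) (hW'.1 W hW) hVN) V rfl 𝒰 hVU
    constructor
    intro 𝒲
    constructor
    rintro 𝒰 ⟨hU, _⟩
    obtain ⟨V, hV, _⟩ := hU.2 ∅ (ZFSet.empty_subset κ)
    exact key _ V rfl 𝒰 hV

end MPaper
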